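/- For every integer q > 2, the group homology of Γ = PSL_2(O_{-13}) with trivial ℤ/3-coefficients satisfies: dim_{F_3} H_q(Γ; ℤ/3) = 2 if q ≡ 0 or 2 (mod 4); dim_{F_3} H_q(Γ; ℤ/3) = 4 if q ≡ 3 (mod 4); and dim_{F_3} H_q(Γ; ℤ/3) = 0 if q ≡ 1 (mod 4), where each H_q(Γ; ℤ/3) is a vector space over the field F_3 with three elements. -/

import Mathlib

/-!
Group homology via the inhomogeneous bar complex (trivial coefficients).
-/

namespace BarHomology

/-- The `n`-th term of the inhomogeneous bar complex of `G` with trivial coefficients in `A`. -/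
abbrev chains (G : Type) (A : Type) [AddCommGroup A] (n : ℕ) : Type := (Fin n → G) →₀ A

/-- The differential of the inhomogeneous bar complex with trivial coefficients:
`d (g₁, …, g_{n+1}) = (g₂, …, g_{n+1}) + ∑_{j=1}^{n} (-1)^j (g₁, …, g_j g_{j+1}, …, g_{n+1})
  + (-1)^{n+1} (g₁, …, g_n)`. -/
noncomputable def d (k : Type) [CommRing k] (G : Type) [Group G] (A : Type) [AddCommGroup A]
    [Module k A] (n : ℕ) : chains G A (n + 1) →ₗ[k] chains G A n :=
  Finsupp.lsum k fun g =>
    (Finsupp.lsingle (fun i => g i.succ) : A →ₗ[k] chains G A n)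
      + ∑ j : Fin (n + 1),
          ((-1 : k) ^ ((j : ℕ) + 1)) • (Finsupp.lsingle (Fin.contractNth j (· * ·) g))

/-- The cycles: everything in degree `0`, the kernel of the differential in positive degrees. -/
noncomputable def cycles (k : Type) [CommRing k] (G : Type) [Group G] (A : Type) [AddCommGroup A]
    [Module k A] : (n : ℕ) → Submodule k (chains G A n)
  | 0 => ⊤
  | (n + 1) => LinearMap.ker (d k G A n)

/-- The boundaries, viewed as a submodule of the cycles. -/
noncomputable def boundariesIn (k : Type) [CommRing k] (G : Type) [Group G] (A : Type)
    [AddCommGroup A] [Module k A] (n : ℕ) : Submodule k (cycles k G A n) :=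
  (LinearMap.range (d k G A n)).comap (cycles k G A n).subtype

/-- Group homology of `G` in degree `n` with trivial coefficients in the `k`-module `A`,
defined as cycles modulo boundaries in the inhomogeneous bar complex. -/
abbrev GroupHomology (k : Type) [CommRing k] (G : Type) [Group G] (A : Type) [AddCommGroup A]
    [Module k A] (n : ℕ) : Type :=
  ↥(cycles k G A n) ⧸ boundariesIn k G A n

section Maps

variable {k : Type} [CommRing k] {G G' : Type} [Group G] [Group G'] {A : Type} [AddCommGroup A]
  [Module k A]

/-- The chain map induced by a group homomorphism. -/
noncomputable def chainsMap (k : Type) [CommRing k] (A : Type) [AddCommGroup A] [Module k A]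
    (φ : G →* G') (n : ℕ) : chains G A n →ₗ[k] chains G' A n :=
  Finsupp.lmapDomain A k (fun f => φ ∘ f)

lemma comp_contractNth (φ : G →* G') {n : ℕ} (j : Fin (n + 1)) (g : Fin (n + 1) → G) :
    φ ∘ Fin.contractNth j (· * ·) g = Fin.contractNth j (· * ·) (φ ∘ g) := by
  funext i
  rcases lt_trichotomy (i : ℕ) (j : ℕ) with h | h | h
  · simp [Function.comp_apply, Fin.contractNth_apply_of_lt _ _ _ _ h]
  · simp [Function.comp_apply, Fin.contractNth_apply_of_eq _ _ _ _ h, map_mul]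
  · simp [Function.comp_apply, Fin.contractNth_apply_of_gt _ _ _ _ h]

lemma chainsMap_comm (φ : G →* G') (n : ℕ) :
    (d k G' A n).comp (chainsMap k A φ (n + 1))
      = (chainsMap k A φ n).comp (d k G A n) := by
  apply Finsupp.lhom_ext
  intro g a
  simp only [LinearMap.comp_apply, chainsMap, Finsupp.lmapDomain_apply, Finsupp.mapDomain_single,
    d, Finsupp.lsum_single, LinearMap.add_apply, LinearMap.sum_apply, LinearMap.smul_apply,
    Finsupp.lsingle_apply, map_add, map_sum, map_smul]
  congr 1
  refine Finset.sum_congr rfl fun j _ => ?_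
  rw [comp_contractNth]

lemma chainsMap_mem_cycles (φ : G →* G') {n : ℕ} {x : chains G A n}
    (hx : x ∈ cycles k G A n) : chainsMap k A φ n x ∈ cycles k G' A n := by
  cases n with
  | zero => trivial
  | succ n =>
    simp only [cycles, LinearMap.mem_ker] at hx ⊢
    have := LinearMap.congr_fun (chainsMap_comm (k := k) (A := A) φ n) x
    simp only [LinearMap.comp_apply] at this
    rw [this, hx, map_zero]

/-- The map induced by a group homomorphism on cycles. -/
noncomputable def cyclesMap (k : Type) [CommRing k] (A : Type) [AddCommGroup A] [Module k A]
    (φ : G →* G') (n : ℕ) : ↥(cycles k G A n) →ₗ[k] ↥(cycles k G' A n) :=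
  (chainsMap k A φ n).restrict fun _ hx => chainsMap_mem_cycles φ hx

/-- The map induced by a group homomorphism on group homology with trivial coefficients. -/
noncomputable def inducedMap (k : Type) [CommRing k] (A : Type) [AddCommGroup A] [Module k A]
    (φ : G →* G') (n : ℕ) :
    GroupHomology k G A n →ₗ[k] GroupHomology k G' A n :=
  Submodule.mapQ (boundariesIn k G A n) (boundariesIn k G' A n) (cyclesMap k A φ n) (by
    rintro ⟨x, hx⟩ hb
    simp only [boundariesIn, Submodule.mem_comap, Submodule.subtype_apply,
      LinearMap.mem_range] at hb ⊢
    obtain ⟨w, hw⟩ := hb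
    refine ⟨chainsMap k A φ (n + 1) w, ?_⟩
    have := LinearMap.congr_fun (chainsMap_comm (k := k) (A := A) φ n) w
    simp only [LinearMap.comp_apply] at this
    rw [this, hw]
    rfl)

end Maps

end BarHomology

open BarHomology

/-- The projective special linear group `PSL₂(R)`, i.e. `SL₂(R)` modulo its center. -/
abbrev PSL2 (R : Type) [CommRing R] : Type :=
  Matrix.ProjectiveSpecialLinearGroup (Fin 2) R

namespace O13

/-- Integral Hermitian forms `(x, y₁, y₂, z) ↔ [[x, y], [ȳ, z]]` with `y = y₁ + y₂ √-13`. -/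
abbrev Lat : Type := ℤ × ℤ × ℤ × ℤ

/-- The polarisation of twice the determinant. -/
def bil (u v : Lat) : ℤ :=
  u.1 * v.2.2.2 + u.2.2.2 * v.1 - 2 * (u.2.1 * v.2.1) - 26 * (u.2.2.1 * v.2.2.1)

/-- The determinant of four lattice vectors, expanded along the first two. -/
def vol (u v w p : Lat) : ℤ :=
  (u.1 * v.2.1 - v.1 * u.2.1) * (w.2.2.1 * p.2.2.2 - p.2.2.1 * w.2.2.2)
  - (u.1 * v.2.2.1 - v.1 * u.2.2.1) * (w.2.1 * p.2.2.2 - p.2.1 * w.2.2.2)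
  + (u.1 * v.2.2.2 - v.1 * u.2.2.2) * (w.2.1 * p.2.2.1 - p.2.1 * w.2.2.1)
  + (u.2.1 * v.2.2.1 - v.2.1 * u.2.2.1) * (w.1 * p.2.2.2 - p.1 * w.2.2.2)
  - (u.2.1 * v.2.2.2 - v.2.1 * u.2.2.2) * (w.1 * p.2.2.1 - p.1 * w.2.2.1)
  + (u.2.2.1 * v.2.2.2 - v.2.2.1 * u.2.2.2) * (w.1 * p.2.1 - p.1 * w.2.1)

/-- Nonzero isotropic vectors in the closed future cone. -/
def IsNull (v : Lat) : Prop := bil v v = 0 ∧ 0 ≤ v.1 ∧ 0 ≤ v.2.2.2 ∧ v ≠ 0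

instance (v : Lat) : Decidable (IsNull v) := by unfold IsNull; infer_instance

lemma bil_comm (u v : Lat) : bil u v = bil v u := by simp only [bil]; ring
lemma bil_add_left (u v w : Lat) : bil (u + v) w = bil u w + bil v w := by
  simp only [bil, Prod.fst_add, Prod.snd_add]; ring
lemma bil_add_right (u v w : Lat) : bil u (v + w) = bil u v + bil u w := by
  simp only [bil, Prod.fst_add, Prod.snd_add]; ring
lemma bil_sub_left (u v w : Lat) : bil (u - v) w = bil u w - bil v w := by
  simp only [bil, Prod.fst_sub, Prod.snd_sub]; ring
lemma bil_neg_left (u w : Lat) : bil (-u) w = - bil u w := by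
  simp only [bil, Prod.fst_neg, Prod.snd_neg]; ring
lemma bil_smul_left (n : ℤ) (u w : Lat) : bil (n • u) w = n * bil u w := by
  simp only [bil, Prod.smul_fst, Prod.smul_snd, smul_eq_mul]; ring
lemma bil_zero_left (w : Lat) : bil 0 w = 0 := by simp [bil]

/-- `bil` as an additive map in the first argument. -/
def bilHom (w : Lat) : Lat →+ ℤ where
  toFun u := bil u w
  map_zero' := bil_zero_left w
  map_add' u v := bil_add_left u v w

lemma bil_sum_left {ι : Type*} (s : Finset ι) (f : ι → Lat) (w : Lat) :
    bil (∑ i ∈ s, f i) w = ∑ i ∈ s, bil (f i) w :=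
  map_sum (bilHom w) f s

lemma vol_swap_left (u v w p : Lat) : vol v u w p = - vol u v w p := by
  simp only [vol]; ring
lemma vol_swap_right (u v w p : Lat) : vol u v p w = - vol u v w p := by
  simp only [vol]; ring

/-! ### The action of `SL₂(ℤ√-13)` -/

abbrev R13 : Type := Zsqrtd (-13)

abbrev Mat : Type := Matrix (Fin 2) (Fin 2) R13

abbrev SLR : Type := Matrix.SpecialLinearGroup (Fin 2) R13

open Matrix

def herm (v : Lat) : Mat :=
  !![⟨v.1, 0⟩, ⟨v.2.1, v.2.2.1⟩; ⟨v.2.1, -v.2.2.1⟩, ⟨v.2.2.2, 0⟩]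

def coords (M : Mat) : Lat :=
  ((M 0 0).re, (M 0 1).re, (M 0 1).im, (M 1 1).re)

lemma coords_herm (v : Lat) : coords (herm v) = v := by simp [coords, herm]

lemma herm_add (u v : Lat) : herm (u + v) = herm u + herm v := by
  ext i j <;> fin_cases i <;> fin_cases j <;> (simp [herm]; try ring)

lemma coords_add (M N : Mat) : coords (M + N) = coords M + coords N := by
  simp [coords]

lemma herm_injective : Function.Injective herm :=
  Function.LeftInverse.injective coords_herm

lemma herm_isHermitian (v : Lat) : (herm v)ᴴ = herm v := by
  ext i j <;> fin_cases i <;> fin_cases j <;> simp [herm, conjTranspose_apply]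

lemma herm_coords {M : Mat} (h : Mᴴ = M) : herm (coords M) = M := by
  have h00 := congrArg Zsqrtd.im (congrFun (congrFun h 0) 0)
  have h11 := congrArg Zsqrtd.im (congrFun (congrFun h 1) 1)
  have h10 := congrFun (congrFun h 1) 0
  simp [conjTranspose_apply] at h00 h11 h10
  have e0 : (M 0 0).im = 0 := by linarith
  have e1 : (M 1 1).im = 0 := by linarith
  ext i j <;> fin_cases i <;> fin_cases j <;> simp [herm, coords, e0, e1, ← h10]

lemma herm_act_isHermitian (g : Mat) (v : Lat) :
    (g * herm v * gᴴ)ᴴ = g * herm v * gᴴ := by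
  simp [conjTranspose_mul, herm_isHermitian, Matrix.mul_assoc]

/-- The transformed form `γ X γ*`. -/
def act (g : Mat) (v : Lat) : Lat := coords (g * herm v * gᴴ)

lemma herm_act (g : Mat) (v : Lat) : herm (act g v) = g * herm v * gᴴ :=
  herm_coords (herm_act_isHermitian g v)

lemma act_mul (g h : Mat) (v : Lat) : act (g * h) v = act g (act h v) := by
  apply herm_injective
  simp only [herm_act, conjTranspose_mul, Matrix.mul_assoc]

lemma act_one (v : Lat) : act 1 v = v := by
  simp [act, coords_herm]

lemma act_add (g : Mat) (u v : Lat) : act g (u + v) = act g u + act g v := by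
  simp [act, herm_add, Matrix.mul_add, Matrix.add_mul, coords_add]

abbrev Aut : Type := Lat ≃ₗ[ℤ] Lat

/-- `SL₂(ℤ√-13)` acting on the lattice of Hermitian forms. -/
def actHom : SLR →* Aut where
  toFun g := AddEquiv.toIntLinearEquiv
    { toFun := act (g : Mat)
      invFun := act ((g⁻¹ : SLR) : Mat)
      left_inv := fun v => (act_mul _ _ _).symm.trans
        ((congrArg (fun h : SLR => act (h : Mat) v) (inv_mul_cancel g)).trans (act_one v))
      right_inv := fun v => (act_mul _ _ _).symm.trans
        ((congrArg (fun h : SLR => act (h : Mat) v) (mul_inv_cancel g)).trans (act_one v))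
      map_add' := act_add (g : Mat) }
  map_one' := LinearEquiv.ext fun v => act_one v
  map_mul' g h := LinearEquiv.ext fun v => act_mul (g : Mat) (h : Mat) v

lemma actHom_apply (g : SLR) (v : Lat) : actHom g v = act (g : Mat) v := rfl

lemma bil_eq_trace (u v : Lat) :
    (⟨bil u v, 0⟩ : R13) = (herm u * (herm v).adjugate).trace := by
  ext <;> simp [herm, adjugate_fin_two, trace_fin_two, bil] <;> ring

lemma vol_eq_trace (u v w p : Lat) :
    vol u v w p =
      (herm u * (herm v).adjugate * herm w * (herm p).adjugate).trace.im := by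
  simp [herm, adjugate_fin_two, trace_fin_two, vol]; ring


lemma act_sl_mul_adjugate (g : SLR) (u v : Lat) :
    herm (act (g : Mat) u) * (herm (act (g : Mat) v)).adjugate =
      (g : Mat) * (herm u * (herm v).adjugate) * (g : Mat).adjugate := by
  have h : ((g : Mat)ᴴ) * ((g : Mat)ᴴ).adjugate = 1 := by
    rw [mul_adjugate, det_conjTranspose, g.det_coe]; simp
  rw [herm_act, herm_act, adjugate_mul_distrib, adjugate_mul_distrib]
  calc (g : Mat) * herm u * (g : Mat)ᴴ * ((g : Mat)ᴴ.adjugate * ((herm v).adjugate * (g : Mat).adjugate))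
      = (g : Mat) * herm u * ((g : Mat)ᴴ * (g : Mat)ᴴ.adjugate) * ((herm v).adjugate * (g : Mat).adjugate) := by
        simp only [Matrix.mul_assoc]
    _ = _ := by rw [h]; simp only [Matrix.mul_assoc, Matrix.mul_one]

lemma trace_conj_sl (g : SLR) (M : Mat) :
    ((g : Mat) * M * (g : Mat).adjugate).trace = M.trace := by
  rw [trace_mul_comm, ← Matrix.mul_assoc, adjugate_mul, g.det_coe, one_smul, Matrix.one_mul]

lemma bil_act (g : SLR) (u v : Lat) : bil (act (g : Mat) u) (act (g : Mat) v) = bil u v := by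
  have h := bil_eq_trace (act (g : Mat) u) (act (g : Mat) v)
  rw [act_sl_mul_adjugate, trace_conj_sl, ← bil_eq_trace] at h
  exact congrArg Zsqrtd.re h

lemma vol_act (g : SLR) (u v w p : Lat) :
    vol (act (g : Mat) u) (act (g : Mat) v) (act (g : Mat) w) (act (g : Mat) p) = vol u v w p := by
  rw [vol_eq_trace, Matrix.mul_assoc _ (herm (act (g : Mat) w)), act_sl_mul_adjugate,
    act_sl_mul_adjugate, vol_eq_trace, Matrix.mul_assoc _ (herm w)]
  have h : (g : Mat).adjugate * (g : Mat) = 1 := by rw [adjugate_mul, g.det_coe, one_smul]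
  generalize herm u * (herm v).adjugate = P
  generalize herm w * (herm p).adjugate = Q
  rw [show (g : Mat) * P * (g : Mat).adjugate * ((g : Mat) * Q * (g : Mat).adjugate)
      = (g : Mat) * P * ((g : Mat).adjugate * (g : Mat)) * Q * (g : Mat).adjugate by simp only [Matrix.mul_assoc], h,
    Matrix.mul_one, Matrix.mul_assoc (g : Mat) P Q, trace_conj_sl]

lemma sq_of_null {v : Lat} (h : bil v v = 0) : v.1 * v.2.2.2 = v.2.1 ^ 2 + 13 * v.2.2.1 ^ 2 := by
  simp only [bil] at h; linarith

/-- Two future null vectors have nonnegative product. -/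
lemma null_bil_nonneg {u v : Lat} (hu : IsNull u) (hv : IsNull v) : 0 ≤ bil u v := by
  obtain ⟨hu, u0, u3, -⟩ := hu
  obtain ⟨hv, v0, v3, -⟩ := hv
  have hu := sq_of_null hu
  have hv := sq_of_null hv
  obtain ⟨x, y, w, z⟩ := u
  obtain ⟨a, b, c, d⟩ := v
  simp only [bil] at *
  have key : (2 * (y * b) + 26 * (w * c)) ^ 2 ≤ (x * d + z * a) ^ 2 := by
    nlinarith [sq_nonneg (x * d - z * a), sq_nonneg (y * c - w * b),
      congrArg₂ (· * ·) hu hv]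
  have := le_abs_self (2 * (y * b) + 26 * (w * c))
  linarith [abs_le_of_sq_le_sq key (by positivity)]

lemma act_fst_nonneg (g : Mat) {v : Lat} (hv : IsNull v) :
    0 ≤ (act g v).1 ∧ 0 ≤ (act g v).2.2.2 := by
  have key : ∀ a b : R13, ∀ v : Lat, IsNull v → 0 ≤ (a.re ^ 2 + 13 * a.im ^ 2) * v.1 +
      (b.re ^ 2 + 13 * b.im ^ 2) * v.2.2.2 + 2 * ((a.re * b.re + 13 * (a.im * b.im)) * v.2.1
      + 13 * (a.re * b.im - a.im * b.re) * v.2.2.1) := by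
    intro a b v hv
    by_cases hb : b = 0 ∧ a = 0
    · simp [hb.1, hb.2]
    have := null_bil_nonneg (u := (b.re ^ 2 + 13 * b.im ^ 2,
      -(a.re * b.re + 13 * (a.im * b.im)), -(a.re * b.im - a.im * b.re),
      a.re ^ 2 + 13 * a.im ^ 2)) ⟨by simp only [bil]; ring, by positivity, by positivity, ?_⟩ hv
    · simp only [bil] at this; linarith
    · intro h
      simp only [Prod.ext_iff, Prod.fst_zero, Prod.snd_zero] at h
      apply hb
      constructor
      · ext <;> simp <;> nlinarith [h.1, sq_nonneg b.re, sq_nonneg b.im]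
      · ext <;> simp <;> nlinarith [h.2.2.2, sq_nonneg a.re, sq_nonneg a.im]
  constructor
  · convert key (g 0 0) (g 0 1) v hv using 1
    simp [act, coords, herm, Matrix.mul_apply, conjTranspose_apply]; ring
  · convert key (g 1 0) (g 1 1) v hv using 1
    simp [act, coords, herm, Matrix.mul_apply, conjTranspose_apply]; ring

end O13

namespace O13
open Matrix

/-- The image of `PSL₂(ℤ√-13)` in the automorphisms of the lattice. -/
def Gam : Subgroup Aut := actHom.range

/-- Complex conjugation. -/
def cA : Aut := LinearEquiv.ofInvolutive
  { toFun := fun v => (v.1, v.2.1, -v.2.2.1, v.2.2.2)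
    map_add' := fun u v => by simp; ring
    map_smul' := fun n v => by simp } fun v => by simp

/-- Sign change of the off-diagonal entry. -/
def dA : Aut := LinearEquiv.ofInvolutive
  { toFun := fun v => (v.1, -v.2.1, -v.2.2.1, v.2.2.2)
    map_add' := fun u v => by simp; constructor <;> ring
    map_smul' := fun n v => by simp } fun v => by simp

/-- Half of the product with the root `(6, 1, 1, 2)`. -/
def rt (v : Lat) : ℤ := v.1 + 3 * v.2.2.2 - v.2.1 - 13 * v.2.2.1

/-- The reflection in the root `(6, 1, 1, 2)`. -/
def tA : Aut := LinearEquiv.ofInvolutive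
  { toFun := fun v => (v.1 + 6 * rt v, v.2.1 + rt v, v.2.2.1 + rt v, v.2.2.2 + 2 * rt v)
    map_add' := fun u v => by simp [rt]; refine ⟨?_, ?_, ?_, ?_⟩ <;> ring
    map_smul' := fun n v => by simp [rt]; refine ⟨?_, ?_, ?_, ?_⟩ <;> ring }
  fun v => by simp [rt]; ext <;> simp <;> ring

lemma cA_apply (v : Lat) : cA v = (v.1, v.2.1, -v.2.2.1, v.2.2.2) := rfl
lemma dA_apply (v : Lat) : dA v = (v.1, -v.2.1, -v.2.2.1, v.2.2.2) := rfl
lemma tA_apply (v : Lat) : tA v =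
  (v.1 + 6 * rt v, v.2.1 + rt v, v.2.2.1 + rt v, v.2.2.2 + 2 * rt v) := rfl

/-- The group of lattice automorphisms generated by `Γ` and three reflections. -/
def AA : Subgroup Aut := Subgroup.closure ((Gam : Set Aut) ∪ {cA, dA, tA})

lemma Gam_le_AA : Gam ≤ AA := fun _ h => Subgroup.subset_closure (Or.inl h)
lemma cA_mem : cA ∈ AA := Subgroup.subset_closure (Or.inr (by simp))
lemma dA_mem : dA ∈ AA := Subgroup.subset_closure (Or.inr (by simp))
lemma tA_mem : tA ∈ AA := Subgroup.subset_closure (Or.inr (by simp))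

lemma act_mem (g : SLR) : actHom g ∈ Gam := ⟨g, rfl⟩

lemma AA_induction {p : Aut → Prop} (one : p 1) (mul : ∀ a b, p a → p b → p (a * b))
    (inv : ∀ a, p a → p a⁻¹) (hg : ∀ g : SLR, p (actHom g)) (hc : p cA) (hd : p dA) (ht : p tA)
    {a : Aut} (ha : a ∈ AA) : p a := by
  refine Subgroup.closure_induction (p := fun a _ => p a) ?_ one (fun a b _ _ => mul a b)
    (fun a _ => inv a) ha
  rintro a (⟨g, rfl⟩ | rfl | rfl | rfl)
  exacts [hg g, hc, hd, ht]

lemma bil_AA {a : Aut} (ha : a ∈ AA) : ∀ u v, bil (a u) (a v) = bil u v := by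
  refine AA_induction (p := fun a => ∀ u v, bil (a u) (a v) = bil u v) ?_ ?_ ?_ ?_ ?_ ?_ ?_ ha
  · intro u v; rfl
  · intro a b ha hb u v
    rw [LinearEquiv.mul_apply, LinearEquiv.mul_apply, ha, hb]
  · intro a ha u v
    rw [← ha, ← LinearEquiv.mul_apply, ← LinearEquiv.mul_apply, mul_inv_cancel]; rfl
  · intro g u v; exact bil_act g u v
  · intro u v; simp only [cA_apply, bil]; ring
  · intro u v; simp only [dA_apply, bil]; ring
  · intro u v; simp only [tA_apply, bil, rt]; ring

lemma null_step {a : Aut} (ha : a ∈ AA) (h : ∀ v, IsNull v → 0 ≤ (a v).1 ∧ 0 ≤ (a v).2.2.2)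
    {v : Lat} (hv : IsNull v) : IsNull (a v) :=
  ⟨(bil_AA ha v v).trans hv.1, (h v hv).1, (h v hv).2, by simpa using hv.2.2.2⟩

lemma tA_nonneg (v : Lat) (hv : IsNull v) : 0 ≤ (tA v).1 ∧ 0 ≤ (tA v).2.2.2 := by
  have h1 := null_bil_nonneg (u := (18, 3, 3, 7)) (by decide) hv
  have h2 := null_bil_nonneg (u := (7, 1, 1, 2)) (by decide) hv
  simp only [bil] at h1 h2
  simp only [tA_apply, rt]
  constructor <;> linarith

lemma null_AA {a : Aut} (ha : a ∈ AA) {v : Lat} (hv : IsNull v) : IsNull (a v) := by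
  have hcl : a ∈ Submonoid.closure ((Gam : Set Aut) ∪ {cA, dA, tA}) := by
    have h := Subgroup.closure_toSubmonoid ((Gam : Set Aut) ∪ {cA, dA, tA})
    have hi : ((Gam : Set Aut) ∪ {cA, dA, tA})⁻¹ = (Gam : Set Aut) ∪ {cA, dA, tA} := by
      have hc : cA⁻¹ = cA := rfl
      have hd : dA⁻¹ = dA := rfl
      have ht : tA⁻¹ = tA := rfl
      rw [Set.union_inv, inv_coe_set]
      simp [hc, hd, ht, Set.inv_insert]
    rw [hi, Set.union_self] at h
    rw [← h]; exact ha
  refine Submonoid.closure_induction (motive := fun a _ => ∀ v, IsNull v → IsNull (a v)) ?_ ?_ ?_ hcl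
    v hv
  · rintro a (⟨g, rfl⟩ | rfl | rfl | rfl) v hv
    · exact null_step (Gam_le_AA (act_mem g)) (fun v hv => act_fst_nonneg _ hv) hv
    · exact null_step cA_mem (fun v hv => ⟨hv.2.1, hv.2.2.1⟩) hv
    · exact null_step dA_mem (fun v hv => ⟨hv.2.1, hv.2.2.1⟩) hv
    · exact null_step tA_mem tA_nonneg hv
  · exact fun v hv => hv
  · intro a b _ _ ha hb v hv
    exact ha _ (hb v hv)

lemma null_AA_iff {a : Aut} (ha : a ∈ AA) {v : Lat} : IsNull (a v) ↔ IsNull v := by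
  refine ⟨fun h => ?_, null_AA ha⟩
  have := null_AA (AA.inv_mem ha) h
  rwa [← LinearEquiv.mul_apply, inv_mul_cancel] at this

lemma vol_AA {a : Aut} (ha : a ∈ AA) : ∃ e : ℤ, (e = 1 ∨ e = -1) ∧
    ∀ u v w p, vol (a u) (a v) (a w) (a p) = e * vol u v w p := by
  refine AA_induction (p := fun a => ∃ e : ℤ, (e = 1 ∨ e = -1) ∧
    ∀ u v w p, vol (a u) (a v) (a w) (a p) = e * vol u v w p) ?_ ?_ ?_ ?_ ?_ ?_ ?_ ha
  · exact ⟨1, .inl rfl, fun u v w p => by simp⟩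
  · rintro a b ⟨e, he, h⟩ ⟨f, hf, h'⟩
    refine ⟨e * f, ?_, fun u v w p => ?_⟩
    · rcases he with rfl | rfl <;> rcases hf with rfl | rfl <;> simp
    · simp only [LinearEquiv.mul_apply, h, h', mul_assoc]
  · rintro a ⟨e, he, h⟩
    refine ⟨e, he, fun u v w p => ?_⟩
    have hh := h (a⁻¹ u) (a⁻¹ v) (a⁻¹ w) (a⁻¹ p)
    simp only [← LinearEquiv.mul_apply, mul_inv_cancel, LinearEquiv.coe_one, id] at hh
    rcases he with rfl | rfl <;> linarith
  · exact fun g => ⟨1, .inl rfl, fun u v w p => by rw [one_mul]; exact vol_act g u v w p⟩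
  · exact ⟨-1, .inr rfl, fun u v w p => by simp only [cA_apply, vol]; ring⟩
  · exact ⟨1, .inl rfl, fun u v w p => by simp only [dA_apply, vol]; ring⟩
  · exact ⟨-1, .inr rfl, fun u v w p => by simp only [tA_apply, vol, rt]; ring⟩

lemma vol_Gam {a : Aut} (ha : a ∈ Gam) (u v w p : Lat) :
    vol (a u) (a v) (a w) (a p) = vol u v w p := by
  obtain ⟨g, rfl⟩ := ha
  exact vol_act g u v w p

lemma inv_apply_self (a : Aut) (v : Lat) : a⁻¹ (a v) = v := by
  rw [← LinearEquiv.mul_apply, inv_mul_cancel]; rfl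
lemma apply_inv_self (a : Aut) (v : Lat) : a (a⁻¹ v) = v := by
  rw [← LinearEquiv.mul_apply, mul_inv_cancel]; rfl

lemma bil_AA_inv {a : Aut} (ha : a ∈ AA) (u v : Lat) : bil (a u) v = bil u (a⁻¹ v) := by
  rw [← bil_AA ha u, apply_inv_self]

end O13

namespace O13

/-- The three types of cells: cupola, prism, cube, each given by its centre and a cutting vector. -/
def base : Fin 3 → Lat × Lat :=
  ![((78, 39, 18, 78), (4, 2, 1, 4)), ((78, 39, 25, 130), 0), ((156, 78, 48, 234), 0)]

def verts : Fin 3 → List Lat :=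
  ![[(0, 0, 0, 1), (1, 0, 0, 0), (1, 1, 0, 1), (7, 2, 2, 8), (7, 5, 2, 11), (8, 2, 2, 7),
      (8, 6, 2, 11), (11, 5, 2, 7), (11, 6, 2, 8)],
    [(0, 0, 0, 1), (2, 1, 1, 7), (7, 2, 2, 8), (7, 5, 2, 11), (9, 3, 3, 14), (9, 6, 3, 17)],
    [(7, 2, 2, 8), (7, 5, 2, 11), (9, 3, 3, 14), (9, 6, 3, 17), (17, 7, 5, 22), (17, 10, 5, 25),
      (19, 8, 6, 28), (19, 11, 6, 31)]]

instance (i : Fin 3) (v : Lat) : Decidable (v ∈ verts i) := inferInstance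

/-- The number of facets of a cell. -/
def nf : Fin 3 → ℕ := ![8, 5, 6]

/-- The neighbours of the standard cells. -/
def nbc : (i : Fin 3) → Fin (nf i) → Lat × Lat
  | 0 => ![((78, 39, -18, 78), (4, 2, -1, 4)), ((78, 0, 21, 78), (0, -1, 0, 0)),
      ((78, 78, 21, 156), (0, 1, 0, 2)), ((78, 39, 25, 130), 0),
      ((156, 78, 21, 78), (2, 1, 0, 0)), ((130, 39, 25, 78), 0), ((130, 91, 25, 130), 0),
      ((78, 39, 18, 78), (-4, -2, -1, -4))]
  | 1 => ![((78, 13, 27, 130), 0), ((78, 65, 27, 182), 0), ((78, 39, 18, 78), (4, 2, 1, 4)),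
      ((156, 78, 57, 312), (6, 3, 2, 10)), ((156, 78, 48, 234), 0)]
  | 2 => ![((78, 39, 25, 130), 0), ((182, 91, 51, 234), 0), ((858, 312, 264, 1170), 0),
      ((858, 546, 264, 1404), 0), ((234, 117, 77, 390), 0), ((338, 169, 103, 494), 0)]

/-- The linear form cutting out a facet. -/
def nr (i : Fin 3) (j : Fin (nf i)) : Lat :=
  if (nbc i j).1 = (base i).1 then (base i).2 else (nbc i j).1 - (base i).1

/-- `v` is a vertex of the cell `c`. -/
def Vs (c : Lat × Lat) (v : Lat) : Prop := IsNull v ∧ bil c.1 v = 78 ∧ 0 ≤ bil c.2 v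

instance (c : Lat × Lat) (v : Lat) : Decidable (Vs c v) := by unfold Vs; infer_instance

lemma null_pos {u : Lat} (hu : IsNull u) : 0 < u.1 + u.2.2.2 := by
  obtain ⟨h, h0, h3, hne⟩ := hu
  by_contra hlt
  have e0 : u.1 = 0 := by omega
  have e3 : u.2.2.2 = 0 := by omega
  have := sq_of_null h
  rw [e0] at this
  have e1 : u.2.1 = 0 := by nlinarith [sq_nonneg u.2.1, sq_nonneg u.2.2.1]
  have e2 : u.2.2.1 = 0 := by nlinarith [sq_nonneg u.2.1, sq_nonneg u.2.2.1]
  exact hne (by ext <;> simp [*])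

lemma timelike_bound_fst {p u : Lat} (hp : 0 ≤ p.1) (hu : IsNull u) :
    bil p p * u.1 ≤ 2 * bil p u * p.1 := by
  obtain ⟨h, h0, h3, -⟩ := hu
  have hs := sq_of_null h
  obtain ⟨x, y, w, z⟩ := u
  obtain ⟨a, b, c, d⟩ := p
  simp only [bil] at *
  rcases h0.eq_or_lt with rfl | hx
  · have e1 : y = 0 := by nlinarith [sq_nonneg y, sq_nonneg w]
    have e2 : w = 0 := by nlinarith [sq_nonneg y, sq_nonneg w]
    subst e1 e2
    have : 0 ≤ a * z := mul_nonneg hp h3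
    nlinarith
  · refine le_of_mul_le_mul_left ?_ hx
    nlinarith [sq_nonneg (a * y - x * b), sq_nonneg (a * w - x * c),
      congrArg (fun t => a ^ 2 * t) hs]

lemma timelike_bound_snd {p u : Lat} (hp : 0 ≤ p.2.2.2) (hu : IsNull u) :
    bil p p * u.2.2.2 ≤ 2 * bil p u * p.2.2.2 := by
  have := timelike_bound_fst (p := (p.2.2.2, p.2.1, p.2.2.1, p.1))
    (u := (u.2.2.2, u.2.1, u.2.2.1, u.1)) hp ?_
  · simp only [bil] at this ⊢; linarith
  · obtain ⟨h, h0, h3, hne⟩ := hu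
    refine ⟨by simp only [bil] at h ⊢; linarith, h3, h0, fun e => hne ?_⟩
    simp only [Prod.ext_iff, Prod.fst_zero, Prod.snd_zero] at e ⊢
    tauto

lemma timelike_pos {p u : Lat} (hp : 0 ≤ p.1) (hp' : 0 ≤ p.2.2.2) (hpp : 0 < bil p p)
    (hu : IsNull u) : 0 < bil p u := by
  have h1 := timelike_bound_fst hp hu
  have h2 := timelike_bound_snd hp' hu
  have h3 := null_pos hu
  by_contra hneg
  have : 0 < bil p p * (u.1 + u.2.2.2) := mul_pos hpp h3
  nlinarith

lemma cupola_enum : ∀ x < (18 : ℕ), ∀ z < (18 : ℕ), ∀ w < (9 : ℕ),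
    ((x + z : ℤ) - 6 * (w - 4) - 1) ^ 2 = x * z - 13 * (w - 4 : ℤ) ^ 2 →
    0 ≤ bil (4, 2, 1, 4) (x, (x + z : ℤ) - 6 * (w - 4) - 1, (w - 4 : ℤ), z) →
    ((x : ℤ), (x + z : ℤ) - 6 * (w - 4) - 1, (w - 4 : ℤ), (z : ℤ)) ∈ verts 0 := by
  decide +kernel

lemma abs_le_of_sq {w : ℤ} {m n : ℤ} (h : 13 * w ^ 2 ≤ m) (hm : m < 13 * (n + 1) ^ 2)
    (hn : 0 ≤ n) : -n ≤ w ∧ w ≤ n := by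
  constructor <;> nlinarith

lemma cupola_verts {v : Lat} (h : Vs (base 0) v) : v ∈ verts 0 := by
  obtain ⟨hn, hq, hm⟩ := h
  have h1 := timelike_bound_fst (p := (base 0).1) (by decide) hn
  have h2 := timelike_bound_snd (p := (base 0).1) (by decide) hn
  have hs := sq_of_null hn.1
  have h0 := hn.2.1
  have h3 := hn.2.2.1
  rw [hq] at h1 h2
  obtain ⟨x, y, w, z⟩ := v
  simp [base, bil] at h1 h2 hq hm hs h0 h3
  have hw := abs_le_of_sq (w := w) (m := x * z) (n := 4) (by nlinarith) (by nlinarith) (by simp)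
  lift x to ℕ using h0
  lift z to ℕ using h3
  obtain ⟨w', hw'⟩ : ∃ w' : ℕ, (w' : ℤ) = w + 4 := ⟨(w + 4).toNat, by omega⟩
  have ew : w = w' - 4 := by omega
  have ey : y = (x + z : ℤ) - 6 * (w' - 4) - 1 := by omega
  subst ew ey
  refine cupola_enum x (by omega) z (by omega) w' (by omega) (by linarith) ?_
  simp only [bil]; linarith

lemma prism_enum : ∀ x < (13 : ℕ), ∀ z < (21 : ℕ), ∀ w < (11 : ℕ), ∀ h < (2 : ℕ),
    ((5 * x + 3 * z : ℤ) - 25 * (w - 5) - (h + 1)) ^ 2 = 9 * (x * z - 13 * (w - 5 : ℤ) ^ 2) →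
    ¬ 3 ∣ (5 * x + 3 * z : ℤ) - 25 * (w - 5) - (h + 1) := by
  decide +kernel

lemma prism_enum' : ∀ x < (13 : ℕ), ∀ z < (21 : ℕ), ∀ w < (11 : ℕ),
    ((5 * x + 3 * z : ℤ) - 25 * (w - 5) - 3) ^ 2 = 9 * (x * z - 13 * (w - 5 : ℤ) ^ 2) →
    3 ∣ (5 * x + 3 * z : ℤ) - 25 * (w - 5) - 3 →
    ((x : ℤ), ((5 * x + 3 * z : ℤ) - 25 * (w - 5) - 3) / 3, (w - 5 : ℤ), (z : ℤ)) ∈ verts 1 := by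
  decide +kernel

lemma cube_enum : ∀ x < (27 : ℕ), ∀ z < (40 : ℕ), ∀ w < (19 : ℕ),
    ((3 * x + 2 * z : ℤ) - 16 * (w - 9) - 1) ^ 2 = 4 * (x * z - 13 * (w - 9 : ℤ) ^ 2) →
    2 ∣ (3 * x + 2 * z : ℤ) - 16 * (w - 9) - 1 →
    ((x : ℤ), ((3 * x + 2 * z : ℤ) - 16 * (w - 9) - 1) / 2, (w - 9 : ℤ), (z : ℤ)) ∈ verts 2 := by
  decide +kernel

lemma prism_verts {v : Lat} (hn : IsNull v) (hq : bil (base 1).1 v ≤ 78) :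
    bil (base 1).1 v = 78 ∧ v ∈ verts 1 := by
  have h1 := timelike_bound_fst (p := (base 1).1) (by decide) hn
  have h2 := timelike_bound_snd (p := (base 1).1) (by decide) hn
  have hp := timelike_pos (p := (base 1).1) (by decide) (by decide) (by decide) hn
  have hs := sq_of_null hn.1
  have h0 := hn.2.1
  have h3 := hn.2.2.1
  obtain ⟨x, y, w, z⟩ := v
  simp [base, bil] at h1 h2 hq hs h0 h3 hp
  have hw := abs_le_of_sq (w := w) (m := x * z) (n := 5) (by nlinarith) (by nlinarith) (by simp)
  lift x to ℕ using h0
  lift z to ℕ using h3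
  obtain ⟨w', hw'⟩ : ∃ w' : ℕ, (w' : ℤ) = w + 5 := ⟨(w + 5).toNat, by omega⟩
  have ew : w = w' - 5 := by omega
  obtain ⟨h, hh⟩ : ∃ h : ℤ, (5 * x + 3 * z : ℤ) - 25 * w - h = 3 * y :=
    ⟨5 * x + 3 * z - 25 * w - 3 * y, by ring⟩
  have hrange : h = 1 ∨ h = 2 ∨ h = 3 := by omega
  subst ew
  rcases hrange with rfl | rfl | rfl
  · refine absurd ⟨y, ?_⟩ (prism_enum x (by omega) z (by omega) w' (by omega) 0 (by omega) ?_)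
    · push_cast; rw [hh]; linarith
    · push_cast; linarith
  · refine absurd ⟨y, ?_⟩ (prism_enum x (by omega) z (by omega) w' (by omega) 1 (by omega) ?_)
    · push_cast; rw [hh]; linarith
    · push_cast; linarith
  · have := prism_enum' x (by omega) z (by omega) w' (by omega) (by rw [hh]; linarith) ⟨y, hh⟩
    rw [hh, Int.mul_ediv_cancel_left _ (by norm_num)] at this
    refine ⟨?_, this⟩
    simp [base, bil]; linarith

lemma cube_verts {v : Lat} (h : Vs (base 2) v) : v ∈ verts 2 := by
  obtain ⟨hn, hq, -⟩ := h
  have h1 := timelike_bound_fst (p := (base 2).1) (by decide) hn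
  have h2 := timelike_bound_snd (p := (base 2).1) (by decide) hn
  have hs := sq_of_null hn.1
  have h0 := hn.2.1
  have h3 := hn.2.2.1
  rw [hq] at h1 h2
  obtain ⟨x, y, w, z⟩ := v
  simp [base, bil] at h1 h2 hq hs h0 h3
  have hw := abs_le_of_sq (w := w) (m := x * z) (n := 9) (by nlinarith) (by nlinarith) (by simp)
  lift x to ℕ using h0
  lift z to ℕ using h3
  obtain ⟨w', hw'⟩ : ∃ w' : ℕ, (w' : ℤ) = w + 9 := ⟨(w + 9).toNat, by omega⟩
  have ew : w = w' - 9 := by omega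
  subst ew
  have hh : (3 * x + 2 * z : ℤ) - 16 * (w' - 9) - 1 = 2 * y := by linarith
  have := cube_enum x (by omega) z (by omega) w' (by omega) (by rw [hh]; linarith) ⟨y, hh⟩
  rwa [hh, Int.mul_ediv_cancel_left _ (by norm_num)] at this

lemma verts_Vs : ∀ i, ∀ v ∈ verts i, Vs (base i) v := by decide +kernel

lemma Vs_iff (i : Fin 3) (v : Lat) : Vs (base i) v ↔ v ∈ verts i := by
  refine ⟨fun h => ?_, verts_Vs i v⟩
  fin_cases i
  · exact cupola_verts h
  · exact (prism_verts h.1 h.2.1.le).2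
  · exact cube_verts h

/-- Null vectors have product at least `78` with every standard centre. -/
lemma base_min (i : Fin 3) {v : Lat} (hv : IsNull v) : 78 ≤ bil (base i).1 v := by
  fin_cases i
  · have := timelike_pos (p := (base 0).1) (by decide) (by decide) (by decide) hv
    simp [base, bil] at this ⊢; omega
  · by_contra h
    exact absurd (prism_verts hv (not_le.mp h).le).1 (not_le.mp h).ne
  · have := timelike_pos (p := (base 2).1) (by decide) (by decide) (by decide) hv
    simp [base, bil] at this ⊢; omega

end O13

namespace O13
open Matrix

/-- The diagonal action on pairs of lattice vectors. -/
def pr (a : Aut) (c : Lat × Lat) : Lat × Lat := (a c.1, a c.2)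

lemma pr_mul (a b : Aut) (c : Lat × Lat) : pr (a * b) c = pr a (pr b c) := rfl
lemma pr_one (c : Lat × Lat) : pr 1 c = c := rfl
lemma pr_inv_self (a : Aut) (c : Lat × Lat) : pr a⁻¹ (pr a c) = c := by
  rw [← pr_mul, inv_mul_cancel, pr_one]
lemma pr_self_inv (a : Aut) (c : Lat × Lat) : pr a (pr a⁻¹ c) = c := by
  rw [← pr_mul, mul_inv_cancel, pr_one]
lemma pr_injective (a : Aut) : Function.Injective (pr a) :=
  Function.LeftInverse.injective (pr_inv_self a)

/-- Cells are the translates of the three standard ones. -/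
def IsCell (c : Lat × Lat) : Prop := ∃ a ∈ AA, ∃ i, c = pr a (base i)

/-- The matrix `[[a, b], [c, d]]` as an element of `SL₂`. -/
def slm (a b c d : R13) (h : a * d - b * c = 1) : SLR := ⟨!![a, b; c, d], by rw [det_fin_two_of, h]⟩

lemma exists_AA_of (k : Fin 3) (a b c d : R13) (h : a * d - b * c = 1) {w : Aut} (hw : w ∈ AA)
    {x : Lat × Lat} (hx : pr (actHom (slm a b c d h)) (pr w (base k)) = x) :
    ∃ e ∈ AA, x = pr e (base k) :=
  ⟨_, AA.mul_mem (Gam_le_AA (act_mem (slm a b c d h))) hw, hx.symm⟩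

/-- The types of the neighbours. -/
def nt : (i : Fin 3) → Fin (nf i) → Fin 3
  | 0 => ![0, 0, 0, 1, 0, 1, 1, 0]
  | 1 => ![1, 1, 0, 0, 2]
  | 2 => ![1, 1, 2, 2, 1, 1]

lemma nbc_translate (i : Fin 3) (j : Fin (nf i)) : ∃ a ∈ AA, nbc i j = pr a (base (nt i j)) := by
  fin_cases i <;> fin_cases j
  · exact exists_AA_of 0 ⟨0, 0⟩ ⟨-1, 0⟩ ⟨1, 0⟩ ⟨0, 0⟩ (by decide) (dA_mem) (by decide +kernel)
  · exact exists_AA_of 0 ⟨-3, 0⟩ ⟨-1, -1⟩ ⟨-1, 1⟩ ⟨-5, 0⟩ (by decide) (AA.mul_mem dA_mem tA_mem) (by decide +kernel)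
  · exact exists_AA_of 0 ⟨-3, 0⟩ ⟨1, -1⟩ ⟨-2, 1⟩ ⟨-4, -1⟩ (by decide) (AA.mul_mem cA_mem tA_mem) (by decide +kernel)
  · exact exists_AA_of 1 ⟨1, 0⟩ ⟨0, 0⟩ ⟨0, 0⟩ ⟨1, 0⟩ (by decide) (AA.one_mem) (by decide +kernel)
  · exact exists_AA_of 0 ⟨-2, -1⟩ ⟨4, -1⟩ ⟨-3, 0⟩ ⟨-1, -1⟩ (by decide) (AA.mul_mem dA_mem tA_mem) (by decide +kernel)
  · exact exists_AA_of 1 ⟨1, 0⟩ ⟨-1, 0⟩ ⟨1, 0⟩ ⟨0, 0⟩ (by decide) (AA.one_mem) (by decide +kernel)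
  · exact exists_AA_of 1 ⟨0, 0⟩ ⟨-1, 0⟩ ⟨1, 0⟩ ⟨-1, 0⟩ (by decide) (AA.one_mem) (by decide +kernel)
  · exact exists_AA_of 0 ⟨-2, -1⟩ ⟨-2, 1⟩ ⟨-4, 0⟩ ⟨2, 1⟩ (by decide) (AA.one_mem) (by decide +kernel)
  · exact exists_AA_of 1 ⟨1, 1⟩ ⟨-3, 0⟩ ⟨5, 0⟩ ⟨-1, 1⟩ (by decide) (cA_mem) (by decide +kernel)
  · exact exists_AA_of 1 ⟨-1, 1⟩ ⟨-3, 0⟩ ⟨4, 1⟩ ⟨-2, 1⟩ (by decide) (dA_mem) (by decide +kernel)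
  · exact exists_AA_of 0 ⟨1, 0⟩ ⟨0, 0⟩ ⟨0, 0⟩ ⟨1, 0⟩ (by decide) (AA.one_mem) (by decide +kernel)
  · exact exists_AA_of 0 ⟨0, 0⟩ ⟨-1, 0⟩ ⟨1, 0⟩ ⟨-1, 0⟩ (by decide) (tA_mem) (by decide +kernel)
  · exact exists_AA_of 2 ⟨1, 0⟩ ⟨0, 0⟩ ⟨0, 0⟩ ⟨1, 0⟩ (by decide) (AA.one_mem) (by decide +kernel)
  · exact exists_AA_of 1 ⟨1, 0⟩ ⟨0, 0⟩ ⟨0, 0⟩ ⟨1, 0⟩ (by decide) (AA.one_mem) (by decide +kernel)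
  · exact exists_AA_of 1 ⟨2, -1⟩ ⟨-4, 0⟩ ⟨-2, -1⟩ ⟨-2, 1⟩ (by decide) (AA.one_mem) (by decide +kernel)
  · exact exists_AA_of 2 ⟨-12, 1⟩ ⟨0, -3⟩ ⟨0, 4⟩ ⟨-12, -1⟩ (by decide) (cA_mem) (by decide +kernel)
  · exact exists_AA_of 2 ⟨-12, 2⟩ ⟨0, -3⟩ ⟨0, 5⟩ ⟨-12, -2⟩ (by decide) (cA_mem) (by decide +kernel)
  · exact exists_AA_of 1 ⟨-3, 2⟩ ⟨6, 0⟩ ⟨7, 2⟩ ⟨3, -2⟩ (by decide) (AA.one_mem) (by decide +kernel)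
  · exact exists_AA_of 1 ⟨8, -1⟩ ⟨0, -2⟩ ⟨0, -3⟩ ⟨-8, -1⟩ (by decide) (AA.mul_mem cA_mem dA_mem) (by decide +kernel)

lemma nbc_isCell (i : Fin 3) (j : Fin (nf i)) : IsCell (nbc i j) := by
  obtain ⟨a, ha, h⟩ := nbc_translate i j
  exact ⟨a, ha, _, h⟩

lemma IsCell.pr {c : Lat × Lat} (hc : IsCell c) {a : Aut} (ha : a ∈ AA) : IsCell (pr a c) := by
  obtain ⟨b, hb, i, rfl⟩ := hc
  exact ⟨a * b, AA.mul_mem ha hb, i, rfl⟩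

lemma Vs_pr {a : Aut} (ha : a ∈ AA) (c : Lat × Lat) (v : Lat) : Vs (pr a c) (a v) ↔ Vs c v := by
  simp only [Vs, O13.pr, null_AA_iff ha, bil_AA ha]

lemma Vs_pr' {a : Aut} (ha : a ∈ AA) (c : Lat × Lat) (v : Lat) :
    Vs (pr a c) v ↔ Vs c (a⁻¹ v) := by
  rw [← Vs_pr ha c, apply_inv_self]

lemma cell_min {c : Lat × Lat} (hc : IsCell c) {v : Lat} (hv : IsNull v) : 78 ≤ bil c.1 v := by
  obtain ⟨a, ha, i, rfl⟩ := hc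
  simp only [pr]
  rw [bil_AA_inv ha]
  exact base_min i (null_AA (AA.inv_mem ha) hv)

lemma base_norm_injective : ∀ i k, bil (base i).1 (base i).1 = bil (base k).1 (base k).1 → i = k := by
  decide

lemma cutting_vector_unique {x y w z : ℤ} (hq : bil (base 0).1 (x, y, w, z) = 0)
    (hn : bil (x, y, w, z) (x, y, w, z) = -2) (hx : 2 ∣ x) (hz : 2 ∣ z) :
    (x, y, w, z) = (base 0).2 ∨ (x, y, w, z) = -(base 0).2 := by
  obtain ⟨x, rfl⟩ := hx
  obtain ⟨z, rfl⟩ := hz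
  simp [bil, base] at hq hn
  have ey : y = 2 * x + 2 * z - 6 * w := by omega
  subst ey
  have key : 3 * (x + z - 4 * w) ^ 2 + (x - z) ^ 2 + w ^ 2 = 1 := by nlinarith
  have h1 : x + z - 4 * w = 0 := by nlinarith [sq_nonneg (x - z), sq_nonneg w]
  rw [h1] at key
  have h2 : w ^ 2 ≤ 1 := by nlinarith [sq_nonneg (x - z)]
  have h3 : w ≤ 1 := by nlinarith
  have h4 : -1 ≤ w := by nlinarith
  obtain rfl | rfl | rfl : w = -1 ∨ w = 0 ∨ w = 1 := by omega
  · have : x - z = 0 := by nlinarith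
    right; simp [base]; omega
  · have : z = -x := by omega
    subst this
    have : 4 * (x * x) = 1 := by nlinarith
    omega
  · have : x - z = 0 := by nlinarith
    left; simp [base]; omega

/-- Cells with the same centre have opposite or equal cutting vectors. -/
lemma cell_unique {q m m' : Lat} (h : IsCell (q, m)) (h' : IsCell (q, m')) :
    m' = m ∨ m' = -m := by
  obtain ⟨a, ha, i, h⟩ := h
  obtain ⟨b, hb, k, h'⟩ := h'
  simp only [pr, Prod.mk.injEq] at h h'
  have hik : i = k := by
    apply base_norm_injective
    rw [← bil_AA ha, ← h.1, h'.1, bil_AA hb]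
  subst hik
  obtain ⟨h1, rfl⟩ := h
  obtain ⟨h2, rfl⟩ := h'
  by_cases hi : i = 0
  swap
  · have : ∀ i, i ≠ 0 → (base i).2 = 0 := by decide
    simp [this i hi]
  subst hi
  set g := a⁻¹ * b with hg
  have hgA : g ∈ AA := AA.mul_mem (AA.inv_mem ha) hb
  have hgq : g (base 0).1 = (base 0).1 := by
    rw [hg, LinearEquiv.mul_apply, ← h2, h1, inv_apply_self]
  have hgm : b (base 0).2 = a (g (base 0).2) := by
    rw [hg, LinearEquiv.mul_apply, apply_inv_self]
  have hev : ∀ v, 2 ∣ bil (g (base 0).2) v := by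
    intro v
    rw [bil_AA_inv hgA]
    generalize g⁻¹ v = u
    simp only [base, bil]
    exact ⟨2 * u.2.2.2 + 2 * u.1 - 2 * u.2.1 - 13 * u.2.2.1, by simp; ring⟩
  have e1 := hev (0, 0, 0, 1)
  have e2 := hev (1, 0, 0, 0)
  have := cutting_vector_unique (x := (g (base 0).2).1) (y := (g (base 0).2).2.1)
    (w := (g (base 0).2).2.2.1) (z := (g (base 0).2).2.2.2)
    (by
      have := bil_AA hgA (base 0).1 (base 0).2
      rw [hgq] at this
      exact this.trans (by decide))
    ((bil_AA hgA _ _).trans (by decide))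
    (by simpa [bil] using e1) (by simpa [bil] using e2)
  rw [hgm]
  rcases this with h | h
  · left; rw [show g (base 0).2 = (base 0).2 from h]
  · right; rw [show g (base 0).2 = -(base 0).2 from h, map_neg]

end O13

namespace O13

lemma cupola_cert {f : Lat} (n : ℤ) (hn : 0 < n) (μ : Fin 8 → ℤ) (hμ : ∀ j, 0 ≤ μ j)
    (h : n • f = μ 0 • (0, 0, -36, 0) +
      μ 1 • (0, -39, 3, 0) +
      μ 2 • (0, 39, 3, 78) +
      μ 3 • (0, 0, 7, 52) +
      μ 4 • (78, 39, 3, 0) +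
      μ 5 • (52, 0, 7, 0) +
      μ 6 • (52, 52, 7, 52) +
      μ 7 • (4, 2, 1, 4)) :
    ∃ n : ℤ, 0 < n ∧ ∃ μ : Fin (nf 0) → ℤ, (∀ j, 0 ≤ μ j) ∧ n • f = ∑ j, μ j • nr 0 j := by
  refine ⟨n, hn, μ, hμ, h.trans ?_⟩
  change _ = ∑ j : Fin 8, μ j • nr 0 j
  rw [Fin.sum_univ_eight, show nr 0 (0 : Fin 8) = (0, 0, -36, 0) by decide,
    show nr 0 (1 : Fin 8) = (0, -39, 3, 0) by decide,
    show nr 0 (2 : Fin 8) = (0, 39, 3, 78) by decide,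
    show nr 0 (3 : Fin 8) = (0, 0, 7, 52) by decide,
    show nr 0 (4 : Fin 8) = (78, 39, 3, 0) by decide,
    show nr 0 (5 : Fin 8) = (52, 0, 7, 0) by decide,
    show nr 0 (6 : Fin 8) = (52, 52, 7, 52) by decide,
    show nr 0 (7 : Fin 8) = (4, 2, 1, 4) by decide]

lemma prism_cert {f : Lat} (n : ℤ) (hn : 0 < n) (μ : Fin 5 → ℤ) (hμ : ∀ j, 0 ≤ μ j)
    (h : n • f = μ 0 • (0, -26, 2, 0) +
      μ 1 • (0, 26, 2, 52) +
      μ 2 • (0, 0, -7, -52) +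
      μ 3 • (78, 39, 32, 182) +
      μ 4 • (78, 39, 23, 104)) :
    ∃ n : ℤ, 0 < n ∧ ∃ μ : Fin (nf 1) → ℤ, (∀ j, 0 ≤ μ j) ∧ n • f = ∑ j, μ j • nr 1 j := by
  refine ⟨n, hn, μ, hμ, h.trans ?_⟩
  change _ = ∑ j : Fin 5, μ j • nr 1 j
  rw [Fin.sum_univ_five, show nr 1 (0 : Fin 5) = (0, -26, 2, 0) by decide,
    show nr 1 (1 : Fin 5) = (0, 26, 2, 52) by decide,
    show nr 1 (2 : Fin 5) = (0, 0, -7, -52) by decide,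
    show nr 1 (3 : Fin 5) = (78, 39, 32, 182) by decide,
    show nr 1 (4 : Fin 5) = (78, 39, 23, 104) by decide]

lemma cube_cert {f : Lat} (n : ℤ) (hn : 0 < n) (μ : Fin 6 → ℤ) (hμ : ∀ j, 0 ≤ μ j)
    (h : n • f = μ 0 • (-78, -39, -23, -104) +
      μ 1 • (26, 13, 3, 0) +
      μ 2 • (702, 234, 216, 936) +
      μ 3 • (702, 468, 216, 1170) +
      μ 4 • (78, 39, 29, 156) +
      μ 5 • (182, 91, 55, 260)) :
    ∃ n : ℤ, 0 < n ∧ ∃ μ : Fin (nf 2) → ℤ, (∀ j, 0 ≤ μ j) ∧ n • f = ∑ j, μ j • nr 2 j := by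
  refine ⟨n, hn, μ, hμ, h.trans ?_⟩
  change _ = ∑ j : Fin 6, μ j • nr 2 j
  rw [Fin.sum_univ_six, show nr 2 (0 : Fin 6) = (-78, -39, -23, -104) by decide,
    show nr 2 (1 : Fin 6) = (26, 13, 3, 0) by decide,
    show nr 2 (2 : Fin 6) = (702, 234, 216, 936) by decide,
    show nr 2 (3 : Fin 6) = (702, 468, 216, 1170) by decide,
    show nr 2 (4 : Fin 6) = (78, 39, 29, 156) by decide,
    show nr 2 (5 : Fin 6) = (182, 91, 55, 260) by decide]

lemma cupola_dual_cone (f : Lat) (h : ∀ v ∈ verts 0, 0 ≤ bil f v) :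
    ∃ n : ℤ, 0 < n ∧ ∃ μ : Fin (nf 0) → ℤ, (∀ j, 0 ≤ μ j) ∧ n • f = ∑ j, μ j • nr 0 j := by
  simp [verts, bil] at h
  rcases le_or_gt (0 : ℤ) (f.2.2.2 - f.1) with h0 | h0
  · rcases le_or_gt (0 : ℤ) (f.1 - 2 * f.2.1) with h1 | h1
    · rcases le_or_gt (0 : ℤ) (f.2.2.2 - 2 * f.2.1) with h2 | h2
      · exact cupola_cert 1872 (by norm_num)
          ![8 * f.1 + (-4) * f.2.1 + (-52) * f.2.2.1 + 7 * f.2.2.2, 24 * f.1 + (-48) * f.2.1, 0, (-36) * f.1 + 36 * f.2.2.2, 0, 0, 0, 468 * f.1]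
          (by simp [Fin.forall_fin_succ]; omega)
          (by simp [Prod.ext_iff]; omega)
      · omega
    · rcases le_or_gt (0 : ℤ) (f.2.2.2 - 2 * f.2.1) with h2 | h2
      · exact cupola_cert 1872 (by norm_num)
          ![11 * f.1 + (-10) * f.2.1 + (-52) * f.2.2.1 + 7 * f.2.2.2, 0, (-24) * f.1 + 48 * f.2.1, (-72) * f.2.1 + 36 * f.2.2.2, 0, 0, 0, 468 * f.1]
          (by simp [Fin.forall_fin_succ]; omega)
          (by simp [Prod.ext_iff]; omega)
      · exact cupola_cert 1872 (by norm_num)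
          ![11 * f.1 + (-12) * f.2.1 + (-52) * f.2.2.1 + 8 * f.2.2.2, 0, (-24) * f.1 + 24 * f.2.2.2, 0, 0, 0, 72 * f.2.1 + (-36) * f.2.2.2, 468 * f.1 + (-936) * f.2.1 + 468 * f.2.2.2]
          (by simp [Fin.forall_fin_succ]; omega)
          (by simp [Prod.ext_iff]; omega)
  · rcases le_or_gt (0 : ℤ) (f.1 - 2 * f.2.1) with h1 | h1
    · rcases le_or_gt (0 : ℤ) (f.2.2.2 - 2 * f.2.1) with h2 | h2
      · exact cupola_cert 1872 (by norm_num)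
          ![7 * f.1 + (-4) * f.2.1 + (-52) * f.2.2.1 + 8 * f.2.2.2, (-48) * f.2.1 + 24 * f.2.2.2, 0, 0, 0, 36 * f.1 + (-36) * f.2.2.2, 0, 468 * f.2.2.2]
          (by simp [Fin.forall_fin_succ]; omega)
          (by simp [Prod.ext_iff]; omega)
      · exact cupola_cert 1872 (by norm_num)
          ![7 * f.1 + (-10) * f.2.1 + (-52) * f.2.2.1 + 11 * f.2.2.2, 0, 0, 0, 48 * f.2.1 + (-24) * f.2.2.2, 36 * f.1 + (-72) * f.2.1, 0, 468 * f.2.2.2]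
          (by simp [Fin.forall_fin_succ]; omega)
          (by simp [Prod.ext_iff]; omega)
    · rcases le_or_gt (0 : ℤ) (f.2.2.2 - 2 * f.2.1) with h2 | h2
      · omega
      · exact cupola_cert 1872 (by norm_num)
          ![8 * f.1 + (-12) * f.2.1 + (-52) * f.2.2.1 + 11 * f.2.2.2, 0, 0, 0, 24 * f.1 + (-24) * f.2.2.2, 0, (-36) * f.1 + 72 * f.2.1, 468 * f.1 + (-936) * f.2.1 + 468 * f.2.2.2]
          (by simp [Fin.forall_fin_succ]; omega)
          (by simp [Prod.ext_iff]; omega)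

lemma prism_dual_cone (f : Lat) (h : ∀ v ∈ verts 1, 0 ≤ bil f v) :
    ∃ n : ℤ, 0 < n ∧ ∃ μ : Fin (nf 1) → ℤ, (∀ j, 0 ≤ μ j) ∧ n • f = ∑ j, μ j • nr 1 j := by
  simp [verts, bil] at h
  rcases le_or_gt (0 : ℤ) (6 * f.1 + 2 * f.2.2.2 - 2 * f.2.1 - 26 * f.2.2.1) with h0 | h0
  · exact prism_cert 156 (by norm_num)
      ![11 * f.1 + (-10) * f.2.1 + (-52) * f.2.2.1 + 7 * f.2.2.2, 8 * f.1 + (-4) * f.2.1 + (-52) * f.2.2.1 + 7 * f.2.2.2, 12 * f.1 + (-4) * f.2.1 + (-52) * f.2.2.1 + 4 * f.2.2.2, 0, 2 * f.1]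
      (by simp [Fin.forall_fin_succ]; omega)
      (by simp [Prod.ext_iff]; omega)
  · exact prism_cert 156 (by norm_num)
      ![17 * f.1 + (-12) * f.2.1 + (-78) * f.2.2.1 + 9 * f.2.2.2, 14 * f.1 + (-6) * f.2.1 + (-78) * f.2.2.1 + 9 * f.2.2.2, 0, (-12) * f.1 + 4 * f.2.1 + 52 * f.2.2.1 + (-4) * f.2.2.2, 14 * f.1 + (-4) * f.2.1 + (-52) * f.2.2.1 + 4 * f.2.2.2]
      (by simp [Fin.forall_fin_succ]; omega)
      (by simp [Prod.ext_iff]; omega)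

lemma cube_dual_cone (f : Lat) (h : ∀ v ∈ verts 2, 0 ≤ bil f v) :
    ∃ n : ℤ, 0 < n ∧ ∃ μ : Fin (nf 2) → ℤ, (∀ j, 0 ≤ μ j) ∧ n • f = ∑ j, μ j • nr 2 j := by
  simp [verts, bil] at h
  rcases le_or_gt (0 : ℤ) (3 * f.1 - 6 * f.2.1) with h0 | h0
  · rcases le_or_gt (0 : ℤ) (6 * f.1 + 2 * f.2.2.2 - 2 * f.2.1 - 26 * f.2.2.1) with h1 | h1
    · rcases le_or_gt (0 : ℤ) (14 * f.1 + 10 * f.2.2.2 - 10 * f.2.1 - 78 * f.2.2.1) with h2 | h2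
      · exact cube_cert 702 (by norm_num)
          ![189 * f.1 + (-135) * f.2.1 + (-1053) * f.2.2.1 + 135 * f.2.2.2, 81 * f.1 + (-27) * f.2.1 + (-351) * f.2.2.1 + 27 * f.2.2.2, 11 * f.1 + (-10) * f.2.1 + (-52) * f.2.2.1 + 7 * f.2.2.2, 8 * f.1 + (-4) * f.2.1 + (-52) * f.2.2.1 + 7 * f.2.2.2, 0, 0]
          (by simp [Fin.forall_fin_succ]; omega)
          (by simp [Prod.ext_iff]; omega)
      · exact cube_cert 468 (by norm_num)
          ![198 * f.1 + (-126) * f.2.1 + (-1170) * f.2.2.1 + 153 * f.2.2.2, 54 * f.1 + (-18) * f.2.1 + (-234) * f.2.2.1 + 18 * f.2.2.2, 2 * f.1 + (-4) * f.2.1, 0, 0, 72 * f.1 + (-36) * f.2.1 + (-468) * f.2.2.1 + 63 * f.2.2.2]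
          (by simp [Fin.forall_fin_succ]; omega)
          (by simp [Prod.ext_iff]; omega)
    · rcases le_or_gt (0 : ℤ) (14 * f.1 + 10 * f.2.2.2 - 10 * f.2.1 - 78 * f.2.2.1) with h2 | h2
      · exact cube_cert 468 (by norm_num)
          ![126 * f.1 + (-90) * f.2.1 + (-702) * f.2.2.1 + 90 * f.2.2.2, 126 * f.1 + (-54) * f.2.1 + (-702) * f.2.2.1 + 81 * f.2.2.2, 2 * f.1 + (-4) * f.2.1, 0, 72 * f.1 + (-36) * f.2.1 + (-468) * f.2.2.1 + 63 * f.2.2.2, 0]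
          (by simp [Fin.forall_fin_succ]; omega)
          (by simp [Prod.ext_iff]; omega)
      · exact cube_cert 468 (by norm_num)
          ![252 * f.1 + (-144) * f.2.1 + (-1404) * f.2.2.1 + 171 * f.2.2.2, 0, 2 * f.1 + (-4) * f.2.1, 0, (-54) * f.1 + 18 * f.2.1 + 234 * f.2.2.1 + (-18) * f.2.2.2, 126 * f.1 + (-54) * f.2.1 + (-702) * f.2.2.1 + 81 * f.2.2.2]
          (by simp [Fin.forall_fin_succ]; omega)
          (by simp [Prod.ext_iff]; omega)
  · rcases le_or_gt (0 : ℤ) (6 * f.1 + 2 * f.2.2.2 - 2 * f.2.1 - 26 * f.2.2.1) with h1 | h1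
    · rcases le_or_gt (0 : ℤ) (14 * f.1 + 10 * f.2.2.2 - 10 * f.2.1 - 78 * f.2.2.1) with h2 | h2
      · exact cube_cert 702 (by norm_num)
          ![189 * f.1 + (-135) * f.2.1 + (-1053) * f.2.2.1 + 135 * f.2.2.2, 81 * f.1 + (-27) * f.2.1 + (-351) * f.2.2.1 + 27 * f.2.2.2, 11 * f.1 + (-10) * f.2.1 + (-52) * f.2.2.1 + 7 * f.2.2.2, 8 * f.1 + (-4) * f.2.1 + (-52) * f.2.2.1 + 7 * f.2.2.2, 0, 0]
          (by simp [Fin.forall_fin_succ]; omega)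
          (by simp [Prod.ext_iff]; omega)
      · exact cube_cert 468 (by norm_num)
          ![225 * f.1 + (-180) * f.2.1 + (-1170) * f.2.2.1 + 153 * f.2.2.2, 54 * f.1 + (-18) * f.2.1 + (-234) * f.2.2.1 + 18 * f.2.2.2, 0, (-2) * f.1 + 4 * f.2.1, 0, 99 * f.1 + (-90) * f.2.1 + (-468) * f.2.2.1 + 63 * f.2.2.2]
          (by simp [Fin.forall_fin_succ]; omega)
          (by simp [Prod.ext_iff]; omega)
    · rcases le_or_gt (0 : ℤ) (14 * f.1 + 10 * f.2.2.2 - 10 * f.2.1 - 78 * f.2.2.1) with h2 | h2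
      · exact cube_cert 468 (by norm_num)
          ![126 * f.1 + (-90) * f.2.1 + (-702) * f.2.2.1 + 90 * f.2.2.2, 153 * f.1 + (-108) * f.2.1 + (-702) * f.2.2.1 + 81 * f.2.2.2, 0, (-2) * f.1 + 4 * f.2.1, 99 * f.1 + (-90) * f.2.1 + (-468) * f.2.2.1 + 63 * f.2.2.2, 0]
          (by simp [Fin.forall_fin_succ]; omega)
          (by simp [Prod.ext_iff]; omega)
      · exact cube_cert 468 (by norm_num)
          ![279 * f.1 + (-198) * f.2.1 + (-1404) * f.2.2.1 + 171 * f.2.2.2, 0, 0, (-2) * f.1 + 4 * f.2.1, (-54) * f.1 + 18 * f.2.1 + 234 * f.2.2.1 + (-18) * f.2.2.2, 153 * f.1 + (-108) * f.2.1 + (-702) * f.2.2.1 + 81 * f.2.2.2]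
          (by simp [Fin.forall_fin_succ]; omega)
          (by simp [Prod.ext_iff]; omega)

/-- A linear form that is nonnegative on a cell is a nonnegative combination of facet forms. -/
lemma dual_cone (i : Fin 3) (f : Lat) (h : ∀ v ∈ verts i, 0 ≤ bil f v) :
    ∃ n : ℤ, 0 < n ∧ ∃ μ : Fin (nf i) → ℤ, (∀ j, 0 ≤ μ j) ∧ n • f = ∑ j, μ j • nr i j := by
  fin_cases i
  exacts [cupola_dual_cone f h, prism_dual_cone f h, cube_dual_cone f h]

end O13

namespace O13

/-- Witnesses that the forms of neighbours of a cell are the optimal ones. -/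
def nw : (i : Fin 3) → Fin (nf i) → Lat
  | 0 => ![(7, 2, -2, 8), (9, 0, 3, 13), (9, 9, 3, 22), (2, 1, 1, 7), (18, 9, 3, 11), (7, 1, 1, 2),
      (7, 6, 1, 7), (16, 8, 4, 17)]
  | 1 => ![(9, 0, 3, 13), (9, 9, 3, 22), (1, 0, 0, 0), (7, 3, 3, 18), (17, 7, 5, 22)]
  | 2 => ![(0, 0, 0, 1), (16, 8, 4, 17), (124, 44, 38, 167), (124, 80, 38, 203), (26, 13, 9, 47),
      (50, 25, 15, 71)]

lemma nw_spec : ∀ i, ∀ j : Fin (nf i),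
    IsNull (nw i j) ∧ bil (nbc i j).1 (nw i j) = 78 ∧ bil (nr i j) (nw i j) < 0 := by
  decide +kernel

lemma nr_nonneg : ∀ i, ∀ j : Fin (nf i), ∀ v ∈ verts i, 0 ≤ bil (nr i j) v := by
  decide +kernel

lemma facet_iff : ∀ i, ∀ j : Fin (nf i), ∀ v ∈ verts i, Vs (nbc i j) v ↔ bil (nr i j) v = 0 := by
  decide +kernel

lemma facets_meet : ∀ i, ∀ j j' : Fin (nf i), j ≠ j' →
    ((verts i).filter fun v => bil (nr i j) v = 0 ∧ bil (nr i j') v = 0).length ≤ 2 := by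
  decide +kernel

lemma facet_mirror : ∀ i, ∀ j : Fin (nf i), (nbc i j).2 = 0 ∨ (nbc i j).1 = (base i).1 ∨
    ((verts i).filter fun v => bil (nr i j) v = 0 ∧ bil (nbc i j).2 v = 0).length ≤ 2 := by
  decide +kernel

lemma nbc_of_eq : ∀ i, ∀ j : Fin (nf i), (nbc i j).1 = (base i).1 →
    nbc i j = ((base i).1, -(base i).2) ∧ nr i j = (base i).2 := by
  decide +kernel

lemma base_snd : ∀ i, (base i).2 = 0 ∨ ∃ j : Fin (nf i), nbc i j = ((base i).1, -(base i).2) ∧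
    nr i j = (base i).2 := by
  decide +kernel

lemma nr_ne_zero : ∀ i, ∀ j : Fin (nf i), nr i j ≠ 0 := by decide +kernel

lemma nbc_ne : ∀ i, ∀ j : Fin (nf i), nbc i j ≠ base i := by decide +kernel

lemma three_le_length {l : List Lat} {a b c : Lat} (hab : a ≠ b) (hac : a ≠ c) (hbc : b ≠ c)
    (ha : a ∈ l) (hb : b ∈ l) (hc : c ∈ l) : 3 ≤ l.length := by
  have h : ({a, b, c} : Finset Lat) ⊆ l.toFinset := by
    intro x; simp only [Finset.mem_insert, Finset.mem_singleton, List.mem_toFinset]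
    rintro (rfl | rfl | rfl) <;> assumption
  have := (Finset.card_le_card h).trans (List.toFinset_card_le l)
  rwa [Finset.card_eq_three.2 ⟨a, b, c, hab, hac, hbc, rfl⟩] at this

lemma eq_zero_of_verts (i : Fin 3) {r : Lat} (h : ∀ v ∈ verts i, bil r v = 0) : r = 0 := by
  obtain ⟨x, y, w, z⟩ := r
  fin_cases i <;> simp [verts, bil] at h <;> simp <;> omega

lemma cell_span {c : Lat × Lat} (hc : IsCell c) {r : Lat} (h : ∀ v, Vs c v → bil r v = 0) :
    r = 0 := by
  obtain ⟨a, ha, i, rfl⟩ := hc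
  have : a⁻¹ r = 0 := by
    apply eq_zero_of_verts i
    intro v hv
    rw [bil_AA_inv (AA.inv_mem ha), inv_inv]
    exact h _ ((Vs_pr ha _ _).2 ((Vs_iff i v).2 hv))
  simpa using this

/-- The sum of the facet forms vanishing at a common vertex is supported on facets through it. -/
lemma dual_cone_support {i : Fin 3} {n : ℤ} {f : Lat} {μ : Fin (nf i) → ℤ} (hμ : ∀ j, 0 ≤ μ j)
    (h : n • f = ∑ j, μ j • nr i j) {v : Lat} (hv : v ∈ verts i) (h0 : bil f v = 0)
    (j : Fin (nf i)) (hj : μ j ≠ 0) : bil (nr i j) v = 0 := by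
  have e := congrArg (fun u => bil u v) h
  simp only [bil_smul_left, bil_sum_left, h0, mul_zero] at e
  have := (Finset.sum_eq_zero_iff_of_nonneg fun j _ =>
    mul_nonneg (hμ j) (nr_nonneg i j v hv)).1 e.symm j (Finset.mem_univ j)
  exact (mul_eq_zero.1 this).resolve_left hj

lemma cell_diff_nonneg {c : Lat × Lat} (hc : IsCell c) (i : Fin 3) :
    ∀ v ∈ verts i, 0 ≤ bil (c.1 - (base i).1) v := by
  intro v hv
  have h := (Vs_iff i v).2 hv
  have := cell_min hc h.1
  rw [bil_sub_left, h.2.1]; omega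

lemma eq_of_same_centre {c : Lat × Lat} (hc : IsCell c) {i : Fin 3} (h1 : c.1 = (base i).1)
    (hne : c ≠ base i) : ∃ j, c = nbc i j ∧ nr i j = (base i).2 := by
  have hb : IsCell (base i) := ⟨1, AA.one_mem, i, rfl⟩
  obtain ⟨q, m⟩ := c
  simp only at h1
  subst h1
  rcases cell_unique (q := (base i).1) (m := (base i).2) hb hc with h | h
  · exact (hne (Prod.ext rfl h)).elim
  · rcases base_snd i with h0 | ⟨j, hj, hj'⟩
    · exact (hne (Prod.ext rfl (by simp [h, h0]))).elim
    · exact ⟨j, by rw [hj, h], hj'⟩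

lemma nbc_fst {i : Fin 3} {j : Fin (nf i)} (h : (nbc i j).1 ≠ (base i).1) :
    (nbc i j).1 = (base i).1 + nr i j := by
  rw [nr, if_neg h]; abel

/-- A cell sharing three vertices with a standard cell is one of its neighbours. -/
lemma neighbour {c : Lat × Lat} (hc : IsCell c) {i : Fin 3} (hne : c ≠ base i) {a b d : Lat}
    (hab : a ≠ b) (had : a ≠ d) (hbd : b ≠ d)
    (hv : ∀ v, v = a ∨ v = b ∨ v = d → Vs (base i) v ∧ Vs c v) :
    ∃ j, c = nbc i j ∧ ∀ v, v = a ∨ v = b ∨ v = d → bil (nr i j) v = 0 := by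
  have hm : ∀ v, v = a ∨ v = b ∨ v = d → v ∈ verts i := fun v h => (Vs_iff i v).1 (hv v h).1
  have h0 : ∀ v, v = a ∨ v = b ∨ v = d → bil (c.1 - (base i).1) v = 0 := fun v h => by
    rw [bil_sub_left, (hv v h).1.2.1, (hv v h).2.2.1, sub_self]
  have three : ∀ p : Lat → Prop, ∀ [DecidablePred p], (∀ v, v = a ∨ v = b ∨ v = d → p v) →
      ((verts i).filter fun v => p v).length ≤ 2 → False := by
    intro p _ hp hle
    have := three_le_length (l := (verts i).filter fun v => p v) hab had hbd
      (by simp [hm a (by simp), hp a (by simp)]) (by simp [hm b (by simp), hp b (by simp)])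
      (by simp [hm d (by simp), hp d (by simp)])
    omega
  obtain ⟨n, hn, μ, hμ, h⟩ := dual_cone i _ (cell_diff_nonneg hc i)
  have supp : ∀ j, μ j ≠ 0 → ∀ v, v = a ∨ v = b ∨ v = d → bil (nr i j) v = 0 :=
    fun j hj v hv => dual_cone_support hμ h (hm v hv) (h0 v hv) j hj
  by_cases hz : ∀ j, μ j = 0
  · have : c.1 = (base i).1 := by
      simp only [hz, zero_smul, Finset.sum_const_zero, smul_eq_zero] at h
      exact sub_eq_zero.1 (h.resolve_left hn.ne')
    obtain ⟨j, hj, hr⟩ := eq_of_same_centre hc this hne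
    refine ⟨j, hj, fun v hv' => ?_⟩
    rw [← facet_iff i j v (hm v hv'), ← hj]
    exact (hv v hv').2
  push Not at hz
  obtain ⟨j, hj⟩ := hz
  have hj0 := supp j hj
  have huniq : ∀ j', j' ≠ j → μ j' = 0 := by
    intro j' hj'
    by_contra hne'
    exact three _ (fun v hv' => ⟨supp j' hne' v hv', hj0 v hv'⟩) (facets_meet i j' j hj')
  rw [Finset.sum_eq_single j (fun j' _ hj' => by rw [huniq j' hj', zero_smul])
    (fun h => absurd (Finset.mem_univ j) h)] at h
  have key : ∀ v, n * bil c.1 v = n * bil (base i).1 v + μ j * bil (nr i j) v := by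
    intro v
    have := congrArg (fun u => bil u v) h
    simp only [bil_smul_left, bil_sub_left] at this
    linarith
  obtain ⟨w0, w1, w2⟩ := nw_spec i j
  have hcw := cell_min hc w0
  have hkw := key (nw i j)
  have hpos : 0 < μ j := lt_of_le_of_ne (hμ j) (Ne.symm hj)
  have hq : (nbc i j).1 ≠ (base i).1 := by
    intro hq
    rw [hq] at w1
    rw [w1] at hkw
    nlinarith
  have hq' := nbc_fst hq
  have hle : μ j ≤ n := by
    rw [hq', bil_add_left] at w1
    by_contra hlt
    push Not at hlt
    nlinarith
  have heq : μ j = n := by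
    by_contra hlt
    have hlt : μ j < n := lt_of_le_of_ne hle hlt
    refine nr_ne_zero i j (cell_span hc fun v hv => ?_)
    have k := key v
    rw [hv.2.1] at k
    have k1 := base_min i hv.1
    have k2 := cell_min (nbc_isCell i j) hv.1
    rw [hq', bil_add_left] at k2
    by_contra hne0
    rcases lt_or_gt_of_ne hne0 with hl | hl
    · nlinarith
    · nlinarith
  have hcq : c.1 = (nbc i j).1 := by
    rw [heq, smul_right_inj hn.ne'] at h
    rw [hq', ← h]; abel
  refine ⟨j, ?_, hj0⟩
  have hnb := nbc_isCell i j
  rcases cell_unique (q := (nbc i j).1) (m := (nbc i j).2) (m' := c.2) hnb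
    (by rw [← hcq]; exact hc) with hm' | hm'
  · exact Prod.ext hcq hm'
  · rcases facet_mirror i j with h2 | h2 | h2
    · exact Prod.ext hcq (by rw [hm', h2, neg_zero])
    · exact absurd h2 hq
    · refine (three _ (fun v hv' => ⟨hj0 v hv', ?_⟩) h2).elim
      have a1 := (hv v hv').2.2.2
      rw [hm', bil_neg_left] at a1
      have a2 := ((facet_iff i j v (hm v hv')).2 (hj0 v hv')).2.2
      omega

end O13

namespace O13

lemma base_functional_nonneg (i : Fin 3) (ψ : Lat →+ ℝ) (h : ∀ v ∈ verts i, 0 ≤ ψ v) :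
    0 ≤ ψ (base i).1 := by
  fin_cases i <;> simp [verts] at h
  · have e : (2 : ℕ) • (base 0).1 = (3 : ℕ) • ((7, 2, 2, 8) + (7, 5, 2, 11) + (8, 2, 2, 7) +
      (8, 6, 2, 11) + (11, 5, 2, 7) + (11, 6, 2, 8) : Lat) := by decide
    have := congrArg ψ e
    simp only [map_nsmul, map_add] at this
    simp only [nsmul_eq_mul] at this
    push_cast at this
    change 0 ≤ ψ (base 0).1
    linarith
  · have e : (3 : ℕ) • (base 1).1 = (5 : ℕ) • ((0, 0, 0, 1) + (2, 1, 1, 7) : Lat) + (7 : ℕ) •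
      ((7, 2, 2, 8) + (7, 5, 2, 11) + (9, 3, 3, 14) + (9, 6, 3, 17) : Lat) := by decide
    have := congrArg ψ e
    simp only [map_nsmul, map_add] at this
    simp only [nsmul_eq_mul] at this
    push_cast at this
    change 0 ≤ ψ (base 1).1
    linarith
  · have e : (2 : ℕ) • (base 2).1 = (3 : ℕ) • ((7, 2, 2, 8) + (7, 5, 2, 11) + (9, 3, 3, 14) +
      (9, 6, 3, 17) + (17, 7, 5, 22) + (17, 10, 5, 25) + (19, 8, 6, 28) + (19, 11, 6, 31) : Lat) := by
      decide
    have := congrArg ψ e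
    simp only [map_nsmul, map_add] at this
    simp only [nsmul_eq_mul] at this
    push_cast at this
    change 0 ≤ ψ (base 2).1
    linarith

/-- Centres of cells are positive combinations of the vertices. -/
lemma cell_functional_nonneg {c : Lat × Lat} (hc : IsCell c) (ψ : Lat →+ ℝ)
    (h : ∀ v, Vs c v → 0 ≤ ψ v) : 0 ≤ ψ c.1 := by
  obtain ⟨a, ha, i, rfl⟩ := hc
  exact base_functional_nonneg i (ψ.comp a.toLinearMap.toAddMonoidHom) fun v hv =>
    h _ ((Vs_pr ha _ _).2 ((Vs_iff i v).2 hv))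

lemma base_timelike : ∀ i, 0 < bil (base i).1 (base i).1 := by decide

lemma cell_timelike {c : Lat × Lat} (hc : IsCell c) : 0 < bil c.1 c.1 := by
  obtain ⟨a, ha, i, rfl⟩ := hc
  simp only [pr, bil_AA ha, base_timelike]

/-- The first and last coordinates as additive maps. -/
def fstHom : Lat →+ ℝ := (Int.castAddHom ℝ).comp (AddMonoidHom.fst ℤ _)
def lstHom : Lat →+ ℝ := (Int.castAddHom ℝ).comp
  ((AddMonoidHom.snd ℤ ℤ).comp ((AddMonoidHom.snd ℤ _).comp (AddMonoidHom.snd ℤ _)))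

lemma fstHom_apply (v : Lat) : fstHom v = v.1 := rfl
lemma lstHom_apply (v : Lat) : lstHom v = v.2.2.2 := rfl

lemma cell_coord_nonneg {c : Lat × Lat} (hc : IsCell c) : 0 ≤ c.1.1 ∧ 0 ≤ c.1.2.2.2 := by
  constructor
  · have := cell_functional_nonneg hc fstHom fun v hv => by
      rw [fstHom_apply]; exact_mod_cast hv.1.2.1
    rw [fstHom_apply] at this; exact_mod_cast this
  · have := cell_functional_nonneg hc lstHom fun v hv => by
      rw [lstHom_apply]; exact_mod_cast hv.1.2.2.1
    rw [lstHom_apply] at this; exact_mod_cast this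

lemma finite_cells (B : ℝ) : {c | IsCell c ∧ (c.1.1 + c.1.2.2.2 : ℝ) ≤ B}.Finite := by
  obtain ⟨N, hN⟩ := exists_int_gt B
  let Q : Set Lat := {q | ∃ m, IsCell (q, m) ∧ q.1 + q.2.2.2 ≤ N}
  have hQ : Q.Finite := by
    refine (Set.Finite.subset ((Set.finite_Icc (0 : ℤ) N).prod ((Set.finite_Icc (-N) N).prod
      ((Set.finite_Icc (-N) N).prod (Set.finite_Icc (0 : ℤ) N)))) ?_)
    rintro ⟨x, y, w, z⟩ ⟨m, hc, hle⟩
    have ht := cell_timelike hc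
    obtain ⟨h0, h3⟩ := cell_coord_nonneg hc
    simp only [bil] at ht h0 h3 hle
    have hxz : x * z ≤ N ^ 2 := by nlinarith
    have hy : |y| ≤ |N| := sq_le_sq.1 (by nlinarith [sq_nonneg w])
    have hw : |w| ≤ |N| := sq_le_sq.1 (by nlinarith [sq_nonneg y, sq_nonneg w])
    rw [abs_of_nonneg (by omega : 0 ≤ N), abs_le] at hy hw
    simp only [Set.mem_prod, Set.mem_Icc]
    omega
  have hfib : ∀ q ∈ Q, {c | IsCell c ∧ c.1 = q}.Finite := by
    rintro q ⟨m, hm, -⟩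
    refine (Set.toFinite {(q, m), (q, -m)}).subset ?_
    rintro ⟨q', m'⟩ ⟨hc, rfl⟩
    rcases cell_unique hm hc with rfl | rfl <;> simp
  refine (hQ.biUnion hfib).subset ?_
  rintro ⟨q, m⟩ ⟨hc, hB⟩
  refine Set.mem_biUnion (x := q) ⟨m, hc, ?_⟩ ⟨hc, rfl⟩
  have : (q.1 + q.2.2.2 : ℝ) < N := lt_of_le_of_lt hB hN
  exact_mod_cast this.le

/-- Only finitely many cells contain two given vertices. -/
lemma finite_star {v v' : Lat} (h : 0 < bil v v') :
    {c | IsCell c ∧ Vs c v ∧ Vs c v'}.Finite := by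
  refine (finite_cells (2 * 156 * ((v + v').1 + (v + v').2.2.2 : ℤ) / (bil (v + v') (v + v') : ℝ))).subset ?_
  rintro c ⟨hc, hv, hv'⟩
  refine ⟨hc, ?_⟩
  have hpp : bil (v + v') (v + v') = 2 * bil v v' := by
    rw [bil_add_left, bil_add_right, bil_add_right, hv.1.1, hv'.1.1, bil_comm v' v]; ring
  have hpos : (0 : ℝ) < bil (v + v') (v + v') := by rw [hpp]; exact_mod_cast (by omega)
  rw [le_div_iff₀ hpos]
  have hp1 : 0 ≤ (v + v').1 := add_nonneg hv.1.2.1 hv'.1.2.1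
  have hp3 : 0 ≤ (v + v').2.2.2 := add_nonneg hv.1.2.2.1 hv'.1.2.2.1
  set p := v + v' with hp
  let ψ : Lat →+ ℝ := (AddMonoidHom.mulLeft ((2 * (p.1 + p.2.2.2) : ℤ) : ℝ)).comp
      ((Int.castAddHom ℝ).comp (bilHom p)) -
    (AddMonoidHom.mulLeft (bil p p : ℝ)).comp (fstHom + lstHom)
  have hψ : ∀ u, ψ u = ((2 * (p.1 + p.2.2.2) * bil p u - bil p p * (u.1 + u.2.2.2) : ℤ) : ℝ) := by
    intro u
    simp [ψ, bilHom, fstHom_apply, lstHom_apply, bil_comm u p]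
  have := cell_functional_nonneg hc ψ fun u hu => by
    rw [hψ]
    have h1 := timelike_bound_fst hp1 hu.1
    have h2 := timelike_bound_snd hp3 hu.1
    exact_mod_cast (by linarith : 0 ≤ 2 * (p.1 + p.2.2.2) * bil p u - bil p p * (u.1 + u.2.2.2))
  rw [hψ] at this
  have hpc : bil p c.1 = 156 := by
    rw [bil_comm, hp, bil_add_right, hv.2.1, hv'.2.1]; norm_num
  rw [hpc] at this
  push_cast at this ⊢
  linarith

end O13

namespace O13

/-- Additive functionals that are positive on the light cone and injective. -/
def Good (φ : Lat →+ ℝ) : Prop := (∀ v, IsNull v → 0 < φ v) ∧ ∀ r, φ r = 0 → r = 0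

def autHom (a : Aut) : Lat →+ Lat := a.toLinearMap.toAddMonoidHom

lemma autHom_apply (a : Aut) (v : Lat) : autHom a v = a v := rfl

lemma Good.comp {φ : Lat →+ ℝ} (h : Good φ) {a : Aut} (ha : a ∈ AA) : Good (φ.comp (autHom a)) :=
  ⟨fun v hv => h.1 _ (null_AA ha hv), fun r hr => by
    have : a r = 0 := h.2 (a r) hr
    simpa using this⟩

lemma null_abs {v : Lat} (hv : IsNull v) :
    2 * |v.2.1| ≤ v.1 + v.2.2.2 ∧ 2 * |v.2.2.1| ≤ v.1 + v.2.2.2 := by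
  obtain ⟨h, h0, h3, -⟩ := hv
  have := sq_of_null h
  constructor
  · rw [← abs_two, ← abs_mul]
    exact abs_le_of_sq_le_sq (by nlinarith [sq_nonneg (v.1 - v.2.2.2), sq_nonneg v.2.2.1]) (by omega)
  · rw [← abs_two, ← abs_mul]
    refine abs_le_of_sq_le_sq ?_ (by omega)
    nlinarith [sq_nonneg (v.1 - v.2.2.2), sq_nonneg v.2.1, sq_nonneg v.2.2.1]

lemma exists_good : ∃ φ : Lat →+ ℝ, Good φ ∧ ∀ v, IsNull v → (v.1 + v.2.2.2 : ℝ) ≤ 2 * φ v := by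
  obtain ⟨t, ht, ht0, ht1⟩ : ∃ t : ℝ, Transcendental ℤ t ∧ 0 < t ∧ t < 1 / 8 := by
    have hd := (Algebraic.countable ℤ ℝ).dense_compl ℝ
    obtain ⟨t, ht, ht'⟩ := hd.exists_mem_open (isOpen_Ioo (a := (0 : ℝ)) (b := 1 / 8))
      ⟨1 / 16, by norm_num, by norm_num⟩
    exact ⟨t, ht, ht'⟩
  let φ : Lat →+ ℝ := AddMonoidHom.mk' (fun v => (v.1 + v.2.2.2 : ℝ) + t * v.1 + t ^ 2 * v.2.1
    + t ^ 3 * v.2.2.1) fun u v => by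
      simp only [Prod.fst_add, Prod.snd_add, Int.cast_add]; ring
  have hφ : ∀ v, φ v = (v.1 + v.2.2.2 : ℝ) + t * v.1 + t ^ 2 * v.2.1 + t ^ 3 * v.2.2.1 := fun _ => rfl
  have hle : ∀ v, IsNull v → (v.1 + v.2.2.2 : ℝ) ≤ 2 * φ v := by
    intro v hv
    obtain ⟨h1, h2⟩ := null_abs hv
    have h1 : 2 * |(v.2.1 : ℝ)| ≤ v.1 + v.2.2.2 := by exact_mod_cast h1
    have h2 : 2 * |(v.2.2.1 : ℝ)| ≤ v.1 + v.2.2.2 := by exact_mod_cast h2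
    have h0 : (0 : ℝ) ≤ v.1 := by exact_mod_cast hv.2.1
    have ht2 : t ^ 2 ≤ 1 / 2 := by nlinarith
    have ht3 : t ^ 3 ≤ 1 / 2 := by nlinarith [pow_pos ht0 2]
    have b1 : -(1 / 2 * |(v.2.1 : ℝ)|) ≤ t ^ 2 * v.2.1 := by
      have := neg_abs_le (v.2.1 : ℝ)
      nlinarith [abs_nonneg (v.2.1 : ℝ), pow_pos ht0 2]
    have b2 : -(1 / 2 * |(v.2.2.1 : ℝ)|) ≤ t ^ 3 * v.2.2.1 := by
      have := neg_abs_le (v.2.2.1 : ℝ)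
      nlinarith [abs_nonneg (v.2.2.1 : ℝ), pow_pos ht0 3]
    have b3 : 0 ≤ t * v.1 := by positivity
    rw [hφ]
    linarith
  refine ⟨φ, ⟨fun v hv => ?_, fun r hr => ?_⟩, hle⟩
  · have h1 : (0 : ℝ) < v.1 + v.2.2.2 := by exact_mod_cast null_pos hv
    have := hle v hv
    linarith
  · rw [hφ] at hr
    let P : Polynomial ℤ := .C (r.1 + r.2.2.2) + .C r.1 * .X + .C r.2.1 * .X ^ 2 + .C r.2.2.1 * .X ^ 3
    have hP : P = 0 := by
      by_contra hne
      refine ht ⟨P, hne, ?_⟩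
      simp [P]
      linarith
    have c0 := congrArg (fun p => Polynomial.coeff p 0) hP
    have c1 := congrArg (fun p => Polynomial.coeff p 1) hP
    have c2 := congrArg (fun p => Polynomial.coeff p 2) hP
    have c3 := congrArg (fun p => Polynomial.coeff p 3) hP
    simp only [P, Polynomial.coeff_add, Polynomial.coeff_C_mul, Polynomial.coeff_X,
      Polynomial.coeff_X_pow, Polynomial.coeff_C, Polynomial.coeff_zero] at c0 c1 c2 c3
    norm_num at c0 c1 c2 c3
    ext
    · exact c1
    · exact c2
    · exact c3
    · simpa [c1] using c0

/-- The cell `c'` is below the cell `c`. -/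
def Lower (φ : Lat →+ ℝ) (c' c : Lat × Lat) : Prop :=
  φ c'.1 < φ c.1 ∨ (c'.1 = c.1 ∧ φ c.2 < φ c'.2)

lemma Lower.pr_iff (φ : Lat →+ ℝ) (a : Aut) (c' c : Lat × Lat) :
    Lower (φ.comp (autHom a)) c' c ↔ Lower φ (pr a c') (pr a c) := by
  simp [Lower, pr, autHom_apply]

lemma Lower.irrefl (φ : Lat →+ ℝ) (c : Lat × Lat) : ¬ Lower φ c c := by simp [Lower]

lemma Lower.trans {φ : Lat →+ ℝ} {a b c : Lat × Lat} (h : Lower φ a b) (h' : Lower φ b c) :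
    Lower φ a c := by
  unfold Lower at *
  rcases h with h | ⟨h, h2⟩ <;> rcases h' with h' | ⟨h', h2'⟩
  · exact .inl (h.trans h')
  · exact .inl (h' ▸ h)
  · exact .inl (h ▸ h')
  · exact .inr ⟨h.trans h', h2'.trans h2⟩

lemma Lower.total {φ : Lat →+ ℝ} (hφ : Good φ) {c c' : Lat × Lat} (hne : c ≠ c') :
    Lower φ c c' ∨ Lower φ c' c := by
  have inj : Function.Injective φ := (injective_iff_map_eq_zero φ).2 hφ.2
  rcases lt_trichotomy (φ c.1) (φ c'.1) with h | h | h
  · exact .inl (.inl h)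
  · rcases lt_trichotomy (φ c.2) (φ c'.2) with h' | h' | h'
    · exact .inr (.inr ⟨(inj h).symm, h'⟩)
    · exact absurd (Prod.ext (inj h) (inj h')) hne
    · exact .inl (.inr ⟨inj h, h'⟩)
  · exact .inr (.inl h)

lemma lower_nbc_iff (φ : Lat →+ ℝ) (i : Fin 3) (j : Fin (nf i)) :
    Lower φ (nbc i j) (base i) ↔ φ (nr i j) < 0 := by
  by_cases h : (nbc i j).1 = (base i).1
  · obtain ⟨h1, h2⟩ := nbc_of_eq i j h
    rw [h2, h1]
    simp [Lower]
  · rw [Lower, nbc_fst h, map_add]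
    constructor
    · rintro (h' | ⟨h', -⟩)
      · linarith
      · exact absurd ((nbc_fst h).trans h') h
    · intro; left; linarith

/-- A fixed good functional. -/
noncomputable def phi : Lat →+ ℝ := exists_good.choose

lemma good_phi : Good phi := exists_good.choose_spec.1

abbrev Cell : Type := {c : Lat × Lat // IsCell c}

lemma finite_lower (c : Cell) : {c' : Cell | Lower phi c'.1 c.1}.Finite := by
  refine Set.Finite.of_finite_image (f := Subtype.val) ((finite_cells (2 * phi c.1.1)).subset ?_)
    Subtype.val_injective.injOn
  rintro _ ⟨⟨c', hc'⟩, hl, rfl⟩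
  refine ⟨hc', ?_⟩
  have h1 : phi c'.1 ≤ phi c.1.1 := by
    rcases hl with h | ⟨h, -⟩
    · exact h.le
    · rw [h]
  have := cell_functional_nonneg hc' ((2 : ℕ) • phi - (fstHom + lstHom)) fun v hv => by
    have := exists_good.choose_spec.2 v hv.1
    simp [fstHom_apply, lstHom_apply]
    exact this
  simp [fstHom_apply, lstHom_apply] at this
  linarith

noncomputable def rank (c : Cell) : ℕ := {c' : Cell | Lower phi c'.1 c.1}.ncard

lemma rank_lt {c c' : Cell} (h : Lower phi c'.1 c.1) : rank c' < rank c := by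
  refine Set.ncard_lt_ncard ?_ (finite_lower c)
  refine ⟨fun d hd => hd.trans h, fun hs => ?_⟩
  exact Lower.irrefl _ _ (hs (show c' ∈ {c' : Cell | Lower phi c'.1 c.1} from h))

lemma rank_injective : Function.Injective rank := by
  intro c c' h
  by_contra hne
  rcases Lower.total good_phi (Subtype.coe_ne_coe.2 hne) with h' | h' <;> have := rank_lt h' <;> omega

lemma rank_lt_iff {c c' : Cell} : rank c' < rank c ↔ Lower phi c'.1 c.1 := by
  refine ⟨fun h => ?_, rank_lt⟩
  rcases Lower.total good_phi (c := c'.1) (c' := c.1) (by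
    intro h'; rw [Subtype.ext h'] at h; omega) with h' | h'
  · exact h'
  · have := rank_lt h'; omega

end O13

namespace O13

def Div3 (u : Lat) : Prop := 3 ∣ u.1 ∧ 3 ∣ u.2.1 ∧ 3 ∣ u.2.2.1 ∧ 3 ∣ u.2.2.2

instance (u : Lat) : Decidable (Div3 u) := by unfold Div3; infer_instance

lemma div3_iff (u : Lat) : Div3 u ↔ ∃ w : Lat, u = (3 : ℤ) • w := by
  constructor
  · rintro ⟨⟨x, hx⟩, ⟨y, hy⟩, ⟨w, hw⟩, ⟨z, hz⟩⟩
    exact ⟨(x, y, w, z), by ext <;> simp [*]⟩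
  · rintro ⟨w, rfl⟩
    simp [Div3]

lemma Div3.map {u : Lat} (h : Div3 u) (a : Aut) : Div3 (a u) := by
  obtain ⟨w, rfl⟩ := (div3_iff u).1 h
  exact (div3_iff _).2 ⟨a w, map_smul a _ _⟩

/-- Two vertices of a cell span an edge. -/
def EdgeCond (v v' : Lat) : Prop :=
  bil v v' = 1 ∨ bil v v' = 2 ∨ bil v v' = 7 ∨ (bil v v' = 9 ∧ Div3 (v - v'))

instance (v v' : Lat) : Decidable (EdgeCond v v') := by unfold EdgeCond; infer_instance

lemma EdgeCond.symm {v v' : Lat} (h : EdgeCond v v') : EdgeCond v' v := by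
  unfold EdgeCond at *
  rw [bil_comm v' v]
  refine h.imp_right (Or.imp_right (Or.imp_right (And.imp_right fun h => ?_)))
  have e : v' - v = -(v - v') := by abel
  obtain ⟨w, hw⟩ := (div3_iff _).1 h
  exact (div3_iff _).2 ⟨-w, by rw [e, hw, smul_neg]⟩

lemma EdgeCond.map {v v' : Lat} (h : EdgeCond v v') {a : Aut} (ha : a ∈ AA) :
    EdgeCond (a v) (a v') := by
  unfold EdgeCond at *
  rw [bil_AA ha, ← map_sub]
  exact h.imp_right (Or.imp_right (Or.imp_right (And.imp_right fun h => h.map a)))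

lemma EdgeCond.map_iff {v v' : Lat} {a : Aut} (ha : a ∈ AA) :
    EdgeCond (a v) (a v') ↔ EdgeCond v v' := by
  refine ⟨fun h => ?_, fun h => h.map ha⟩
  have := h.map (AA.inv_mem ha)
  rwa [inv_apply_self, inv_apply_self] at this

lemma EdgeCond.pos {v v' : Lat} (h : EdgeCond v v') : 0 < bil v v' := by
  unfold EdgeCond at h; omega

/-- The orientation of two cells around an edge. -/
def sg (e c c' : Lat × Lat) : ℤ := Int.sign (vol e.1 e.2 (c.1 - c.2) (c'.1 - c'.2))

/-- The facet `j` contains both vertices. -/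
def InFacet (i : Fin 3) (j : Fin (nf i)) (v v' : Lat) : Prop :=
  bil (nr i j) v = 0 ∧ bil (nr i j) v' = 0

instance (i : Fin 3) (j : Fin (nf i)) (v v' : Lat) : Decidable (InFacet i j v v') := by
  unfold InFacet; infer_instance

lemma edge_facets : ∀ i, ∀ v ∈ verts i, ∀ v' ∈ verts i, EdgeCond v v' →
    ∃ j j' : Fin (nf i), j ≠ j' ∧ InFacet i j v v' ∧ InFacet i j' v v' ∧
      (∀ l : Fin (nf i), InFacet i l v v' → l = j ∨ l = j') ∧
      sg (v, v') (base i) (nbc i j) = - sg (v, v') (base i) (nbc i j') ∧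
      sg (v, v') (base i) (nbc i j) ≠ 0 := by
  decide +kernel

/-- The facets sharing an edge with a given one. -/
def adjFacets : (i : Fin 3) → Fin (nf i) → List (Fin (nf i))
  | 0 => (![[1, 2, 4], [0, 3, 5, 7], [0, 3, 6, 7], [1, 2, 7], [0, 5, 6, 7], [1, 4, 7], [2, 4, 7], [1, 2, 3, 4, 5, 6]] : Fin 8 → List (Fin 8))
  | 1 => (![[1, 2, 3, 4], [0, 2, 3, 4], [0, 1, 4], [0, 1, 4], [0, 1, 2, 3]] : Fin 5 → List (Fin 5))
  | 2 => (![[1, 2, 3, 4], [0, 2, 3, 5], [0, 1, 4, 5], [0, 1, 4, 5], [0, 2, 3, 5], [1, 2, 3, 4]] : Fin 6 → List (Fin 6))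

lemma mem_adjFacets : ∀ i, ∀ j l : Fin (nf i), j ≠ l → (l ∈ adjFacets i j ↔
    ∃ v ∈ verts i, ∃ v' ∈ verts i, EdgeCond v v' ∧ InFacet i j v v' ∧ InFacet i l v v') := by
  decide +kernel

/-- The subset `d` of the facets is empty or a star for the adjacency relation. -/
def IsStar (i : Fin 3) (d : Fin (nf i) → Bool) : Prop :=
  (∀ j, d j = false) ∨ ∃ r, d r = true ∧ ∀ l, d l = true → l ≠ r → l ∈ adjFacets i r ∧
    ∀ l', d l' = true → l' ≠ r → l' ≠ l → l' ∉ adjFacets i l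

instance (i : Fin 3) (d : Fin (nf i) → Bool) : Decidable (IsStar i d) := by
  unfold IsStar; infer_instance

lemma functional_coords (φ : Lat →+ ℝ) : ∃ a b c d : ℝ,
    ∀ x y w z : ℤ, φ (x, y, w, z) = x * a + y * b + w * c + z * d := by
  refine ⟨φ (1, 0, 0, 0), φ (0, 1, 0, 0), φ (0, 0, 1, 0), φ (0, 0, 0, 1), fun x y w z => ?_⟩
  have e : ((x, y, w, z) : Lat) = x • (1, 0, 0, 0) + y • (0, 1, 0, 0) + w • (0, 0, 1, 0) +
    z • (0, 0, 0, 1) := by simp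
  rw [e, map_add, map_add, map_add, map_zsmul, map_zsmul, map_zsmul, map_zsmul]
  simp only [zsmul_eq_mul]

/-- A set of facets given by its indicator function. -/
def cupolaBool (d0 d1 d2 d3 d4 d5 d6 d7 : Bool) : Fin (nf 0) → Bool :=
  (![d0, d1, d2, d3, d4, d5, d6, d7] : Fin 8 → Bool)

set_option synthInstance.maxSize 4000 in
set_option synthInstance.maxHeartbeats 1000000 in
set_option maxHeartbeats 2000000 in
set_option maxRecDepth 10000 in
lemma cupola_star_bool : ∀ d0 d1 d2 d3 d4 d5 d6 d7 : Bool,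
    (¬ (d0 = true ∧ d3 = true) ∧ ¬ (d0 = true ∧ d5 = true) ∧ ¬ (d0 = true ∧ d6 = true) ∧
    ¬ (d0 = true ∧ d7 = true) ∧ ¬ (d1 = true ∧ d6 = true) ∧ ¬ (d2 = true ∧ d5 = true) ∧
    ¬ (d3 = true ∧ d4 = true) ∧ ¬ (d3 = true ∧ d5 = true) ∧ ¬ (d3 = true ∧ d6 = true) ∧
    ¬ (d5 = true ∧ d6 = true) ∧ ¬ (d1 = true ∧ d3 = true ∧ d7 = true) ∧
    ¬ (d1 = true ∧ d5 = true ∧ d7 = true) ∧ ¬ (d2 = true ∧ d3 = true ∧ d7 = true) ∧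
    ¬ (d2 = true ∧ d6 = true ∧ d7 = true) ∧ ¬ (d4 = true ∧ d5 = true ∧ d7 = true) ∧
    ¬ (d4 = true ∧ d6 = true ∧ d7 = true) ∧ (d1 = true ∧ d2 = true → d3 = true) ∧
    (d1 = true ∧ d4 = true → d5 = true) ∧ (d2 = true ∧ d4 = true → d6 = true)) →
    IsStar 0 (cupolaBool d0 d1 d2 d3 d4 d5 d6 d7) := by
  decide +kernel

lemma cupola_star (φ : Lat →+ ℝ) (hφ : Good φ) :
    IsStar 0 fun j => decide (φ (nr 0 j) < 0) := by
  obtain ⟨a, b, c, d, h⟩ := functional_coords φ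
  have pos : ∀ x y w z : ℤ, IsNull (x, y, w, z) → 0 < x * a + y * b + w * c + z * d :=
    fun x y w z hn => h x y w z ▸ hφ.1 _ hn
  have n0 := pos 0 0 0 1 (by decide)
  have n1 := pos 1 0 0 0 (by decide)
  have n2 := pos 1 1 0 1 (by decide)
  have n3 := pos 17 9 4 17 (by decide)
  have n4 := pos 17 8 4 16 (by decide)
  have n5 := pos 16 8 4 17 (by decide)
  have n6 := pos 13 0 3 9 (by decide)
  have n7 := pos 9 0 3 13 (by decide)
  have n8 := pos 9 9 3 22 (by decide)
  have n9 := pos 13 13 3 22 (by decide)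
  have n10 := pos 22 9 3 9 (by decide)
  have n11 := pos 22 13 3 13 (by decide)
  have n12 := pos 7 2 2 8 (by decide)
  have n13 := pos 8 2 2 7 (by decide)
  have n14 := pos 7 5 2 11 (by decide)
  have n15 := pos 8 6 2 11 (by decide)
  have n16 := pos 11 5 2 7 (by decide)
  have n17 := pos 11 6 2 8 (by decide)
  push_cast at n0 n1 n2 n3 n4 n5 n6 n7 n8 n9 n10 n11 n12 n13 n14 n15 n16 n17
  have e : (fun j => decide (φ (nr 0 j) < 0)) =
    (![decide (φ (0, 0, -36, 0) < 0),
      decide (φ (0, -39, 3, 0) < 0),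
      decide (φ (0, 39, 3, 78) < 0),
      decide (φ (0, 0, 7, 52) < 0),
      decide (φ (78, 39, 3, 0) < 0),
      decide (φ (52, 0, 7, 0) < 0),
      decide (φ (52, 52, 7, 52) < 0),
      decide (φ (4, 2, 1, 4) < 0)] : Fin 8 → Bool) := by
    funext j; fin_cases j <;> rfl
  rw [e]
  apply cupola_star_bool
  refine ⟨?_, ?_, ?_, ?_, ?_, ?_, ?_, ?_, ?_, ?_, ?_, ?_, ?_, ?_, ?_, ?_, ?_, ?_, ?_⟩ <;> simp only [decide_eq_true_eq, h, not_and, and_imp] <;> push_cast <;>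
    intros <;> linarith

/-- A set of facets given by its indicator function. -/
def prismBool (d0 d1 d2 d3 d4 : Bool) : Fin (nf 1) → Bool :=
  (![d0, d1, d2, d3, d4] : Fin 5 → Bool)

lemma prism_star_bool : ∀ d0 d1 d2 d3 d4 : Bool,
    (¬ (d2 = true ∧ d3 = true) ∧ ¬ (d0 = true ∧ d1 = true ∧ d2 = true) ∧
    ¬ (d0 = true ∧ d1 = true ∧ d3 = true) ∧ ¬ (d0 = true ∧ d1 = true ∧ d4 = true) ∧
    ¬ (d0 = true ∧ d2 = true ∧ d4 = true) ∧ ¬ (d0 = true ∧ d3 = true ∧ d4 = true) ∧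
    ¬ (d1 = true ∧ d2 = true ∧ d4 = true) ∧ ¬ (d1 = true ∧ d3 = true ∧ d4 = true)) →
    IsStar 1 (prismBool d0 d1 d2 d3 d4) := by
  decide +kernel

lemma prism_star (φ : Lat →+ ℝ) (hφ : Good φ) :
    IsStar 1 fun j => decide (φ (nr 1 j) < 0) := by
  obtain ⟨a, b, c, d, h⟩ := functional_coords φ
  have pos : ∀ x y w z : ℤ, IsNull (x, y, w, z) → 0 < x * a + y * b + w * c + z * d :=
    fun x y w z hn => h x y w z ▸ hφ.1 _ hn
  have n0 := pos 0 0 0 1 (by decide)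
  have n1 := pos 7 2 2 8 (by decide)
  have n2 := pos 7 5 2 11 (by decide)
  have n3 := pos 2 1 1 7 (by decide)
  have n4 := pos 9 3 3 14 (by decide)
  have n5 := pos 9 6 3 17 (by decide)
  push_cast at n0 n1 n2 n3 n4 n5
  have e : (fun j => decide (φ (nr 1 j) < 0)) =
    (![decide (φ (0, -26, 2, 0) < 0),
      decide (φ (0, 26, 2, 52) < 0),
      decide (φ (0, 0, -7, -52) < 0),
      decide (φ (78, 39, 32, 182) < 0),
      decide (φ (78, 39, 23, 104) < 0)] : Fin 5 → Bool) := by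
    funext j; fin_cases j <;> rfl
  rw [e]
  apply prism_star_bool
  refine ⟨?_, ?_, ?_, ?_, ?_, ?_, ?_, ?_⟩ <;> simp only [decide_eq_true_eq, h, not_and] <;> push_cast <;>
    intros <;> linarith

/-- A set of facets given by its indicator function. -/
def cubeBool (d0 d1 d2 d3 d4 d5 : Bool) : Fin (nf 2) → Bool :=
  (![d0, d1, d2, d3, d4, d5] : Fin 6 → Bool)

set_option synthInstance.maxSize 4000 in
set_option synthInstance.maxHeartbeats 1000000 in
set_option maxHeartbeats 2000000 in
set_option maxRecDepth 10000 in
lemma cube_star_bool : ∀ d0 d1 d2 d3 d4 d5 : Bool,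
    (¬ (d0 = true ∧ d5 = true) ∧ ¬ (d1 = true ∧ d4 = true) ∧ ¬ (d2 = true ∧ d3 = true) ∧
    ¬ (d0 = true ∧ d1 = true ∧ d2 = true) ∧ ¬ (d0 = true ∧ d1 = true ∧ d3 = true) ∧
    ¬ (d0 = true ∧ d2 = true ∧ d4 = true) ∧ ¬ (d0 = true ∧ d3 = true ∧ d4 = true) ∧
    ¬ (d1 = true ∧ d2 = true ∧ d5 = true) ∧ ¬ (d1 = true ∧ d3 = true ∧ d5 = true) ∧
    ¬ (d2 = true ∧ d4 = true ∧ d5 = true) ∧ ¬ (d3 = true ∧ d4 = true ∧ d5 = true)) →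
    IsStar 2 (cubeBool d0 d1 d2 d3 d4 d5) := by
  decide +kernel

lemma cube_star (φ : Lat →+ ℝ) (hφ : Good φ) :
    IsStar 2 fun j => decide (φ (nr 2 j) < 0) := by
  obtain ⟨a, b, c, d, h⟩ := functional_coords φ
  have pos : ∀ x y w z : ℤ, IsNull (x, y, w, z) → 0 < x * a + y * b + w * c + z * d :=
    fun x y w z hn => h x y w z ▸ hφ.1 _ hn
  have n0 := pos 7 2 2 8 (by decide)
  have n1 := pos 9 6 3 17 (by decide)
  have n2 := pos 17 10 5 25 (by decide)
  have n3 := pos 19 8 6 28 (by decide)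
  have n4 := pos 7 5 2 11 (by decide)
  have n5 := pos 9 3 3 14 (by decide)
  have n6 := pos 17 7 5 22 (by decide)
  have n7 := pos 19 11 6 31 (by decide)
  push_cast at n0 n1 n2 n3 n4 n5 n6 n7
  have e : (fun j => decide (φ (nr 2 j) < 0)) =
    (![decide (φ (-78, -39, -23, -104) < 0),
      decide (φ (26, 13, 3, 0) < 0),
      decide (φ (702, 234, 216, 936) < 0),
      decide (φ (702, 468, 216, 1170) < 0),
      decide (φ (78, 39, 29, 156) < 0),
      decide (φ (182, 91, 55, 260) < 0)] : Fin 6 → Bool) := by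
    funext j; fin_cases j <;> rfl
  rw [e]
  apply cube_star_bool
  refine ⟨?_, ?_, ?_, ?_, ?_, ?_, ?_, ?_, ?_, ?_, ?_⟩ <;> simp only [decide_eq_true_eq, h, not_and] <;> push_cast <;>
    intros <;> linarith

/-- The descending facets of a standard cell form a star. -/
lemma descending_star (i : Fin 3) (φ : Lat →+ ℝ) (hφ : Good φ) :
    IsStar i fun j => decide (φ (nr i j) < 0) := by
  fin_cases i
  exacts [cupola_star φ hφ, prism_star φ hφ, cube_star φ hφ]

end O13

namespace O13

/-- Both vertices of `e` are vertices of `c`. -/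
def On (e c : Lat × Lat) : Prop := Vs c e.1 ∧ Vs c e.2

instance (e c : Lat × Lat) : Decidable (On e c) := by unfold On; infer_instance

lemma On.pr_iff {a : Aut} (ha : a ∈ AA) (e c : Lat × Lat) : On (pr a e) (pr a c) ↔ On e c := by
  unfold On; simp only [pr]
  exact and_congr (Vs_pr ha c e.1) (Vs_pr ha c e.2)

/-- Two different cells sharing at least three vertices. -/
def Adj (c c' : Lat × Lat) : Prop := c ≠ c' ∧ ∃ a b d, a ≠ b ∧ a ≠ d ∧ b ≠ d ∧
  ∀ v, v = a ∨ v = b ∨ v = d → Vs c v ∧ Vs c' v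

lemma Adj.symm {c c' : Lat × Lat} (h : Adj c c') : Adj c' c := by
  obtain ⟨hne, a, b, d, h1, h2, h3, h⟩ := h
  exact ⟨hne.symm, a, b, d, h1, h2, h3, fun v hv => (h v hv).symm⟩

lemma Adj.pr {c c' : Lat × Lat} (h : Adj c c') {a : Aut} (ha : a ∈ AA) :
    Adj (pr a c) (pr a c') := by
  obtain ⟨hne, x, y, z, h1, h2, h3, h⟩ := h
  refine ⟨fun h => hne (pr_injective a h), a x, a y, a z, fun h => h1 (a.injective h),
    fun h => h2 (a.injective h), fun h => h3 (a.injective h), ?_⟩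
  rintro v (rfl | rfl | rfl) <;> rw [Vs_pr ha, Vs_pr ha] <;> apply h <;> simp

lemma Adj.pr_iff {a : Aut} (ha : a ∈ AA) {c c' : Lat × Lat} :
    Adj (O13.pr a c) (O13.pr a c') ↔ Adj c c' := by
  refine ⟨fun h => ?_, fun h => h.pr ha⟩
  have := h.pr (AA.inv_mem ha)
  rwa [pr_inv_self, pr_inv_self] at this

lemma three_verts : ∀ i, ∀ j : Fin (nf i), ∃ a ∈ verts i, ∃ b ∈ verts i, ∃ d ∈ verts i,
    a ≠ b ∧ a ≠ d ∧ b ≠ d ∧ bil (nr i j) a = 0 ∧ bil (nr i j) b = 0 ∧ bil (nr i j) d = 0 := by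
  decide +kernel

lemma adj_nbc (i : Fin 3) (j : Fin (nf i)) : Adj (base i) (nbc i j) := by
  obtain ⟨a, ha, b, hb, d, hd, h1, h2, h3, ea, eb, ed⟩ := three_verts i j
  refine ⟨(nbc_ne i j).symm, a, b, d, h1, h2, h3, ?_⟩
  rintro v (rfl | rfl | rfl)
  exacts [⟨(Vs_iff i _).2 ha, (facet_iff i j _ ha).2 ea⟩,
    ⟨(Vs_iff i _).2 hb, (facet_iff i j _ hb).2 eb⟩, ⟨(Vs_iff i _).2 hd, (facet_iff i j _ hd).2 ed⟩]

lemma adj_base_iff {c : Lat × Lat} (hc : IsCell c) (i : Fin 3) :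
    Adj (base i) c ↔ ∃ j, c = nbc i j := by
  constructor
  · rintro ⟨hne, a, b, d, h1, h2, h3, h⟩
    obtain ⟨j, hj, -⟩ := neighbour hc hne.symm h1 h2 h3 h
    exact ⟨j, hj⟩
  · rintro ⟨j, rfl⟩
    exact adj_nbc i j

lemma on_nbc_iff {i : Fin 3} {e : Lat × Lat} (he : On e (base i)) (j : Fin (nf i)) :
    On e (nbc i j) ↔ InFacet i j e.1 e.2 :=
  and_congr (facet_iff i j _ ((Vs_iff i _).1 he.1)) (facet_iff i j _ ((Vs_iff i _).1 he.2))

lemma nbc_injective : ∀ i, ∀ j j' : Fin (nf i), nbc i j = nbc i j' → j = j' := by decide +kernel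

lemma sg_pr {a : Aut} (ha : a ∈ AA) : ∃ ε : ℤ, (ε = 1 ∨ ε = -1) ∧
    ∀ e c c', sg (pr a e) (pr a c) (pr a c') = ε * sg e c c' := by
  obtain ⟨ε, hε, h⟩ := vol_AA ha
  refine ⟨ε, hε, fun e c c' => ?_⟩
  simp only [sg, pr, ← map_sub, h, Int.sign_mul]
  rcases hε with rfl | rfl <;> simp

lemma sg_anti (e c c' : Lat × Lat) : sg e c' c = - sg e c c' := by
  simp only [sg]; rw [vol_swap_right, Int.sign_neg]

lemma sg_flip (e c c' : Lat × Lat) : sg e.swap c c' = - sg e c c' := by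
  simp only [sg, Prod.fst_swap, Prod.snd_swap]; rw [vol_swap_left, Int.sign_neg]

/-- At an edge of a cell there are exactly two facets of the cell. -/
lemma edge_two {c e : Lat × Lat} (hc : IsCell c) (he : EdgeCond e.1 e.2) (hec : On e c) :
    ∃ l l', IsCell l ∧ IsCell l' ∧ l ≠ l' ∧ (Adj c l ∧ On e l) ∧ (Adj c l' ∧ On e l') ∧
      (∀ x, IsCell x → Adj c x → On e x → x = l ∨ x = l') ∧ sg e c l = - sg e c l' ∧
      sg e c l ≠ 0 := by
  obtain ⟨a, ha, i, rfl⟩ := hc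
  obtain ⟨e, rfl⟩ : ∃ e', e = pr a e' := ⟨_, (pr_self_inv a e).symm⟩
  rw [On.pr_iff ha] at hec
  obtain ⟨j, j', hj, h1, h2, h3, h4, h5⟩ := edge_facets i e.1 ((Vs_iff i _).1 hec.1) e.2
    ((Vs_iff i _).1 hec.2) ((EdgeCond.map_iff ha).1 he)
  obtain ⟨ε, hε, hs⟩ := sg_pr ha
  refine ⟨pr a (nbc i j), pr a (nbc i j'), (nbc_isCell i j).pr ha, (nbc_isCell i j').pr ha,
    fun h => hj (nbc_injective i _ _ (pr_injective a h)),
    ⟨(adj_nbc i j).pr ha, (On.pr_iff ha _ _).2 ((on_nbc_iff hec j).2 h1)⟩,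
    ⟨(adj_nbc i j').pr ha, (On.pr_iff ha _ _).2 ((on_nbc_iff hec j').2 h2)⟩, ?_, ?_, ?_⟩
  · intro x hx hadj hon
    obtain ⟨x, rfl⟩ : ∃ x', x = pr a x' := ⟨_, (pr_self_inv a x).symm⟩
    have hx := hx.pr (AA.inv_mem ha)
    rw [pr_inv_self] at hx
    obtain ⟨l, rfl⟩ := (adj_base_iff hx i).1 ((Adj.pr_iff ha).1 hadj)
    rcases h3 l ((on_nbc_iff hec l).1 ((On.pr_iff ha _ _).1 hon)) with rfl | rfl
    exacts [Or.inl rfl, Or.inr rfl]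
  · rw [hs, hs, show sg e (base i) (nbc i j) = _ from h4, mul_neg]
  · rw [hs]
    have : sg e (base i) (nbc i j) ≠ 0 := h5
    rcases hε with rfl | rfl <;> simpa using this

lemma EdgeCond.ne {v v' : Lat} (h : EdgeCond v v') (hv : IsNull v) : v ≠ v' := by
  rintro rfl
  have := h.pos
  have := hv.1
  omega

/-- Two facets of a cell share at most one edge. -/
lemma edge_unique {c l l' e e' : Lat × Lat} (hc : IsCell c) (hl : IsCell l) (hl' : IsCell l')
    (hne : l ≠ l') (hcl : Adj c l) (hcl' : Adj c l') (he : EdgeCond e.1 e.2)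
    (he' : EdgeCond e'.1 e'.2) (h : On e c ∧ On e l ∧ On e l') (h' : On e' c ∧ On e' l ∧ On e' l') :
    e' = e ∨ e' = e.swap := by
  obtain ⟨a, ha, i, rfl⟩ := hc
  obtain ⟨e, rfl⟩ : ∃ e', e = pr a e' := ⟨_, (pr_self_inv a e).symm⟩
  obtain ⟨e', rfl⟩ : ∃ e'', e' = pr a e'' := ⟨_, (pr_self_inv a e').symm⟩
  obtain ⟨l, rfl⟩ : ∃ e', l = pr a e' := ⟨_, (pr_self_inv a l).symm⟩
  obtain ⟨l', rfl⟩ : ∃ e', l' = pr a e' := ⟨_, (pr_self_inv a l').symm⟩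
  rw [Adj.pr_iff ha] at hcl hcl'
  simp only [On.pr_iff ha] at h h'
  have hl := hl.pr (AA.inv_mem ha)
  have hl' := hl'.pr (AA.inv_mem ha)
  rw [pr_inv_self] at hl hl'
  obtain ⟨j, rfl⟩ := (adj_base_iff hl i).1 hcl
  obtain ⟨j', rfl⟩ := (adj_base_iff hl' i).1 hcl'
  have hjj : j ≠ j' := fun h => hne (by rw [h])
  have hlen := facets_meet i j j' hjj
  have n1 := ((EdgeCond.map_iff ha).1 he).ne h.1.1.1
  have n2 := ((EdgeCond.map_iff ha).1 he').ne h'.1.1.1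
  have hm : ∀ e : Lat × Lat, On e (base i) ∧ On e (nbc i j) ∧ On e (nbc i j') →
      ∀ v, v = e.1 ∨ v = e.2 →
      v ∈ (verts i).filter fun v => bil (nr i j) v = 0 ∧ bil (nr i j') v = 0 := by
    rintro e ⟨h0, h1, h2⟩ v hv
    have h1 := (on_nbc_iff h0 j).1 h1
    have h2 := (on_nbc_iff h0 j').1 h2
    rw [List.mem_filter, decide_eq_true_eq]
    rcases hv with rfl | rfl
    exacts [⟨(Vs_iff i _).1 h0.1, h1.1, h2.1⟩, ⟨(Vs_iff i _).1 h0.2, h1.2, h2.2⟩]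
  have key : ∀ v, v = e'.1 ∨ v = e'.2 → v = e.1 ∨ v = e.2 := by
    intro v hv
    by_contra hcon
    push Not at hcon
    have := three_le_length n1 (Ne.symm hcon.1) (Ne.symm hcon.2) (hm e h _ (Or.inl rfl))
      (hm e h _ (Or.inr rfl)) (hm e' h' v hv)
    omega
  rcases key _ (Or.inl rfl) with h1 | h1 <;> rcases key _ (Or.inr rfl) with h2 | h2
  · exact absurd (h1.trans h2.symm) n2
  · exact Or.inl (congrArg (pr a) (Prod.ext h1 h2))
  · exact Or.inr (congrArg (pr a) (Prod.ext h1 h2 : e' = e.swap))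
  · exact absurd (h1.trans h2.symm) n2

lemma exists_lower_facet {φ : Lat →+ ℝ} {i : Fin 3} {c : Lat × Lat} (hc : IsCell c)
    (h : Lower φ c (base i)) : ∃ j : Fin (nf i), φ (nr i j) < 0 := by
  by_contra hcon
  push Not at hcon
  rcases h with h | ⟨h1, h2⟩
  · obtain ⟨n, hn, μ, hμ, e⟩ := dual_cone i _ (cell_diff_nonneg hc i)
    have e := congrArg φ e
    rw [map_zsmul, map_sum] at e
    have h3 : 0 ≤ ∑ j, φ (μ j • nr i j) := Finset.sum_nonneg fun j _ => by
      rw [map_zsmul]; exact zsmul_nonneg (hcon j) (hμ j)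
    rw [← e, zsmul_eq_mul, map_sub] at h3
    have hn : (0 : ℝ) < n := by exact_mod_cast hn
    nlinarith
  · obtain ⟨j, rfl, -⟩ := eq_of_same_centre hc h1 (by rintro rfl; exact lt_irrefl _ h2)
    exact absurd ((lower_nbc_iff φ i j).1 (Or.inr ⟨h1, h2⟩)) (not_lt.2 (hcon j))

lemma edge_lower {φ : Lat →+ ℝ} {i : Fin 3} {e c : Lat × Lat} (he : On e (base i))
    (hφ : ∀ j : Fin (nf i), InFacet i j e.1 e.2 → φ (nr i j) < 0) (hc : IsCell c) (hec : On e c) :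
    c = base i ∨ Lower φ c (base i) := by
  by_cases hne : c = base i
  · exact Or.inl hne
  right
  by_cases h1 : c.1 = (base i).1
  · obtain ⟨j, rfl, -⟩ := eq_of_same_centre hc h1 hne
    exact (lower_nbc_iff φ i j).2 (hφ j ((on_nbc_iff he j).1 hec))
  · left
    obtain ⟨n, hn, μ, hμ, e'⟩ := dual_cone i _ (cell_diff_nonneg hc i)
    have hsup : ∀ j, μ j ≠ 0 → φ (nr i j) < 0 := fun j hj => hφ j
      ⟨dual_cone_support hμ e' ((Vs_iff i _).1 he.1)
        (by rw [bil_sub_left, hec.1.2.1, he.1.2.1, sub_self]) j hj,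
       dual_cone_support hμ e' ((Vs_iff i _).1 he.2)
        (by rw [bil_sub_left, hec.2.2.1, he.2.2.1, sub_self]) j hj⟩
    have hex : ∃ j, μ j ≠ 0 := by
      by_contra hcon
      push Not at hcon
      simp only [hcon, zero_smul, Finset.sum_const_zero] at e'
      rcases smul_eq_zero.1 e' with h | h
      · omega
      · exact h1 (sub_eq_zero.1 h)
    obtain ⟨j₀, hj₀⟩ := hex
    have e' := congrArg φ e'
    rw [map_zsmul, map_sum] at e'
    have h3 : ∑ j, φ (μ j • nr i j) < 0 := by
      refine Finset.sum_neg' (fun j _ => ?_) ⟨j₀, Finset.mem_univ _, ?_⟩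
      · rw [map_zsmul, zsmul_eq_mul]
        by_cases hj : μ j = 0
        · simp [hj]
        · exact mul_nonpos_of_nonneg_of_nonpos (by exact_mod_cast hμ j) (hsup j hj).le
      · rw [map_zsmul, zsmul_eq_mul]
        have : 0 < μ j₀ := lt_of_le_of_ne (hμ j₀) (Ne.symm hj₀)
        exact mul_neg_of_pos_of_neg (by exact_mod_cast this) (hsup j₀ hj₀)
    rw [← e', zsmul_eq_mul, map_sub] at h3
    have hn : (0 : ℝ) < n := by exact_mod_cast hn
    nlinarith

/-- The structure of the descending neighbours of a cell. -/
def StarAt (φ : Lat →+ ℝ) (c : Lat × Lat) : Prop :=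
  (∀ c', IsCell c' → ¬ Lower φ c' c) ∨ ∃ r, IsCell r ∧ Adj c r ∧ Lower φ r c ∧
    (∀ l, IsCell l → Adj c l → Lower φ l c → l ≠ r → ∃ e, EdgeCond e.1 e.2 ∧ On e c ∧ On e l ∧
      On e r ∧ ∀ c', IsCell c' → On e c' → c' = c ∨ Lower φ c' c) ∧
    ∀ e l₁ l₂, EdgeCond e.1 e.2 → IsCell l₁ → IsCell l₂ → On e c → On e l₁ → On e l₂ → Adj c l₁ →
      Adj c l₂ → Lower φ l₁ c → Lower φ l₂ c → l₁ ≠ l₂ → l₁ = r ∨ l₂ = r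

lemma starAt_base {φ : Lat →+ ℝ} (hφ : Good φ) (i : Fin 3) : StarAt φ (base i) := by
  rcases descending_star i φ hφ with h | ⟨r, hr, h⟩
  · left
    intro c' hc' hl
    obtain ⟨j, hj⟩ := exists_lower_facet hc' hl
    have := h j
    simp only [decide_eq_false_iff_not] at this
    exact this hj
  · right
    simp only [decide_eq_true_eq] at hr h
    refine ⟨nbc i r, nbc_isCell i r, adj_nbc i r, (lower_nbc_iff φ i r).2 hr, ?_, ?_⟩
    · intro l hl hadj hlow hne
      obtain ⟨l, rfl⟩ := (adj_base_iff hl i).1 hadj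
      have hne : l ≠ r := fun h => hne (by rw [h])
      rw [lower_nbc_iff] at hlow
      obtain ⟨v, hv, v', hv', he, hr', hl'⟩ :=
        (mem_adjFacets i r l hne.symm).1 (h l hlow hne).1
      have hon : On (v, v') (base i) := ⟨(Vs_iff i _).2 hv, (Vs_iff i _).2 hv'⟩
      refine ⟨(v, v'), he, hon, (on_nbc_iff hon l).2 hl', (on_nbc_iff hon r).2 hr', ?_⟩
      intro c' hc' hon'
      refine edge_lower hon (fun j hj => ?_) hc' hon'
      obtain ⟨j₁, j₂, -, -, -, h3, -⟩ := edge_facets i v hv v' hv' he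
      have e1 := h3 l hl'
      have e2 := h3 r hr'
      have e3 := h3 j hj
      have : j = l ∨ j = r := by grind
      rcases this with rfl | rfl <;> assumption
    · intro e l₁ l₂ he h1 h2 h0 o1 o2 a1 a2 w1 w2 hne
      obtain ⟨l₁, rfl⟩ := (adj_base_iff h1 i).1 a1
      obtain ⟨l₂, rfl⟩ := (adj_base_iff h2 i).1 a2
      rw [lower_nbc_iff] at w1 w2
      have hne : l₁ ≠ l₂ := fun h => hne (by rw [h])
      by_contra hcon
      push Not at hcon
      have n1 : l₁ ≠ r := fun h => hcon.1 (by rw [h])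
      have n2 : l₂ ≠ r := fun h => hcon.2 (by rw [h])
      exact (h l₁ w1 n1).2 l₂ w2 n2 hne.symm ((mem_adjFacets i l₁ l₂ hne).2
        ⟨e.1, (Vs_iff i _).1 h0.1, e.2, (Vs_iff i _).1 h0.2, he, (on_nbc_iff h0 _).1 o1,
          (on_nbc_iff h0 _).1 o2⟩)

lemma isCell_pr_iff {a : Aut} (ha : a ∈ AA) {c : Lat × Lat} : IsCell (pr a c) ↔ IsCell c := by
  refine ⟨fun h => ?_, fun h => h.pr ha⟩
  have := h.pr (AA.inv_mem ha)
  rwa [pr_inv_self] at this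

lemma pr_surjective (a : Aut) : Function.Surjective (pr a) := fun x => ⟨_, pr_self_inv a x⟩

lemma edgeCond_pr_iff {a : Aut} (ha : a ∈ AA) {e : Lat × Lat} :
    EdgeCond (pr a e).1 (pr a e).2 ↔ EdgeCond e.1 e.2 := EdgeCond.map_iff ha

lemma starAt {φ : Lat →+ ℝ} (hφ : Good φ) {c : Lat × Lat} (hc : IsCell c) : StarAt φ c := by
  obtain ⟨a, ha, i, rfl⟩ := hc
  have h := starAt_base (hφ.comp ha) i
  rcases h with h | ⟨r, h1, h2, h3, h4, h5⟩
  · refine Or.inl ((pr_surjective a).forall.2 fun c' hc' => ?_)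
    rw [← Lower.pr_iff]
    exact h c' ((isCell_pr_iff ha).1 hc')
  · refine Or.inr ⟨pr a r, (isCell_pr_iff ha).2 h1, h2.pr ha, (Lower.pr_iff _ _ _ _).1 h3,
      (pr_surjective a).forall.2 fun l => ?_, (pr_surjective a).forall.2 fun e =>
      (pr_surjective a).forall.2 fun l₁ => (pr_surjective a).forall.2 fun l₂ => ?_⟩
    · rw [isCell_pr_iff ha, Adj.pr_iff ha, ← Lower.pr_iff, (pr_injective a).ne_iff]
      intro g1 g2 g3 g4
      obtain ⟨e, e1, e2, e3, e4, e5⟩ := h4 l g1 g2 g3 g4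
      refine ⟨pr a e, (edgeCond_pr_iff ha).2 e1, (On.pr_iff ha _ _).2 e2, (On.pr_iff ha _ _).2 e3,
        (On.pr_iff ha _ _).2 e4, (pr_surjective a).forall.2 fun c' => ?_⟩
      rw [isCell_pr_iff ha, On.pr_iff ha, ← Lower.pr_iff, (pr_injective a).eq_iff]
      exact e5 c'
    · simp only [isCell_pr_iff ha, Adj.pr_iff ha, On.pr_iff ha, edgeCond_pr_iff ha, ← Lower.pr_iff,
        (pr_injective a).eq_iff, ne_eq]
      exact h5 e l₁ l₂

end O13

namespace O13

open Finsupp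

/-- A discrete Morse function on the dual two-complex of a cell decomposition: `C` are the cells,
`E` the oriented codimension-two faces, `S e` the oriented cycle of cells around `e`. -/
structure MorseData (k C E : Type) [Field k] where
  rank : C → ℕ
  rank_inj : Function.Injective rank
  adj : C → C → Prop
  adj_symm : ∀ c c', adj c c' → adj c' c
  flip : E → E
  S : E → C × C →₀ k
  S_anti : ∀ e c c', S e (c', c) = - S e (c, c')
  S_flip : ∀ e, S (flip e) = - S e
  flip_flip : ∀ e, flip (flip e) = e
  S_adj : ∀ e c c', S e (c, c') ≠ 0 → adj c c'
  S_cycle : ∀ e, mapDomain Prod.snd (S e) = 0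
  bot : C
  star : ∀ c, ((∀ c', adj c c' → rank c ≤ rank c') ∧ c = bot) ∨
    ∃ r, adj c r ∧ rank r < rank c ∧ ∃ leaf : C → E,
      (∀ l, adj c l → rank l < rank c → l ≠ r → S (leaf l) (c, l) ≠ 0 ∧
        (∀ l', S (leaf l) (c, l') ≠ 0 → l' = l ∨ l' = r) ∧
        ∀ p, S (leaf l) p ≠ 0 → rank p.1 ≤ rank c) ∧
      ∀ e l₁ l₂, l₁ ≠ l₂ → S e (c, l₁) ≠ 0 → S e (c, l₂) ≠ 0 → rank l₁ < rank c →
        rank l₂ < rank c → ∃ l, adj c l ∧ rank l < rank c ∧ l ≠ r ∧ (e = leaf l ∨ e = flip (leaf l))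

namespace MorseData

variable {k C E : Type} [Field k] (D : MorseData k C E)

lemma mapDomain_snd_apply {z : C × C →₀ k} (hz : mapDomain Prod.snd z = 0) {c r : C}
    (h : ∀ l, z (l, c) ≠ 0 → l = r) : z (r, c) = 0 := by
  classical
  have h0 := congrArg (fun f => f c) hz
  simp only [mapDomain, Finsupp.sum, Finsupp.finsetSum_apply, Finsupp.coe_zero, Pi.zero_apply] at h0
  by_contra hne
  rw [Finset.sum_eq_single (r, c)] at h0
  · exact hne (by simpa using h0)
  · rintro ⟨a, b⟩ hab hne'
    rw [single_apply, if_neg]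
    intro hb
    simp only at hb
    subst hb
    exact hne' (by rw [h a (by simpa using hab)])
  · intro hn
    simp at hn
    simp [hn]

lemma exists_other {e : E} {c l : C} (h : D.S e (c, l) ≠ 0) : ∃ l', l' ≠ l ∧ D.S e (c, l') ≠ 0 := by
  by_contra hcon
  push Not at hcon
  refine h ?_
  have := mapDomain_snd_apply (D.S_cycle e) (c := c) (r := l) fun l' hl' => ?_
  · rw [D.S_anti, this, neg_zero]
  · by_contra hne
    exact hl' (by rw [D.S_anti, hcon l' hne, neg_zero])

/-- Antisymmetric chains of edges. -/
def chains₂ : Submodule k (E →₀ k) where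
  carrier := {x | ∀ e, x (D.flip e) = - x e}
  zero_mem' := by simp
  add_mem' := by intro a b ha hb e; simp [ha e, hb e]; ring
  smul_mem' := by intro a b ha e; simp [ha e]

/-- Antisymmetric chains of adjacent cells. -/
def chains₁ : Submodule k (C × C →₀ k) where
  carrier := {z | ∀ c c', z (c', c) = - z (c, c') ∧ (z (c, c') ≠ 0 → D.adj c c')}
  zero_mem' := by simp
  add_mem' := by
    intro a b ha hb c c'
    refine ⟨by simp [(ha c c').1, (hb c c').1]; ring, fun h => ?_⟩
    by_contra hn
    have h1 := (ha c c').2.mt hn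
    have h2 := (hb c c').2.mt hn
    push Not at h1 h2
    exact h (by simp [h1, h2])
  smul_mem' := by
    intro a b hb c c'
    refine ⟨by simp [(hb c c').1], fun h => (hb c c').2 fun h0 => h (by simp [h0])⟩

lemma S_mem (e : E) : D.S e ∈ D.chains₁ := fun c c' => ⟨D.S_anti e c c', D.S_adj e c c'⟩

lemma linearCombination_mem (x : E →₀ k) : linearCombination k D.S x ∈ D.chains₁ := by
  rw [linearCombination_apply]
  exact Submodule.sum_mem _ fun e _ => Submodule.smul_mem _ _ (D.S_mem e)

lemma mapDomain_linearCombination (x : E →₀ k) :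
    mapDomain Prod.snd (linearCombination k D.S x) = 0 := by
  rw [linearCombination_apply, ← lmapDomain_apply k k, Finsupp.sum, map_sum]
  refine Finset.sum_eq_zero fun e _ => ?_
  rw [map_smul, lmapDomain_apply, D.S_cycle, smul_zero]

lemma exists_boundary₁ (e : E) (h2 : (2 : k) ≠ 0) :
    ∃ x ∈ D.chains₂, linearCombination k D.S x = D.S e := by
  classical
  refine ⟨(2 : k)⁻¹ • (single e 1 - single (D.flip e) 1), fun f => ?_, ?_⟩
  · have : ∀ a b : E, a = D.flip b ↔ D.flip a = b := fun a b =>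
      ⟨fun h => by rw [h, D.flip_flip], fun h => by rw [← h, D.flip_flip]⟩
    have e1 : (D.flip e = D.flip f) = (e = f) := by rw [← this, D.flip_flip]
    have e2 : (e = D.flip f) = (D.flip e = f) := by rw [this]
    simp only [Finsupp.smul_apply, Finsupp.sub_apply, single_apply, smul_eq_mul, e1, e2]
    ring
  · rw [map_smul, map_sub]
    simp only [linearCombination_single, one_smul, D.S_flip, sub_neg_eq_add, ← two_smul k (D.S e),
      smul_smul]
    rw [inv_mul_cancel₀ h2, one_smul]

lemma exact₁_aux (h2 : (2 : k) ≠ 0) (n : ℕ) : ∀ z ∈ D.chains₁, mapDomain Prod.snd z = 0 →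
    (∀ c c', z (c, c') ≠ 0 → D.rank c < n) → ∃ x ∈ D.chains₂, linearCombination k D.S x = z := by
  classical
  induction n with
  | zero =>
    intro z _ _ h
    refine ⟨0, Submodule.zero_mem _, ?_⟩
    ext ⟨c, c'⟩
    by_contra hne
    exact absurd (h c c' (by simpa [eq_comm] using hne)) (by omega)
  | succ n ih =>
    intro z hz hcyc hn
    by_cases hc : ∃ c, D.rank c = n
    swap
    · exact ih z hz hcyc fun c c' h =>
        lt_of_le_of_ne (Nat.le_of_lt_succ (hn c c' h)) fun h' => hc ⟨c, h'⟩
    obtain ⟨c, rfl⟩ := hc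
    have hn' : ∀ a b, z (a, b) ≠ 0 → D.rank b ≤ D.rank c := fun a b h =>
      Nat.le_of_lt_succ (hn b a (by rw [(hz a b).1]; simpa using h))
    have hlow : ∀ l, z (c, l) ≠ 0 → D.adj c l ∧ D.rank l < D.rank c := fun l h => by
      have hadj := (hz c l).2 h
      refine ⟨hadj, lt_of_le_of_ne (hn' c l h) fun heq => ?_⟩
      have : l = c := D.rank_inj heq
      subst this
      have := (hz l l).1
      have h0 : (2 : k) * z (l, l) = 0 := by linear_combination this
      exact h ((mul_eq_zero.1 h0).resolve_left h2)
    rcases D.star c with ⟨hmin, -⟩ | ⟨r, -, hrr, leaf, hleaf, -⟩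
    · refine ih z hz hcyc fun a b h => lt_of_le_of_ne (Nat.le_of_lt_succ (hn a b h)) fun h' => ?_
      have := D.rank_inj h'
      subst this
      obtain ⟨h3, h4⟩ := hlow b h
      have := hmin b h3
      omega
    · set L : Finset C := (z.support.filter fun p => p.1 = c ∧ p.2 ≠ r).image Prod.snd with hL
      have hmem : ∀ l, l ∈ L ↔ z (c, l) ≠ 0 ∧ l ≠ r := by
        intro l
        simp [hL, Finset.mem_image]
      let y : C × C →₀ k := ∑ l ∈ L, (z (c, l) * (D.S (leaf l) (c, l))⁻¹) • D.S (leaf l)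
      have hLp : ∀ l ∈ L, D.adj c l ∧ D.rank l < D.rank c ∧ l ≠ r := fun l hl =>
        ⟨(hlow l ((hmem l).1 hl).1).1, (hlow l ((hmem l).1 hl).1).2, ((hmem l).1 hl).2⟩
      have hy₁ : y ∈ D.chains₁ := Submodule.sum_mem _ fun l _ => Submodule.smul_mem _ _ (D.S_mem _)
      have hycyc : mapDomain Prod.snd y = 0 := by
        rw [← lmapDomain_apply k k, map_sum]
        refine Finset.sum_eq_zero fun e _ => ?_
        rw [map_smul, lmapDomain_apply, D.S_cycle, smul_zero]
      have hyim : ∃ x ∈ D.chains₂, linearCombination k D.S x = y := by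
        choose x hx hx' using fun e => D.exists_boundary₁ (k := k) e h2
        refine ⟨∑ l ∈ L, (z (c, l) * (D.S (leaf l) (c, l))⁻¹) • x (leaf l),
          Submodule.sum_mem _ fun l _ => Submodule.smul_mem _ _ (hx _), ?_⟩
        rw [map_sum]
        exact Finset.sum_congr rfl fun l _ => by rw [map_smul, hx']
      have hyc : ∀ l, l ≠ r → y (c, l) = z (c, l) := by
        intro l hl
        simp only [y, Finsupp.finsetSum_apply, Finsupp.smul_apply, smul_eq_mul]
        by_cases hlL : l ∈ L
        · rw [Finset.sum_eq_single l]
          · obtain ⟨h1, h3, h4⟩ := hLp l hlL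
            rw [mul_assoc, inv_mul_cancel₀ (hleaf l h1 h3 h4).1, mul_one]
          · intro b hb hbl
            obtain ⟨h1, h3, h4⟩ := hLp b hb
            by_contra hne
            rcases (hleaf b h1 h3 h4).2.1 l (right_ne_zero_of_mul hne) with h | h
            exacts [hbl h.symm, hl h]
          · exact fun h => absurd hlL h
        · rw [Finset.sum_eq_zero]
          · by_contra hne
            exact hlL ((hmem l).2 ⟨Ne.symm hne, hl⟩)
          · intro b hb
            obtain ⟨h1, h3, h4⟩ := hLp b hb
            by_contra hne
            rcases (hleaf b h1 h3 h4).2.1 l (right_ne_zero_of_mul hne) with h | h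
            · exact hlL (h ▸ hb)
            · exact hl h
      have hyr : ∀ a b, y (a, b) ≠ 0 → D.rank a ≤ D.rank c := by
        intro a b h
        simp only [y, Finsupp.finsetSum_apply, Finsupp.smul_apply, smul_eq_mul] at h
        obtain ⟨l, hl, hne⟩ := Finset.exists_ne_zero_of_sum_ne_zero h
        obtain ⟨h1, h3, h4⟩ := hLp l hl
        exact (hleaf l h1 h3 h4).2.2 (a, b) (right_ne_zero_of_mul hne)
      have hw₁ : z - y ∈ D.chains₁ := Submodule.sub_mem _ hz hy₁
      have hwcyc : mapDomain Prod.snd (z - y) = 0 := by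
        rw [← lmapDomain_apply k k, map_sub, lmapDomain_apply, lmapDomain_apply, hcyc, hycyc, sub_zero]
      have hwc : ∀ l, l ≠ r → (z - y) (c, l) = 0 := fun l hl => by
        rw [Finsupp.sub_apply, hyc l hl, sub_self]
      have hwr : (z - y) (r, c) = 0 := mapDomain_snd_apply hwcyc fun l hl => by
        by_contra hne
        exact hl (by rw [(hw₁ c l).1, hwc l hne, neg_zero])
      obtain ⟨x, hx, hx'⟩ := ih (z - y) hw₁ hwcyc fun a b h => by
        refine lt_of_le_of_ne ?_ fun h' => ?_
        · by_contra hlt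
          push Not at hlt
          have hza : z (a, b) = 0 := by
            by_contra hne
            have := hn a b hne
            omega
          have hya : y (a, b) = 0 := by
            by_contra hne
            have := hyr a b hne
            omega
          exact h (by rw [Finsupp.sub_apply, hza, hya, sub_zero])
        · have := D.rank_inj h'
          subst this
          by_cases hb : b = r
          · subst hb
            exact h (by rw [(hw₁ b a).1, hwr, neg_zero])
          · exact h (hwc b hb)
      obtain ⟨x', hx₂, hx₂'⟩ := hyim
      exact ⟨x + x', Submodule.add_mem _ hx hx₂, by rw [map_add, hx', hx₂', sub_add_cancel]⟩

lemma exact₁ (h2 : (2 : k) ≠ 0) {z : C × C →₀ k} (hz : z ∈ D.chains₁)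
    (h : mapDomain Prod.snd z = 0) : ∃ x ∈ D.chains₂, linearCombination k D.S x = z := by
  refine D.exact₁_aux h2 (z.support.sup (fun p => D.rank p.1) + 1) z hz h fun c c' hne => ?_
  exact Nat.lt_succ_of_le
    (Finset.le_sup (f := fun p : C × C => D.rank p.1) (Finsupp.mem_support_iff.2 hne))

lemma exists_path (c : C) :
    ∃ z ∈ D.chains₁, mapDomain Prod.snd z = single c (1 : k) - single D.bot 1 := by
  classical
  induction h : D.rank c using Nat.strong_induction_on generalizing c with
  | _ n ih =>
  subst h
  rcases D.star c with ⟨-, rfl⟩ | ⟨r, hadj, hr, -⟩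
  · exact ⟨0, Submodule.zero_mem _, by simp⟩
  · obtain ⟨z, hz, hz'⟩ := ih _ hr r rfl
    refine ⟨z + (single (r, c) 1 - single (c, r) 1), Submodule.add_mem _ hz ?_, ?_⟩
    · have hrc : c ≠ r := by rintro rfl; omega
      intro a b
      simp only [Finsupp.sub_apply, single_apply, Prod.mk.injEq]
      refine ⟨by simp only [and_comm, neg_sub], fun h => ?_⟩
      by_cases h1 : r = a ∧ c = b
      · rw [← h1.1, ← h1.2]; exact D.adj_symm _ _ hadj
      · by_cases h3 : c = a ∧ r = b
        · rw [← h3.1, ← h3.2]; exact hadj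
        · simp [h1, h3] at h
    · rw [← lmapDomain_apply k k, map_add, map_sub]
      simp only [lmapDomain_apply, mapDomain_single, hz']
      abel

lemma exact₀ {x : C →₀ k} (hx : x.sum (fun _ a => a) = 0) :
    ∃ z ∈ D.chains₁, mapDomain Prod.snd z = x := by
  choose z hz hz' using D.exists_path
  refine ⟨x.sum fun c a => a • z c, Submodule.sum_mem _ fun c _ => Submodule.smul_mem _ _ (hz c), ?_⟩
  rw [← lmapDomain_apply k k, Finsupp.sum, map_sum]
  simp only [map_smul, lmapDomain_apply, hz', smul_sub, Finset.sum_sub_distrib, smul_single,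
    smul_eq_mul, mul_one]
  have : ∑ c ∈ x.support, single D.bot (x c) = (0 : C →₀ k) := by
    rw [← single_finsetSum]
    have h : ∑ c ∈ x.support, x c = 0 := hx
    rw [h, single_zero]
  rw [this, sub_zero]
  exact x.sum_single

lemma injective₂ (h2 : (2 : k) ≠ 0) {x : E →₀ k} (hx : x ∈ D.chains₂)
    (h : linearCombination k D.S x = 0) (hS : ∀ e, D.S e ≠ 0) : x = 0 := by
  classical
  by_contra hne
  let T : Finset (C × C) := x.support.biUnion fun e => (D.S e).support
  have hT : T.Nonempty := by
    obtain ⟨e, he⟩ := Finsupp.support_nonempty_iff.2 hne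
    obtain ⟨p, hp⟩ := Finsupp.support_nonempty_iff.2 (hS e)
    exact ⟨p, Finset.mem_biUnion.2 ⟨e, he, hp⟩⟩
  obtain ⟨⟨c, l₁⟩, hc, hmax⟩ := Finset.exists_max_image T (fun p => D.rank p.1) hT
  have hmax' : ∀ e, x e ≠ 0 → ∀ l, D.S e (c, l) ≠ 0 → D.rank l < D.rank c := by
    intro e he l hl
    have h3 : D.S e (l, c) ≠ 0 := by rw [D.S_anti]; simpa using hl
    have := hmax (l, c) (Finset.mem_biUnion.2
      ⟨e, Finsupp.mem_support_iff.2 he, Finsupp.mem_support_iff.2 h3⟩)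
    refine lt_of_le_of_ne this fun heq => ?_
    have := D.rank_inj heq
    subst this
    have h4 := D.S_anti e l l
    have h0 : (2 : k) * D.S e (l, l) = 0 := by linear_combination h4
    exact hl ((mul_eq_zero.1 h0).resolve_left h2)
  obtain ⟨e₁, he₁, hs₁⟩ := Finset.mem_biUnion.1 hc
  rw [Finsupp.mem_support_iff] at he₁ hs₁
  rcases D.star c with ⟨hmin, -⟩ | ⟨r, -, -, leaf, hleaf, hall⟩
  · have := hmin l₁ (D.S_adj _ _ _ hs₁)
    have := hmax' e₁ he₁ l₁ hs₁
    omega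
  have key : ∀ e, x e ≠ 0 → ∀ l, D.S e (c, l) ≠ 0 →
      ∃ l, D.adj c l ∧ D.rank l < D.rank c ∧ l ≠ r ∧ (e = leaf l ∨ e = D.flip (leaf l)) := by
    intro e he l hl
    obtain ⟨l', hne', hl'⟩ := D.exists_other hl
    exact hall e l' l hne' hl' hl (hmax' e he _ hl') (hmax' e he _ hl)
  obtain ⟨l, hadj, hrk, hlr, hel⟩ := key e₁ he₁ l₁ hs₁
  obtain ⟨hl0, hl1, -⟩ := hleaf l hadj hrk hlr
  have hxl : x (leaf l) ≠ 0 := by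
    rcases hel with rfl | rfl
    · exact he₁
    · rw [hx] at he₁; simpa using he₁
  have hfl : D.flip (leaf l) ≠ leaf l := by
    intro heq
    have := hx (leaf l)
    rw [heq] at this
    have h0 : (2 : k) * x (leaf l) = 0 := by linear_combination this
    exact hxl ((mul_eq_zero.1 h0).resolve_left h2)
  have hval := congrArg (fun f => f (c, l)) h
  simp only [linearCombination_apply, Finsupp.sum, Finsupp.finsetSum_apply, Finsupp.smul_apply, smul_eq_mul,
    Finsupp.coe_zero, Pi.zero_apply] at hval
  have hsub : {leaf l, D.flip (leaf l)} ⊆ x.support := by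
    intro e he
    rw [Finset.mem_insert, Finset.mem_singleton] at he
    rw [Finsupp.mem_support_iff]
    rcases he with rfl | rfl
    · exact hxl
    · rw [hx]; simpa using hxl
  rw [← Finset.sum_subset hsub, Finset.sum_pair hfl.symm, hx, D.S_flip] at hval
  · have h0 : (2 : k) * (x (leaf l) * D.S (leaf l) (c, l)) = 0 := by
      rw [← hval]; simp; ring
    exact (mul_ne_zero h2 (mul_ne_zero hxl hl0)) h0
  · intro e he hnot
    rw [Finsupp.mem_support_iff] at he
    by_contra hne'
    have hse := right_ne_zero_of_mul hne'
    obtain ⟨l', hadj', hrk', hlr', hel'⟩ := key e he l hse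
    have hs' : D.S (leaf l') (c, l) ≠ 0 := by
      rcases hel' with rfl | rfl
      · exact hse
      · rw [D.S_flip] at hse; simpa using hse
    rcases (hleaf l' hadj' hrk' hlr').2.1 l hs' with h | h
    · subst h
      exact hnot (by simpa using hel')
    · exact hlr h

end MorseData

end O13

namespace O13

open Finsupp

/-- The oriented edges of the cell decomposition. -/
abbrev Edge : Type :=
  {e : Lat × Lat // EdgeCond e.1 e.2 ∧ ∃ c, IsCell c ∧ On e c}

namespace Edge

/-- Reversal of the orientation. -/
def flip (e : Edge) : Edge := ⟨e.1.swap, e.2.1.symm, by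
  obtain ⟨-, c, hc, h⟩ := e.2
  exact ⟨c, hc, h.2, h.1⟩⟩

end Edge

/-- The two cells are adjacent along a facet containing the edge. -/
def Around (e : Edge) (p : Cell × Cell) : Prop :=
  Adj p.1.1 p.2.1 ∧ On e.1 p.1.1 ∧ On e.1 p.2.1

lemma finite_around (e : Edge) : {p | Around e p}.Finite := by
  have h : {c : Cell | On e.1 c.1}.Finite :=
    Set.Finite.of_finite_image ((finite_star e.2.1.pos).subset (by
      rintro _ ⟨c, hc, rfl⟩
      exact ⟨c.2, hc⟩)) Subtype.val_injective.injOn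
  exact (h.prod h).subset fun p hp => ⟨hp.2.1, hp.2.2⟩

section

variable (k : Type) [Field k]

open Classical in
/-- The oriented cycle of cells around an edge. -/
noncomputable def link (e : Edge) : Cell × Cell →₀ k :=
  Finsupp.ofSupportFinite (fun p => if Around e p then ((sg e.1 p.1.1 p.2.1 : ℤ) : k) else 0)
    ((finite_around e).subset fun p hp => by
      by_contra h
      exact hp (if_neg h))

variable {k}

open Classical in
lemma link_apply (e : Edge) (p : Cell × Cell) :
    link k e p = if Around e p then ((sg e.1 p.1.1 p.2.1 : ℤ) : k) else 0 := rfl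

lemma Around.symm {e : Edge} {c c' : Cell} (h : Around e (c, c')) : Around e (c', c) :=
  ⟨h.1.symm, h.2.2, h.2.1⟩

lemma link_anti (e : Edge) (c c' : Cell) : link k e (c', c) = - link k e (c, c') := by
  rw [link_apply, link_apply]
  by_cases h : Around e (c, c')
  · rw [if_pos h, if_pos h.symm, sg_anti, Int.cast_neg]
  · rw [if_neg h, if_neg fun h' => h h'.symm, neg_zero]

lemma link_flip (e : Edge) : link k e.flip = - link k e := by
  ext p
  rw [Finsupp.neg_apply, link_apply, link_apply]
  have : Around e.flip p ↔ Around e p := by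
    simp only [Around, On, Edge.flip, Prod.fst_swap, Prod.snd_swap]; tauto
  by_cases h : Around e p
  · rw [if_pos h, if_pos (this.2 h), ← Int.cast_neg]
    exact congrArg _ (sg_flip _ _ _)
  · rw [if_neg h, if_neg (fun h' => h (this.1 h')), neg_zero]

lemma cast_sg_ne_zero {e c c' : Lat × Lat} (h : sg e c c' ≠ 0) : ((sg e c c' : ℤ) : k) ≠ 0 := by
  have : sg e c c' = 1 ∨ sg e c c' = -1 := by
    rcases Int.sign_trichotomy (vol e.1 e.2 (c.1 - c.2) (c'.1 - c'.2)) with h' | h' | h'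
    exacts [Or.inl h', absurd h' h, Or.inr h']
  rcases this with h | h <;> rw [h] <;> simp

lemma link_ne_zero_iff (e : Edge) (p : Cell × Cell) : link k e p ≠ 0 ↔ Around e p := by
  rw [link_apply]
  refine ⟨fun h => by by_contra h'; exact h (if_neg h'), fun h => ?_⟩
  rw [if_pos h]
  obtain ⟨l, l', -, -, -, -, -, h1, h2, h3⟩ := edge_two p.1.2 e.2.1 h.2.1
  rcases h1 p.2.1 p.2.2 h.1 h.2.2 with h4 | h4 <;> rw [h4]
  · exact cast_sg_ne_zero h3
  · exact cast_sg_ne_zero fun h => h3 (by rw [h2, h, neg_zero])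

lemma link_ne_zero (e : Edge) : link k e ≠ 0 := by
  obtain ⟨h1, c, hc, h2⟩ := e.2
  obtain ⟨l, l', hl, -, -, h3, -⟩ := edge_two hc h1 h2
  intro h
  exact (link_ne_zero_iff (k := k) e (⟨c, hc⟩, ⟨l, hl⟩)).2 ⟨h3.1, h2, h3.2⟩ (by rw [h]; rfl)

lemma link_cycle (e : Edge) : mapDomain Prod.snd (link k e) = 0 := by
  classical
  ext c
  have e0 : mapDomain Prod.snd (link k e) c =
      ∑ p ∈ (link k e).support, if p.2 = c then link k e p else 0 := by
    rw [mapDomain, Finsupp.sum, Finsupp.finsetSum_apply]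
    exact Finset.sum_congr rfl fun p _ => by rw [single_apply]
  rw [e0, Finsupp.coe_zero, Pi.zero_apply]
  by_cases hc : On e.1 c.1
  · obtain ⟨l, l', hl, hl', hne, h1, h2, h3, h4, h5⟩ := edge_two c.2 e.2.1 hc
    have a1 : Around e (⟨l, hl⟩, c) := ⟨h1.1.symm, h1.2, hc⟩
    have a2 : Around e (⟨l', hl'⟩, c) := ⟨h2.1.symm, h2.2, hc⟩
    rw [← Finset.sum_subset (s₁ := {((⟨l, hl⟩ : Cell), c), ((⟨l', hl'⟩ : Cell), c)})]
    · rw [Finset.sum_pair (fun h => hne (congrArg (fun p : Cell × Cell => p.1.1) h)), if_pos rfl,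
        if_pos rfl, link_apply, link_apply, if_pos a1, if_pos a2, ← Int.cast_add]
      simp only []
      rw [sg_anti e.1 c.1 l, sg_anti e.1 c.1 l', h4]
      simp
    · intro p hp
      rw [Finset.mem_insert, Finset.mem_singleton] at hp
      rw [Finsupp.mem_support_iff, link_ne_zero_iff]
      rcases hp with rfl | rfl <;> assumption
    · rintro ⟨x, y⟩ hp hn
      refine if_neg ?_
      rintro rfl
      rw [Finsupp.mem_support_iff, link_ne_zero_iff] at hp
      refine hn ?_
      rw [Finset.mem_insert, Finset.mem_singleton]
      rcases h3 x.1 x.2 hp.1.symm hp.2.1 with h | h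
      · exact Or.inl (Prod.ext (Subtype.ext h) rfl)
      · exact Or.inr (Prod.ext (Subtype.ext h) rfl)
  · refine Finset.sum_eq_zero fun p hp => if_neg ?_
    rintro rfl
    rw [Finsupp.mem_support_iff, link_ne_zero_iff] at hp
    exact hc hp.2.2

lemma isCell_base (i : Fin 3) : IsCell (base i) := ⟨1, AA.one_mem, i, rfl⟩

instance : Nonempty Cell := ⟨⟨base 0, isCell_base 0⟩⟩

instance : Nonempty Edge := ⟨⟨((0, 0, 0, 1), (1, 0, 0, 0)), by decide, base 0, isCell_base 0,
  by decide⟩⟩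

lemma exists_bot : ∃ c : Cell, ∀ c', rank c ≤ rank c' :=
  ⟨Function.argmin rank, fun c' => Function.argmin_le rank c'⟩

variable (k)

/-- The discrete Morse function on the cell decomposition. -/
noncomputable def morse : MorseData k Cell Edge where
  rank := rank
  rank_inj := rank_injective
  adj c c' := Adj c.1 c'.1
  adj_symm _ _ h := h.symm
  flip := Edge.flip
  S := link k
  S_anti := link_anti
  S_flip := link_flip
  flip_flip _ := rfl
  S_adj e c c' h := ((link_ne_zero_iff e _).1 h).1
  S_cycle := link_cycle
  bot := exists_bot.choose
  star c := by
    rcases starAt good_phi c.2 with h | ⟨r, hr, h1, h2, h3, h4⟩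
    · left
      have hc : ∀ c', rank c ≤ rank c' := fun c' => by
        by_contra hlt
        exact h c'.1 c'.2 (rank_lt_iff.1 (not_le.1 hlt))
      exact ⟨fun c' _ => hc c', rank_injective (le_antisymm (hc _) (exists_bot.choose_spec _))⟩
    · right
      have hleaf : ∀ l : Cell, ∃ e : Edge, Adj c.1 l.1 → rank l < rank c → l ≠ ⟨r, hr⟩ →
          On e.1 c.1 ∧ On e.1 l.1 ∧ On e.1 r ∧
          ∀ c', IsCell c' → On e.1 c' → c' = c.1 ∨ Lower phi c' c.1 := by
        intro l
        by_cases hl : Adj c.1 l.1 ∧ rank l < rank c ∧ l ≠ ⟨r, hr⟩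
        · obtain ⟨e, he, h⟩ := h3 l.1 l.2 hl.1 (rank_lt_iff.1 hl.2.1) fun h => hl.2.2 (Subtype.ext h)
          exact ⟨⟨e, he, c.1, c.2, h.1⟩, fun _ _ _ => h⟩
        · exact ⟨Classical.arbitrary _, fun g1 g2 g3 => absurd ⟨g1, g2, g3⟩ hl⟩
      choose leaf hleaf using hleaf
      refine ⟨⟨r, hr⟩, h1, rank_lt_iff.2 h2, leaf, fun l g1 g2 g3 => ?_, ?_⟩
      · obtain ⟨f1, f2, f3, f4⟩ := hleaf l g1 g2 g3
        refine ⟨(link_ne_zero_iff _ _).2 ⟨g1, f1, f2⟩, fun l' hl' => ?_, fun p hp => ?_⟩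
        · have hl' := (link_ne_zero_iff _ _).1 hl'
          obtain ⟨x, x', -, -, -, -, -, h5, -⟩ := edge_two c.2 (leaf l).2.1 f1
          have e1 := h5 _ l.2 g1 f2
          have e2 := h5 _ hr h1 f3
          have e3 := h5 _ l'.2 hl'.1 hl'.2.2
          have g3 : l.1 ≠ r := fun h => g3 (Subtype.ext h)
          have : l'.1 = l.1 ∨ l'.1 = r := by grind
          exact this.imp Subtype.ext fun h => Subtype.ext h
        · have hp := (link_ne_zero_iff _ _).1 hp
          rcases f4 _ p.1.2 hp.2.1 with h | h
          · exact le_of_eq (congrArg rank (Subtype.ext h))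
          · exact (rank_lt_iff.2 h).le
      · intro e l₁ l₂ hne s1 s2 k1 k2
        have s1 := (link_ne_zero_iff _ _).1 s1
        have s2 := (link_ne_zero_iff _ _).1 s2
        have key : ∀ l : Cell, l ≠ ⟨r, hr⟩ → Around e (c, l) → On e.1 r → rank l < rank c →
            e = leaf l ∨ e = (leaf l).flip := by
          intro l n1 n2 n3 n4
          obtain ⟨f1, f2, f3, -⟩ := hleaf l n2.1 n4 n1
          rcases edge_unique c.2 l.2 hr (fun h => n1 (Subtype.ext h)) n2.1 h1 (leaf l).2.1 e.2.1
            ⟨f1, f2, f3⟩ ⟨n2.2.1, n2.2.2, n3⟩ with h | h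
          exacts [Or.inl (Subtype.ext h), Or.inr (Subtype.ext h)]
        rcases h4 e.1 l₁.1 l₂.1 e.2.1 l₁.2 l₂.2 s1.2.1 s1.2.2 s2.2.2 s1.1 s2.1 (rank_lt_iff.1 k1)
          (rank_lt_iff.1 k2) (fun h => hne (Subtype.ext h)) with rfl | rfl
        · exact ⟨l₂, s2.1, k2, hne.symm, key _ hne.symm s2 s1.2.2 k2⟩
        · exact ⟨l₁, s1.1, k1, hne, key _ hne s1 s2.2.2 k1⟩

end

end O13

namespace O13
open CategoryTheory

section Homology
variable {k G : Type} [CommRing k] [Group G]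

/-- The map induced on group homology by a morphism of coefficients. -/
noncomputable def hm (q : ℕ) {A B : Rep k G} (f : A ⟶ B) :
    groupHomology A q →ₗ[k] groupHomology B q :=
  ((groupHomology.functor k G q).map f).hom

lemma hm_id (q : ℕ) (A : Rep k G) : hm q (𝟙 A) = LinearMap.id := by
  simp only [hm, CategoryTheory.Functor.map_id]; rfl

lemma hm_comp (q : ℕ) {A B C : Rep k G} (f : A ⟶ B) (g : B ⟶ C) :
    hm q (f ≫ g) = hm q g ∘ₗ hm q f := by
  simp only [hm, CategoryTheory.Functor.map_comp]; rfl

instance chainsFunctor_additive : (groupHomology.chainsFunctor k G).Additive where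
  map_add {A B f g} := by
    apply HomologicalComplex.hom_ext
    intro i
    apply ModuleCat.hom_ext
    apply LinearMap.ext
    intro x
    have h1 := groupHomology.chainsMap_id_f_hom_eq_mapRange i (f + g)
    have h2 := groupHomology.chainsMap_id_f_hom_eq_mapRange i f
    have h3 := groupHomology.chainsMap_id_f_hom_eq_mapRange i g
    simp only [HomologicalComplex.add_f_apply, ModuleCat.hom_add, LinearMap.add_apply]
    erw [h1, h2, h3]
    apply Finsupp.ext
    intro y
    rfl

lemma hm_add (q : ℕ) {A B : Rep k G} (f g : A ⟶ B) : hm q (f + g) = hm q f + hm q g := by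
  have h : (groupHomology.functor k G q).map (f + g) =
      (groupHomology.functor k G q).map f + (groupHomology.functor k G q).map g := by
    change HomologicalComplex.homologyMap ((groupHomology.chainsFunctor k G).map (f + g)) q = _
    rw [Functor.map_add, HomologicalComplex.homologyMap_add]
    rfl
  simp only [hm, h]; rfl

/-- `hm` as an additive map. -/
noncomputable def hmAdd (q : ℕ) (A B : Rep k G) :
    (A ⟶ B) →+ (groupHomology A q →ₗ[k] groupHomology B q) :=
  AddMonoidHom.mk' (hm q) (hm_add q)

lemma hm_zero (q : ℕ) (A B : Rep k G) : hm q (0 : A ⟶ B) = 0 := (hmAdd q A B).map_zero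
lemma hm_neg (q : ℕ) {A B : Rep k G} (f : A ⟶ B) : hm q (-f) = -hm q f := (hmAdd q A B).map_neg f
lemma hm_sub (q : ℕ) {A B : Rep k G} (f g : A ⟶ B) : hm q (f - g) = hm q f - hm q g :=
  (hmAdd q A B).map_sub f g
/-- A short exact sequence of representations, as concrete data. -/
structure SES {A B C : Rep k G} (f : A ⟶ B) (g : B ⟶ C) : Prop where
  inj : Function.Injective f.hom
  surj : Function.Surjective g.hom
  exact : ∀ x, g.hom x = 0 ↔ ∃ y, f.hom y = x

lemma SES.comp_eq {A B C : Rep k G} {f : A ⟶ B} {g : B ⟶ C} (h : SES f g) : f ≫ g = 0 := by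
  ext x
  exact (h.exact _).2 ⟨x, rfl⟩

lemma SES.shortExact {A B C : Rep k G} {f : A ⟶ B} {g : B ⟶ C} (h : SES f g) :
    (ShortComplex.mk f g h.comp_eq).ShortExact := by
  refine { exact := ?_, mono_f := ?_, epi_g := ?_ }
  · rw [← ShortComplex.exact_map_iff_of_faithful _ (forget₂ (Rep k G) (ModuleCat k)),
      ShortComplex.moduleCat_exact_iff]
    intro x hx
    exact (h.exact x).1 hx
  · exact (Rep.mono_iff_injective f).2 h.inj
  · exact (Rep.epi_iff_surjective g).2 h.surj

/-- The connecting map. -/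
noncomputable def SES.δ {A B C : Rep k G} {f : A ⟶ B} {g : B ⟶ C} (h : SES f g) (q : ℕ) :
    groupHomology C (q + 1) →ₗ[k] groupHomology A q :=
  (groupHomology.δ h.shortExact (q + 1) q rfl).hom

lemma SES.exact₁ {A B C : Rep k G} {f : A ⟶ B} {g : B ⟶ C} (h : SES f g) (q : ℕ) :
    Function.Exact (h.δ q) (hm q f) := 
  (ShortComplex.ShortExact.moduleCat_exact_iff_function_exact _).1
    (groupHomology.mapShortComplex₁_exact h.shortExact (i := q + 1) (j := q) rfl)

lemma SES.exact₂ {A B C : Rep k G} {f : A ⟶ B} {g : B ⟶ C} (h : SES f g) (q : ℕ) :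
    Function.Exact (hm q f) (hm q g) := 
  (ShortComplex.ShortExact.moduleCat_exact_iff_function_exact _).1
    (groupHomology.mapShortComplex₂_exact h.shortExact q)

lemma SES.exact₃ {A B C : Rep k G} {f : A ⟶ B} {g : B ⟶ C} (h : SES f g) (q : ℕ) :
    Function.Exact (hm (q + 1) g) (h.δ q) := 
  (ShortComplex.ShortExact.moduleCat_exact_iff_function_exact _).1
    (groupHomology.mapShortComplex₃_exact h.shortExact (i := q + 1) (j := q) rfl)

lemma SES.δ_natural {A B C A' B' C' : Rep k G} {f : A ⟶ B} {g : B ⟶ C} (h : SES f g)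
    {f' : A' ⟶ B'} {g' : B' ⟶ C'} (h' : SES f' g') (a : A ⟶ A') (b : B ⟶ B') (c : C ⟶ C')
    (hab : f ≫ b = a ≫ f') (hbc : g ≫ c = b ≫ g') (q : ℕ) :
    hm q a ∘ₗ h.δ q = h'.δ q ∘ₗ hm (q + 1) c := by
  let F : ShortComplex.mk f g h.comp_eq ⟶ ShortComplex.mk f' g' h'.comp_eq :=
    { τ₁ := a, τ₂ := b, τ₃ := c, comm₁₂ := hab.symm, comm₂₃ := hbc.symm }
  have := HomologicalComplex.HomologySequence.δ_naturality
    ((groupHomology.chainsFunctor k G).mapShortComplex.map F)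
    (groupHomology.map_chainsFunctor_shortExact h.shortExact)
    (groupHomology.map_chainsFunctor_shortExact h'.shortExact) (q + 1) q rfl
  exact congrArg ModuleCat.Hom.hom this

lemma SES.surj₀ {A B C : Rep k G} {f : A ⟶ B} {g : B ⟶ C} (h : SES f g) :
    Function.Surjective (hm 0 g) := by
  have : Epi g := (Rep.epi_iff_surjective g).2 h.surj
  exact (ModuleCat.epi_iff_surjective _).1 (groupHomology.epi_map_0_of_epi g)

end Homology
end O13

namespace O13
open CategoryTheory

section Perm
variable (k : Type) {G : Type} [CommRing k] [Group G]

/-- The permutation representation on finitely supported functions. -/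
noncomputable def permRep (G : Type) [Group G] (X : Type) [MulAction G X] :
    Representation k G (X →₀ k) where
  toFun g := Finsupp.lmapDomain k k (g • ·)
  map_one' := by ext; simp
  map_mul' a b := by ext; simp [mul_smul]

/-- The permutation representation as an object of `Rep`. -/
noncomputable abbrev perm (G : Type) [Group G] (X : Type) [MulAction G X] : Rep.{0} k G :=
  Rep.of (permRep k G X)

variable {X Y : Type} [MulAction G X] [MulAction G Y]

/-- The basis vector of a permutation representation. -/
noncomputable def pt (G : Type) [Group G] {X : Type} [MulAction G X] (x : X) : X →₀ k :=
  Finsupp.single x (1 : k)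

lemma perm_ρ_apply (g : G) (x : X →₀ k) :
    (perm k G X).ρ g x = Finsupp.mapDomain (g • ·) x := rfl

lemma perm_ρ_pt (g : G) (x : X) : (perm k G X).ρ g (pt k G x) = pt k G (g • x) := by
  rw [pt, perm_ρ_apply, Finsupp.mapDomain_single, pt]

variable {k}

/-- A morphism of representations from an equivariant linear map. -/
def mkHom {A B : Rep.{0} k G} (f : A →ₗ[k] B) (hf : ∀ g a, f (A.ρ g a) = B.ρ g (f a)) : A ⟶ B :=
  Rep.ofHom ⟨f, fun g => LinearMap.ext (hf g)⟩

@[simp]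
lemma mkHom_apply {A B : Rep.{0} k G} (f : A →ₗ[k] B) (hf : ∀ g a, f (A.ρ g a) = B.ρ g (f a)) (a : A) :
    (mkHom f hf).hom a = f a := rfl

lemma perm_lhom_ext {B : Type} [AddCommGroup B] [Module k B] {f g : perm k G X →ₗ[k] B}
    (h : ∀ x, f (pt k G x) = g (pt k G x)) : f = g :=
  Finsupp.lhom_ext' fun x => LinearMap.ext_ring (h x)

lemma perm_hom_ext {B : Rep.{0} k G} {f g : perm k G X ⟶ B}
    (h : ∀ x, f.hom (pt k G x) = g.hom (pt k G x)) : f = g := by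
  apply Rep.hom_ext
  apply Representation.IntertwiningMap.toLinearMap_injective
  exact perm_lhom_ext h

/-- The morphism out of a permutation representation with prescribed values on the basis. -/
noncomputable def permLift {B : Rep.{0} k G} (φ : X → B) (hφ : ∀ (g : G) x, φ (g • x) = B.ρ g (φ x)) :
    perm k G X ⟶ B :=
  mkHom (A := perm k G X) (Finsupp.linearCombination k φ) fun g a => by
    refine LinearMap.congr_fun (f := Finsupp.linearCombination k φ ∘ₗ (perm k G X).ρ g)
      (g := B.ρ g ∘ₗ Finsupp.linearCombination k φ) (perm_lhom_ext fun x => ?_) a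
    rw [LinearMap.comp_apply, perm_ρ_pt]
    simp [pt, hφ]

lemma permLift_apply {B : Rep.{0} k G} (φ : X → B) (hφ : ∀ (g : G) x, φ (g • x) = B.ρ g (φ x))
    (x : X →₀ k) : (permLift φ hφ).hom x = Finsupp.linearCombination k φ x := rfl

@[simp]
lemma permLift_pt {B : Rep.{0} k G} (φ : X → B) (hφ : ∀ (g : G) x, φ (g • x) = B.ρ g (φ x)) (x : X) :
    (permLift φ hφ).hom (pt k G x) = φ x := by
  rw [pt, permLift_apply]; simp

/-- The morphism of permutation representations induced by an equivariant map. -/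
noncomputable def permMap (φ : X → Y) (hφ : ∀ (g : G) x, φ (g • x) = g • φ x) :
    perm k G X ⟶ perm k G Y :=
  permLift (fun x => pt k G (φ x)) fun g x => by rw [hφ, perm_ρ_pt]

@[simp]
lemma permMap_pt (φ : X → Y) (hφ : ∀ (g : G) x, φ (g • x) = g • φ x) (x : X) :
    (permMap (k := k) φ hφ).hom (pt k G x) = pt k G (φ x) := permLift_pt _ _ _

lemma permMap_apply (φ : X → Y) (hφ : ∀ (g : G) x, φ (g • x) = g • φ x) (x : X →₀ k) :
    (permMap (k := k) φ hφ).hom x = Finsupp.mapDomain φ x :=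
  LinearMap.congr_fun (f := Finsupp.linearCombination k fun x => pt k G (φ x))
    (g := Finsupp.lmapDomain k k φ) (Finsupp.lhom_ext' fun x => LinearMap.ext_ring (by simp [pt])) x

/-! ### Kernels -/

/-- The kernel of a morphism, as a representation. -/
noncomputable abbrev kerRep {A B : Rep.{0} k G} (f : A ⟶ B) : Rep.{0} k G :=
  Rep.subrepresentation A (LinearMap.ker f.hom.toLinearMap) fun g x hx => by
    have h := Rep.hom_comm_apply f g x
    have hx' : f.hom x = 0 := hx
    rw [hx', map_zero] at h
    exact h

/-- The inclusion of the kernel. -/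
noncomputable def kerIncl {A B : Rep.{0} k G} (f : A ⟶ B) : kerRep f ⟶ A := Rep.subtype A _ _

/-- The factorization of a morphism through a kernel. -/
noncomputable def kerLift {A B C : Rep.{0} k G} (f : A ⟶ B) (g : C ⟶ A) (h : g ≫ f = 0) :
    C ⟶ kerRep f :=
  mkHom (A := C) (B := kerRep f)
    (LinearMap.codRestrict (LinearMap.ker f.hom.toLinearMap) g.hom.toLinearMap fun c =>
      LinearMap.congr_fun (congrArg (fun u : C ⟶ B => u.hom.toLinearMap) h) c) fun a c => Subtype.ext (Rep.hom_comm_apply g a c)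

lemma kerLift_incl {A B C : Rep.{0} k G} (f : A ⟶ B) (g : C ⟶ A) (h : g ≫ f = 0) :
    kerLift f g h ≫ kerIncl f = g := rfl

lemma kerIncl_comp {A B : Rep.{0} k G} (f : A ⟶ B) : kerIncl f ≫ f = 0 := by
  apply Rep.hom_ext
  apply Representation.IntertwiningMap.toLinearMap_injective
  exact LinearMap.ext fun x => x.2

lemma ses_kerIncl {A B : Rep.{0} k G} (f : A ⟶ B) (hf : Function.Surjective f.hom) :
    SES (kerIncl f) f where
  inj := Subtype.val_injective
  surj := hf
  exact x := ⟨fun h => ⟨⟨x, h⟩, rfl⟩, by rintro ⟨y, rfl⟩; exact y.2⟩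

/-! ### Degree zero -/

/-- The class of a vector in degree zero homology. -/
noncomputable def cls (A : Rep.{0} k G) : A →ₗ[k] groupHomology A 0 := (groupHomology.H0π A).hom

lemma cls_surjective (A : Rep.{0} k G) : Function.Surjective (cls A) :=
  (ModuleCat.epi_iff_surjective _).1 (inferInstance : Epi (groupHomology.H0π A))

lemma hm_cls {A B : Rep.{0} k G} (f : A ⟶ B) (a : A) : hm 0 f (cls A a) = cls B (f.hom a) := by
  have := groupHomology.H0π_comp_map (MonoidHom.id G) f
  exact LinearMap.congr_fun (congrArg ModuleCat.Hom.hom this) a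

lemma H0Iso_cls (A : Rep.{0} k G) (a : A) :
    (groupHomology.H0Iso A).hom.hom (cls A a) = Representation.Coinvariants.mk A.ρ a :=
  LinearMap.congr_fun (congrArg ModuleCat.Hom.hom (groupHomology.H0π_comp_H0Iso_hom A)) a

lemma cls_ρ (A : Rep.{0} k G) (g : G) (a : A) : cls A (A.ρ g a) = cls A a := by
  apply (ModuleCat.mono_iff_injective (groupHomology.H0Iso A).hom).1 inferInstance
  change (groupHomology.H0Iso A).hom.hom _ = (groupHomology.H0Iso A).hom.hom _
  rw [H0Iso_cls, H0Iso_cls, Representation.Coinvariants.mk_self_apply]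

lemma cls_smul (g : G) (x : X) : cls (perm k G X) (pt k G (g • x)) = cls _ (pt k G x) := by
  rw [← perm_ρ_pt, cls_ρ]

/-- An invariant functional factors through degree zero homology. -/
lemma exists_lift_zero (A : Rep.{0} k G) {W : Type} [AddCommGroup W] [Module k W] (f : A →ₗ[k] W)
    (hf : ∀ g a, f (A.ρ g a) = f a) :
    ∃ F : groupHomology A 0 →ₗ[k] W, ∀ a, F (cls A a) = f a := by
  refine ⟨Representation.Coinvariants.lift A.ρ f (fun g => LinearMap.ext (hf g)) ∘ₗ
    (groupHomology.H0Iso A).hom.hom, fun a => ?_⟩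
  rw [LinearMap.comp_apply, H0Iso_cls, Representation.Coinvariants.lift_mk]

/-- Degree zero homology of a permutation module has a basis indexed by the orbits. -/
theorem exists_basis_zero {L : Type} (l : X → L) (hl : Function.Surjective l)
    (h : ∀ x y, l x = l y ↔ ∃ g : G, g • x = y) :
    ∃ e : groupHomology (perm k G X) 0 ≃ₗ[k] (L →₀ k),
      ∀ x, e (cls _ (pt k G x)) = Finsupp.single (l x) 1 := by
  obtain ⟨F, hF⟩ := exists_lift_zero (perm k G X) (Finsupp.lmapDomain k k l) (fun g a => by
    refine LinearMap.congr_fun (f := Finsupp.lmapDomain k k l ∘ₗ (perm k G X).ρ g)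
      (perm_lhom_ext fun x => ?_) a
    rw [LinearMap.comp_apply, perm_ρ_pt]
    simp only [pt, Finsupp.lmapDomain_apply, Finsupp.mapDomain_single]
    rw [(h x (g • x)).2 ⟨g, rfl⟩])
  have hFx : ∀ x, F (cls _ (pt k G x)) = Finsupp.single (l x) 1 := fun x => by
    rw [hF, pt]; simp
  let s := Function.surjInv hl
  let I : (L →₀ k) →ₗ[k] groupHomology (perm k G X) 0 :=
    Finsupp.linearCombination k fun c => cls _ (pt k G (s c))
  have h1 : F ∘ₗ I = LinearMap.id := by
    refine Finsupp.lhom_ext' fun c => LinearMap.ext_ring ?_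
    simp [I, hFx, s, Function.surjInv_eq hl]
  have h2 : I ∘ₗ F = LinearMap.id := by
    refine LinearMap.ext fun y => ?_
    obtain ⟨a, rfl⟩ := cls_surjective _ y
    refine LinearMap.congr_fun (f := (I ∘ₗ F) ∘ₗ cls _) (g := cls _) (perm_lhom_ext fun x => ?_) a
    simp only [LinearMap.comp_apply, hFx]
    obtain ⟨g, hg⟩ := (h (s (l x)) x).1 (Function.surjInv_eq hl _)
    simp only [I, Finsupp.linearCombination_single, one_smul]
    conv_rhs => rw [← hg, cls_smul]
  exact ⟨LinearEquiv.ofLinearMap F I h1 h2, hFx⟩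

/-! ### Acyclicity -/

open groupHomology Finsupp

/-- The contracting homotopy on chains with values in a free permutation module. -/
noncomputable def homot (u : X → G) (n : ℕ) :
    ((Fin n → G) →₀ (X →₀ k)) →ₗ[k] ((Fin (n + 1) → G) →₀ (X →₀ k)) :=
  lsum (R := k) k fun g => Finsupp.linearCombination k fun x =>
    single (Fin.cons (u x)⁻¹ g : Fin (n + 1) → G) (pt k G ((u x)⁻¹ • x))

lemma homot_single (u : X → G) (n : ℕ) (g : Fin n → G) (x : X) :
    homot (k := k) u n (single g (pt k G x)) =
      single (Fin.cons (u x)⁻¹ g) (pt k G ((u x)⁻¹ • x)) := by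
  simp [homot, pt]

lemma contractNth_cons_zero {n : ℕ} (w : G) (g : Fin (n + 1) → G) :
    Fin.contractNth 0 (· * ·) (Fin.cons w g : Fin (n + 2) → G) =
      Fin.cons (w * g 0) (fun i => g i.succ) := by
  funext i
  refine Fin.cases ?_ (fun i => ?_) i
  · simp [Fin.contractNth]
  · simp [Fin.contractNth]

lemma contractNth_cons_succ {n : ℕ} (w : G) (g : Fin (n + 1) → G) (j : Fin (n + 1)) :
    Fin.contractNth j.succ (· * ·) (Fin.cons w g : Fin (n + 2) → G) =
      Fin.cons w (Fin.contractNth j (· * ·) g) := by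
  funext i
  refine Fin.cases ?_ (fun i => ?_) i
  · simp [Fin.contractNth]
  · simp [Fin.contractNth]

/-- The differential on chains with values in a permutation module. -/
noncomputable def permD (k G : Type) [CommRing k] [Group G] (X : Type) [MulAction G X] (n : ℕ) :
    ((Fin (n + 1) → G) →₀ (X →₀ k)) →ₗ[k] ((Fin n → G) →₀ (X →₀ k)) :=
  (inhomogeneousChains.d (perm k G X) n).hom

lemma permD_single (n : ℕ) (g : Fin (n + 1) → G) (x : X) :
    permD k G X n (single g (pt k G x)) = single (fun i => g i.succ) (pt k G ((g 0)⁻¹ • x)) +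
      ∑ j : Fin (n + 1), (-1 : k) ^ ((j : ℕ) + 1) •
        single (Fin.contractNth j (· * ·) g) (pt k G x) := by
  rw [← perm_ρ_pt]
  exact inhomogeneousChains.d_single (A := perm k G X) n g (pt k G x)

lemma alternating_cancel {M : Type*} [AddCommGroup M] [Module k M] {n : ℕ} (a b : M)
    (c : Fin n → M) :
    a + ((-1 : k) ^ (0 + 1) • b + ∑ j : Fin n, (-1 : k) ^ ((j : ℕ) + 1 + 1) • c j) +
      (b + ∑ j : Fin n, (-1 : k) ^ ((j : ℕ) + 1) • c j) = a := by
  simp only [pow_succ, mul_neg_one, neg_smul, neg_neg, Finset.sum_neg_distrib, pow_zero, one_smul]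
  abel

lemma homot_spec (u : X → G) (hu : ∀ (g : G) x, u (g • x) = g * u x) (n : ℕ)
    (z : (Fin (n + 1) → G) →₀ (X →₀ k)) :
    permD k G X (n + 1) (homot u (n + 1) z) + homot u n (permD k G X n z) = z := by
  suffices h : permD k G X (n + 1) ∘ₗ homot u (n + 1) + homot u n ∘ₗ permD k G X n =
      LinearMap.id from LinearMap.congr_fun h z
  refine Finsupp.lhom_ext' fun g => Finsupp.lhom_ext' fun x => LinearMap.ext_ring ?_
  change permD k G X (n + 1) (homot u (n + 1) (single g (pt k G x))) +
    homot u n (permD k G X n (single g (pt k G x))) = single g (pt k G x)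
  rw [homot_single, permD_single, permD_single, Fin.sum_univ_succ]
  simp only [Fin.cons_zero, Fin.cons_succ, inv_inv, smul_inv_smul, map_add, map_sum,
    map_smul, homot_single, contractNth_cons_zero, contractNth_cons_succ, hu, mul_inv_rev,
    mul_smul, Fin.val_zero, Fin.val_succ]
  exact alternating_cancel (k := k) (M := (Fin (n + 1) → G) →₀ (X →₀ k)) _ _ _

/-- Higher homology of a free permutation module vanishes. -/
theorem subsingleton_of_free (u : X → G) (hu : ∀ (g : G) x, u (g • x) = g * u x) (q : ℕ) :
    Subsingleton (groupHomology (perm k G X) (q + 1)) := by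
  rw [← ModuleCat.isZero_iff_subsingleton]
  change Limits.IsZero ((inhomogeneousChains (perm k G X)).homology (q + 1))
  rw [← HomologicalComplex.exactAt_iff_isZero_homology,
    HomologicalComplex.exactAt_iff' _ (q + 2) (q + 1) q (by simp) (by simp),
    ShortComplex.moduleCat_exact_iff]
  intro z hz
  refine ⟨homot u (q + 1) z, ?_⟩
  have h := homot_spec u hu q z
  have h1 := inhomogeneousChains.d_def (perm k G X) q
  have h2 := inhomogeneousChains.d_def (perm k G X) (q + 1)
  change ((inhomogeneousChains (perm k G X)).d (q + 1) q).hom z = 0 at hz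
  change ((inhomogeneousChains (perm k G X)).d (q + 1 + 1) (q + 1)).hom _ = z
  rw [h1] at hz
  rw [h2]
  change permD k G X q z = 0 at hz
  rw [hz, map_zero, add_zero] at h
  exact h

lemma exists_coordinate (hfree : ∀ (g : G) (x : X), g • x = x → g = 1) :
    ∃ u : X → G, ∀ (g : G) x, u (g • x) = g * u x := by
  have h : ∀ x : X, ∃ g : G, g • (Quotient.out (s := MulAction.orbitRel G X) ⟦x⟧) = x := fun x => by
    have := Quotient.mk_out (s := MulAction.orbitRel G X) x
    obtain ⟨g, hg⟩ := (MulAction.orbitRel G X).symm this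
    exact ⟨g, hg⟩
  choose u hu using h
  refine ⟨u, fun g x => ?_⟩
  have h1 : (⟦g • x⟧ : Quotient (MulAction.orbitRel G X)) = ⟦x⟧ := Quotient.sound ⟨g, rfl⟩
  have h2 := hu (g • x)
  rw [h1] at h2
  have h3 := hfree ((g * u x)⁻¹ * u (g • x)) _ (by rw [mul_smul, h2, inv_smul_eq_iff, mul_smul, hu])
  exact (inv_mul_eq_one.1 h3).symm

/-- A morphism that factors through a free permutation module vanishes on higher homology. -/
theorem hm_eq_zero_of_factor {A B : Rep.{0} k G} (hfree : ∀ (g : G) (x : X), g • x = x → g = 1)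
    (f : A ⟶ perm k G X) (h : perm k G X ⟶ B) {q : ℕ} (hq : 0 < q) : hm q (f ≫ h) = 0 := by
  obtain ⟨u, hu⟩ := exists_coordinate hfree
  obtain ⟨q, rfl⟩ := Nat.exists_eq_succ_of_ne_zero hq.ne'
  have := subsingleton_of_free (k := k) u hu q
  rw [hm_comp]
  ext x
  simp [Subsingleton.elim (hm _ f x) 0]

end Perm
end O13

namespace O13
open CategoryTheory

section Periodic
variable {k G : Type} [CommRing k] [Group G]

lemma SES.δ_bijective {A B C : Rep.{0} k G} {f : A ⟶ B} {g : B ⟶ C} (h : SES f g) (q : ℕ)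
    (h1 : Subsingleton (groupHomology B (q + 1))) (h0 : hm q f = 0) :
    Function.Bijective (h.δ q) := by
  constructor
  · rw [injective_iff_map_eq_zero]
    intro x hx
    obtain ⟨y, rfl⟩ := (h.exact₃ q x).1 hx
    rw [Subsingleton.elim y 0, map_zero]
  · intro y
    exact (h.exact₁ q y).1 (by rw [h0]; rfl)

/-- A periodic resolution of `M` by an acyclic module, as for a cyclic stabilizer of order `3`. -/
structure Periodic {M P I : Rep.{0} k G} (N : M ⟶ P) (r : P ⟶ I) (j : I ⟶ P) (p : P ⟶ M)
    (ρ : P ⟶ P) : Prop where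
  left : SES N r
  right : SES j p
  comp_rj : r ≫ j = 𝟙 P - ρ
  comp_pN : p ≫ N = 𝟙 P + ρ + ρ ≫ ρ
  comp_Nρ : N ≫ ρ = N
  cube : ρ ≫ ρ ≫ ρ = 𝟙 P
  acyclic : ∀ q, Subsingleton (groupHomology P (q + 1))
  hm_ρ : hm 0 ρ = LinearMap.id

/-- An endomorphism of `M` that lifts to one inverting the generator of the stabilizers. -/
structure Reverses {M P I : Rep.{0} k G} (N : M ⟶ P) (j : I ⟶ P) (p : P ⟶ M)
    (ρ : P ⟶ P) (θ : M ⟶ M) (φ : P ⟶ P) (ψ : I ⟶ I) : Prop where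
  comp_p : φ ≫ p = p ≫ θ
  comp_ρ : ρ ≫ φ = φ ≫ ρ ≫ ρ
  comp_j : ψ ≫ j = j ≫ φ
  comp_N : N ≫ φ = θ ≫ N

variable {M P I : Rep.{0} k G} {N : M ⟶ P} {r : P ⟶ I} {j : I ⟶ P} {p : P ⟶ M} {ρ : P ⟶ P}

lemma Periodic.hm_j (h : Periodic N r j p ρ) : hm 0 j = 0 := by
  have h1 : hm 0 j ∘ₗ hm 0 r = 0 := by
    rw [← hm_comp, h.comp_rj, hm_sub, hm_id, h.hm_ρ, sub_self]
  ext x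
  obtain ⟨y, rfl⟩ := h.left.surj₀ x
  exact LinearMap.congr_fun h1 y

lemma Periodic.hm_N (h : Periodic N r j p ρ) (h3 : (3 : k) = 0) : hm 0 N = 0 := by
  have h1 : hm 0 N ∘ₗ hm 0 p = 0 := by
    rw [← hm_comp, h.comp_pN, hm_add, hm_add, hm_comp, hm_id, h.hm_ρ, LinearMap.comp_id]
    ext x
    have : x + x + x = (3 : k) • x := by
      rw [show (3 : k) = 1 + 1 + 1 by norm_num, add_smul, add_smul, one_smul]
    simp [this, h3]
  ext x
  obtain ⟨y, rfl⟩ := h.right.surj₀ x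
  exact LinearMap.congr_fun h1 y

lemma Periodic.eq_of_comp_j (h : Periodic N r j p ρ) {A : Rep.{0} k G} {f g : A ⟶ I}
    (hfg : f ≫ j = g ≫ j) : f = g := by
  have := (Rep.mono_iff_injective j).2 h.right.inj
  exact (cancel_mono j).1 hfg

lemma Reverses.comp_r (h : Periodic N r j p ρ) {θ : M ⟶ M} {φ : P ⟶ P} {ψ : I ⟶ I}
    (hr : Reverses N j p ρ θ φ ψ) : r ≫ ψ = (-(φ ≫ ρ ≫ ρ)) ≫ r := by
  apply h.eq_of_comp_j
  rw [Category.assoc, hr.comp_j, ← Category.assoc, h.comp_rj, Category.assoc, h.comp_rj]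
  simp only [Preadditive.sub_comp, Preadditive.comp_sub, Preadditive.neg_comp, Category.id_comp,
    Category.comp_id, hr.comp_ρ, Category.assoc, h.cube]
  abel

lemma Reverses.neg_comp_N (h : Periodic N r j p ρ) {θ : M ⟶ M} {φ : P ⟶ P} {ψ : I ⟶ I}
    (hr : Reverses N j p ρ θ φ ψ) : N ≫ (-(φ ≫ ρ ≫ ρ)) = (-θ) ≫ N := by
  have h1 : N ≫ φ ≫ ρ ≫ ρ = θ ≫ N := by
    rw [← Category.assoc, hr.comp_N, Category.assoc, ← Category.assoc N, h.comp_Nρ, h.comp_Nρ]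
  rw [Preadditive.comp_neg, Preadditive.neg_comp, h1]

/-- The sign in degree `q`. -/
def periodSign (q : ℕ) : ℤ := if q % 4 = 0 ∨ q % 4 = 3 then 1 else -1

theorem Periodic.exists_equiv (h : Periodic N r j p ρ) (h3 : (3 : k) = 0) : ∀ q : ℕ,
    ∃ e : groupHomology M q ≃ₗ[k] groupHomology M 0, ∀ (θ : M ⟶ M) (φ : P ⟶ P) (ψ : I ⟶ I),
      Reverses N j p ρ θ φ ψ → ∀ x, e (hm q θ x) = periodSign q • hm 0 θ (e x)
  | 0 => ⟨LinearEquiv.refl _ _, fun θ _ _ _ x => by simp [periodSign]⟩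
  | 1 => by
    let e₁ := LinearEquiv.ofBijective _ (h.right.δ_bijective 0 (h.acyclic 0) h.hm_j)
    let e₂ : groupHomology P 0 ≃ₗ[k] groupHomology I 0 := LinearEquiv.ofBijective (hm 0 r) (by
      refine ⟨?_, h.left.surj₀⟩
      rw [injective_iff_map_eq_zero]
      intro x hx
      obtain ⟨y, rfl⟩ := (h.left.exact₂ 0 x).1 hx
      rw [h.hm_N h3]; rfl)
    let e₃ : groupHomology P 0 ≃ₗ[k] groupHomology M 0 := LinearEquiv.ofBijective (hm 0 p) (by
      refine ⟨?_, h.right.surj₀⟩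
      rw [injective_iff_map_eq_zero]
      intro x hx
      obtain ⟨y, rfl⟩ := (h.right.exact₂ 0 x).1 hx
      rw [h.hm_j]; rfl)
    refine ⟨(e₁.trans e₂.symm).trans e₃, fun θ φ ψ hr x => ?_⟩
    have h1 : e₁ (hm 1 θ x) = hm 0 ψ (e₁ x) :=
      (LinearMap.congr_fun (h.right.δ_natural h.right ψ φ θ hr.comp_j.symm hr.comp_p.symm 0) x).symm
    have h2 : ∀ y, e₂.symm (hm 0 ψ y) = -hm 0 φ (e₂.symm y) := fun y => by
      rw [LinearEquiv.symm_apply_eq]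
      obtain ⟨z, rfl⟩ := e₂.surjective y
      rw [LinearEquiv.symm_apply_apply]
      change hm 0 ψ (hm 0 r z) = hm 0 r (-hm 0 φ z)
      rw [← LinearMap.comp_apply, ← hm_comp, hr.comp_r h, hm_comp, hm_neg, hm_comp, hm_comp,
        h.hm_ρ]
      rfl
    have h4 : ∀ y, e₃ (hm 0 φ y) = hm 0 θ (e₃ y) := fun y => by
      change hm 0 p (hm 0 φ y) = hm 0 θ (hm 0 p y)
      rw [← LinearMap.comp_apply, ← LinearMap.comp_apply, ← hm_comp, ← hm_comp, hr.comp_p]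
    simp only [LinearEquiv.trans_apply, h1, h2, map_neg, h4, periodSign]
    norm_num
  | q + 2 => by
    obtain ⟨e, he⟩ := h.exists_equiv h3 q
    have hj : hm (q + 1) j = 0 := by
      have := h.acyclic q
      exact LinearMap.ext fun x => Subsingleton.elim _ _
    have hN : hm q N = 0 := by
      cases q with
      | zero => exact h.hm_N h3
      | succ q =>
        have := h.acyclic q
        exact LinearMap.ext fun x => Subsingleton.elim _ _
    let e₁ := LinearEquiv.ofBijective _ (h.right.δ_bijective (q + 1) (h.acyclic (q + 1)) hj)
    let e₂ := LinearEquiv.ofBijective _ (h.left.δ_bijective q (h.acyclic q) hN)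
    refine ⟨(e₁.trans e₂).trans e, fun θ φ ψ hr x => ?_⟩
    have h1 : e₁ (hm (q + 2) θ x) = hm (q + 1) ψ (e₁ x) :=
      (LinearMap.congr_fun
        (h.right.δ_natural h.right ψ φ θ hr.comp_j.symm hr.comp_p.symm (q + 1)) x).symm
    have h2 : ∀ y, e₂ (hm (q + 1) ψ y) = hm q (-θ) (e₂ y) := fun y =>
      (LinearMap.congr_fun
        (h.left.δ_natural h.left (-θ) (-(φ ≫ ρ ≫ ρ)) ψ (hr.neg_comp_N h) (hr.comp_r h) q) y).symm
    have h4 : periodSign (q + 2) = -periodSign q := by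
      unfold periodSign
      split_ifs <;> first | rfl | omega
    simp only [LinearEquiv.trans_apply, h1, h2, hm_neg, LinearMap.neg_apply, map_neg,
      he θ φ ψ hr, h4, neg_smul]

end Periodic
end O13

namespace O13
open CategoryTheory

section Fibre
variable {k G : Type} [CommRing k] [Group G] {X V : Type} [MulAction G X] [MulAction G V]

/-- An equivariant three-to-one map whose fibres are the orbits of a commuting action of `ℤ/3`. -/
structure Triple (G : Type) {X V : Type} [Group G] [MulAction G X] [MulAction G V] (p : V → X)
    (ρ : V → V) : Prop where
  smul_p : ∀ (g : G) v, p (g • v) = g • p v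
  smul_ρ : ∀ (g : G) v, ρ (g • v) = g • ρ v
  surj : Function.Surjective p
  p_ρ : ∀ v, p (ρ v) = p v
  cube : ∀ v, ρ (ρ (ρ v)) = v
  ne : ∀ v, ρ v ≠ v
  fibre : ∀ v w, p v = p w → w = v ∨ w = ρ v ∨ w = ρ (ρ v)
  free : ∀ (g : G) (v : V), g • v = v → g = 1
  orbit : ∀ v, ∃ g : G, g • v = ρ v

variable {p : V → X} {ρ : V → V} (h : Triple G p ρ)
include h

lemma Triple.ρ_injective : Function.Injective ρ := fun v w hvw => by
  rw [← h.cube v, hvw, h.cube]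

lemma Triple.ne' (v : V) : ρ (ρ v) ≠ v := fun e => h.ne v (by conv_rhs => rw [← h.cube v, e])

lemma Triple.smul_ρρ (g : G) (v : V) : ρ (ρ (g • v)) = g • ρ (ρ v) := by rw [h.smul_ρ, h.smul_ρ]

/-- The sum over the fibre through a point. -/
noncomputable def fibreSum (k : Type) [CommRing k] (ρ : V → V) (v : V) : V →₀ k :=
  Finsupp.single v 1 + Finsupp.single (ρ v) 1 + Finsupp.single (ρ (ρ v)) 1

lemma Triple.fibreSum_eq (k : Type) [CommRing k] {v w : V} (hvw : p v = p w) :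
    fibreSum k ρ v = fibreSum k ρ w := by
  rcases h.fibre v w hvw with rfl | rfl | rfl <;> simp only [fibreSum, h.cube] <;> abel

/-- A set-theoretic section of the fibration. -/
noncomputable def Triple.sec (x : X) : V := Function.surjInv h.surj x

lemma Triple.p_sec (x : X) : p (h.sec x) = x := Function.surjInv_eq h.surj x

/-- The rotation of the fibres. -/
noncomputable def Triple.rot (k : Type) [CommRing k] : perm k G V ⟶ perm k G V :=
  permMap ρ h.smul_ρ

/-- The projection. -/
noncomputable def Triple.proj (k : Type) [CommRing k] : perm k G V ⟶ perm k G X :=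
  permMap p h.smul_p

/-- The transfer. -/
noncomputable def Triple.transfer (k : Type) [CommRing k] : perm k G X ⟶ perm k G V :=
  permLift (B := perm k G V) (fun x => fibreSum k ρ (h.sec x)) fun g x => by
    rw [h.fibreSum_eq k (v := h.sec (g • x)) (w := g • h.sec x)
      (by rw [h.p_sec, h.smul_p, h.p_sec])]
    simp only [fibreSum, map_add]
    change _ = (perm k G V).ρ g (pt k G _) + (perm k G V).ρ g (pt k G _) +
      (perm k G V).ρ g (pt k G _)
    rw [perm_ρ_pt, perm_ρ_pt, perm_ρ_pt, h.smul_ρρ, h.smul_ρ]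
    rfl

lemma Triple.transfer_pt (v : V) : (h.transfer k).hom (pt k G (p v)) = fibreSum k ρ v := by
  rw [Triple.transfer, permLift_pt]
  exact h.fibreSum_eq k (by rw [h.p_sec])

lemma Triple.proj_apply (x : V →₀ k) : (h.proj k).hom x = Finsupp.mapDomain p x :=
  permMap_apply _ _ _

lemma Triple.rot_apply (x : V →₀ k) : (h.rot k).hom x = Finsupp.mapDomain ρ x :=
  permMap_apply _ _ _

open Classical in
lemma Triple.mapDomain_sec_apply (z : X →₀ k) (w : V) :
    Finsupp.mapDomain h.sec z w = if h.sec (p w) = w then z (p w) else 0 := by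
  have hinj : Function.Injective h.sec := fun x y hxy => by rw [← h.p_sec x, hxy, h.p_sec]
  split_ifs with hw
  · conv_lhs => rw [← hw]
    exact Finsupp.mapDomain_apply hinj _ _
  · refine Finsupp.mapDomain_of_notMem_range _ _ ?_
    rintro ⟨x, rfl⟩
    exact hw (by rw [h.p_sec])

lemma Triple.mapDomain_ρ_apply (y : V →₀ k) (v : V) :
    Finsupp.mapDomain ρ y v = y (ρ (ρ v)) := by
  conv_lhs => rw [← h.cube v]
  exact Finsupp.mapDomain_apply h.ρ_injective _ _

lemma Triple.transfer_apply (z : X →₀ k) : (h.transfer k).hom z =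
    Finsupp.mapDomain h.sec z + Finsupp.mapDomain ρ (Finsupp.mapDomain h.sec z) +
      Finsupp.mapDomain ρ (Finsupp.mapDomain ρ (Finsupp.mapDomain h.sec z)) := by
  let s := Finsupp.lmapDomain k k h.sec
  let t := Finsupp.lmapDomain k k ρ
  refine LinearMap.congr_fun (f := Finsupp.linearCombination k fun x => fibreSum k ρ (h.sec x))
    (g := s + t ∘ₗ s + t ∘ₗ t ∘ₗ s) (Finsupp.lhom_ext' fun x => LinearMap.ext_ring ?_) z
  simp [s, t, fibreSum]

lemma Triple.transfer_apply_apply (z : X →₀ k) (v : V) :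
    ((h.transfer k).hom z : V →₀ k) v = z (p v) := by
  classical
  rw [h.transfer_apply]
  simp only [Finsupp.add_apply, h.mapDomain_ρ_apply, h.mapDomain_sec_apply, h.p_ρ, h.cube]
  have hs := h.fibre v (h.sec (p v)) (by rw [h.p_sec])
  have h1 := h.ne v
  have h2 := h.ne' v
  have h3 : ρ v ≠ ρ (ρ v) := fun e => h1 (h.ρ_injective e).symm
  rcases hs with hs | hs | hs <;> rw [hs] <;> simp [h1, h1.symm, h2, h2.symm, h3, h3.symm]

/-- The difference `1 - ρ`, as a map to the kernel of the projection. -/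
noncomputable def Triple.diff (k : Type) [CommRing k] : perm k G V ⟶ kerRep (h.proj k) :=
  kerLift (h.proj k) (𝟙 _ - h.rot k) (perm_hom_ext fun v => by
    change (h.proj k).hom (pt k G v - (h.rot k).hom (pt k G v)) = 0
    rw [map_sub, Triple.proj, Triple.rot, permMap_pt, permMap_pt, permMap_pt, h.p_ρ, sub_self])

lemma Triple.diff_incl : h.diff k ≫ kerIncl (h.proj k) = 𝟙 _ - h.rot k := kerLift_incl _ _ _

lemma Triple.proj_surjective : Function.Surjective (h.proj k).hom := fun x =>
  ⟨Finsupp.mapDomain h.sec x, by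
    rw [h.proj_apply, ← Finsupp.mapDomain_comp]
    conv_rhs => rw [← Finsupp.mapDomain_id (v := x)]
    congr 1
    exact funext h.p_sec⟩

lemma Triple.exists_diff (v : V) : ∃ t : V →₀ k,
    t - Finsupp.mapDomain ρ t = Finsupp.single v 1 - Finsupp.single (h.sec (p v)) 1 := by
  rcases h.fibre v (h.sec (p v)) (by rw [h.p_sec]) with e | e | e <;> rw [e]
  · exact ⟨0, by simp⟩
  · exact ⟨Finsupp.single v 1, by rw [Finsupp.mapDomain_single]⟩
  · refine ⟨Finsupp.single v 1 + Finsupp.single (ρ v) 1, ?_⟩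
    rw [Finsupp.mapDomain_add, Finsupp.mapDomain_single, Finsupp.mapDomain_single]
    abel

lemma Triple.diff_surjective : Function.Surjective (h.diff k).hom := by
  rintro ⟨x, hx⟩
  have hx' : Finsupp.mapDomain p x = 0 := (h.proj_apply x).symm.trans hx
  choose t ht using h.exists_diff (k := k)
  have key : ∀ y : V →₀ k, Finsupp.linearCombination k t y -
      Finsupp.mapDomain ρ (Finsupp.linearCombination k t y) =
        y - Finsupp.mapDomain h.sec (Finsupp.mapDomain p y) := fun y => by
    let T := Finsupp.linearCombination k t
    refine LinearMap.congr_fun (f := T - Finsupp.lmapDomain k k ρ ∘ₗ T)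
      (g := LinearMap.id - Finsupp.lmapDomain k k h.sec ∘ₗ Finsupp.lmapDomain k k p)
      (Finsupp.lhom_ext' fun v => LinearMap.ext_ring ?_) y
    simpa [T] using ht v
  refine ⟨Finsupp.linearCombination k t x, Subtype.ext ?_⟩
  have h1 := congrArg (fun f => f.hom (Finsupp.linearCombination k t x)) (h.diff_incl (k := k))
  refine Eq.trans h1 ?_
  change Finsupp.linearCombination k t x - (h.rot k).hom (Finsupp.linearCombination k t x) = x
  rw [h.rot_apply, key, hx', Finsupp.mapDomain_zero, sub_zero]

theorem Triple.periodic : Periodic (h.transfer k) (h.diff k) (kerIncl (h.proj k)) (h.proj k)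
    (h.rot k) where
  left :=
    { inj := fun x y hxy => Finsupp.ext fun c => by
        rw [← h.p_sec c, ← h.transfer_apply_apply, ← h.transfer_apply_apply, hxy]
      surj := h.diff_surjective
      exact := fun y => by
        have h1 : (h.diff k).hom y = 0 ↔ Finsupp.mapDomain ρ y = y := by
          rw [← Subtype.coe_inj]
          have h1 := congrArg (fun f => f.hom y) (h.diff_incl (k := k))
          change (((h.diff k).hom y).1 : V →₀ k) = y - (h.rot k).hom y at h1
          rw [h1, h.rot_apply]
          change y - Finsupp.mapDomain ρ y = 0 ↔ _
          rw [sub_eq_zero, eq_comm]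
        rw [h1]
        constructor
        · intro hy
          have hinj : Function.Injective h.sec := fun a b e => by
            rw [← h.p_sec a, e, h.p_sec]
          refine ⟨Finsupp.comapDomain h.sec y hinj.injOn, Finsupp.ext fun v => ?_⟩
          rw [h.transfer_apply_apply, Finsupp.comapDomain_apply]
          have hρ : ∀ w, y (ρ w) = y w := fun w => by
            conv_lhs => rw [← hy]
            exact Finsupp.mapDomain_apply h.ρ_injective _ _
          rcases h.fibre v (h.sec (p v)) (by rw [h.p_sec]) with e | e | e <;> rw [e] <;>
            simp only [hρ]
        · rintro ⟨z, rfl⟩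
          refine Finsupp.ext fun v => ?_
          rw [h.mapDomain_ρ_apply, h.transfer_apply_apply, h.transfer_apply_apply, h.p_ρ, h.p_ρ] }
  right := ses_kerIncl _ h.proj_surjective
  comp_rj := h.diff_incl
  comp_pN := perm_hom_ext fun v => by
    change (h.transfer k).hom ((h.proj k).hom (pt k G v)) = pt k G v + (h.rot k).hom (pt k G v) +
      (h.rot k).hom ((h.rot k).hom (pt k G v))
    rw [Triple.proj, permMap_pt, h.transfer_pt, Triple.rot, permMap_pt, permMap_pt]
    rfl
  comp_Nρ := perm_hom_ext fun x => Finsupp.ext fun v => by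
    change ((h.rot k).hom ((h.transfer k).hom (pt k G x)) : V →₀ k) v =
      ((h.transfer k).hom (pt k G x) : V →₀ k) v
    rw [h.rot_apply, h.mapDomain_ρ_apply, h.transfer_apply_apply, h.transfer_apply_apply, h.p_ρ,
      h.p_ρ]
  cube := perm_hom_ext fun v => by
    change (h.rot k).hom ((h.rot k).hom ((h.rot k).hom (pt k G v))) = pt k G v
    rw [Triple.rot, permMap_pt, permMap_pt, permMap_pt, h.cube]
  acyclic := fun q => by
    obtain ⟨u, hu⟩ := exists_coordinate h.free
    exact subsingleton_of_free u hu q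
  hm_ρ := by
    refine LinearMap.ext fun y => ?_
    obtain ⟨a, rfl⟩ := cls_surjective _ y
    refine LinearMap.congr_fun (f := hm 0 (h.rot k) ∘ₗ cls _) (g := cls _)
      (perm_lhom_ext fun v => ?_) a
    rw [LinearMap.comp_apply, hm_cls, Triple.rot, permMap_pt]
    obtain ⟨g, hg⟩ := h.orbit v
    rw [← hg, cls_smul]

theorem Triple.reverses {θ : X → X} {φ : V → V} (hθ : ∀ (g : G) x, θ (g • x) = g • θ x)
    (hφ : ∀ (g : G) x, φ (g • x) = g • φ x) (hp : ∀ v, p (φ v) = θ (p v))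
    (hρ : ∀ v, φ (ρ v) = ρ (ρ (φ v))) :
    ∃ ψ, Reverses (h.transfer k) (kerIncl (h.proj k)) (h.proj k) (h.rot k)
      (permMap θ hθ) (permMap φ hφ) ψ := by
  have h1 : permMap φ hφ ≫ h.proj k = h.proj k ≫ permMap θ hθ := perm_hom_ext fun v => by
    change (h.proj k).hom ((permMap φ hφ).hom (pt k G v)) =
      (permMap θ hθ).hom ((h.proj k).hom (pt k G v))
    rw [Triple.proj, permMap_pt, permMap_pt, permMap_pt, permMap_pt, hp]
  refine ⟨kerLift (h.proj k) (kerIncl (h.proj k) ≫ permMap φ hφ) ?_, h1, ?_, kerLift_incl _ _ _, ?_⟩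
  · rw [Category.assoc, h1, ← Category.assoc, kerIncl_comp, Limits.zero_comp]
  · refine perm_hom_ext fun v => ?_
    change (permMap φ hφ).hom ((h.rot k).hom (pt k G v)) =
      (h.rot k).hom ((h.rot k).hom ((permMap φ hφ).hom (pt k G v)))
    rw [Triple.rot, permMap_pt, permMap_pt, permMap_pt, permMap_pt, permMap_pt, hρ]
  · refine perm_hom_ext fun x => ?_
    change (permMap φ hφ).hom ((h.transfer k).hom (pt k G x)) =
      (h.transfer k).hom ((permMap θ hθ).hom (pt k G x))
    obtain ⟨v, rfl⟩ := h.surj x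
    rw [permMap_pt, ← hp, h.transfer_pt, h.transfer_pt, permMap_apply]
    simp only [fibreSum, Finsupp.mapDomain_add, Finsupp.mapDomain_single, hρ, h.cube]
    abel

end Fibre
end O13

namespace O13
open CategoryTheory

section LinearAlgebra
variable {k : Type} [Field k] {A C V U : Type} [AddCommGroup A] [Module k A] [AddCommGroup C]
  [Module k C] [AddCommGroup V] [Module k V] [AddCommGroup U] [Module k U]

lemma finrank_range_swap (ε : ℤ) (hε : ε * ε = 1) {σ : V →ₗ[k] V} (e : V ≃ₗ[k] U × U)
    (hσ : ∀ x, e (σ x) = ε • (e x).swap) :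
    Module.finrank k (LinearMap.range (1 - σ)) = Module.finrank k U := by
  let f : U →ₗ[k] V := e.symm.toLinearMap ∘ₗ (LinearMap.id.prod (-ε • LinearMap.id))
  have hf : Function.Injective f := fun u v huv => congrArg Prod.fst (e.symm.injective huv)
  have hr : LinearMap.range (1 - σ) = LinearMap.range f := by
    refine le_antisymm ?_ ?_
    · rintro _ ⟨x, rfl⟩
      refine ⟨(e x).1 - ε • (e x).2, e.injective ?_⟩
      simp only [f, LinearMap.comp_apply, LinearEquiv.coe_coe, LinearEquiv.apply_symm_apply,
        LinearMap.sub_apply, map_sub, hσ, Module.End.one_apply]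
      refine Prod.ext rfl ?_
      change -ε • (e x).1 - -ε • ε • (e x).2 = (e x).2 - ε • (e x).1
      rw [smul_smul, neg_mul, hε]
      simp only [neg_smul, one_smul]
      abel
    · rintro _ ⟨u, rfl⟩
      refine ⟨e.symm (u, 0), e.injective ?_⟩
      simp only [f, LinearMap.comp_apply, LinearEquiv.coe_coe, LinearEquiv.apply_symm_apply,
        LinearMap.sub_apply, map_sub, hσ, Module.End.one_apply]
      refine Prod.ext ?_ ?_
      · change u - ε • (0 : U) = u
        simp
      · change 0 - ε • u = -ε • u
        simp
  rw [hr, LinearMap.finrank_range_of_inj hf]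

variable {α : A →ₗ[k] C} {P : C →ₗ[k] V} {a₁ a₂ : V →ₗ[k] A} {s₁ s₂ : A →ₗ[k] V}
  {σ τ : V →ₗ[k] V}

/-- A map presented through two involutions of a vector space. -/
structure Presented (α : A →ₗ[k] C) (P : C →ₗ[k] V) (a₁ a₂ : V →ₗ[k] A) (s₁ s₂ : A →ₗ[k] V)
    (σ τ : V →ₗ[k] V) : Prop where
  bij : Function.Bijective P
  as : a₁ ∘ₗ s₁ + a₂ ∘ₗ s₂ = -1
  sa₁₁ : s₁ ∘ₗ a₁ = 1 - σ
  sa₂₂ : s₂ ∘ₗ a₂ = 1 - τ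
  sa₁₂ : s₁ ∘ₗ a₂ = 0
  sa₂₁ : s₂ ∘ₗ a₁ = 0
  pa₁ : P ∘ₗ α ∘ₗ a₁ = σ - 1
  pa₂ : P ∘ₗ α ∘ₗ a₂ = τ - 1

lemma Presented.s₁_eq (h : Presented α P a₁ a₂ s₁ s₂ σ τ) (w : A) : (1 - σ) (s₁ w) = -s₁ w := by
  have h1 := congrArg s₁ (LinearMap.congr_fun h.as w)
  have h2 := LinearMap.congr_fun h.sa₁₁ (s₁ w)
  have h3 := LinearMap.congr_fun h.sa₁₂ (s₂ w)
  simp only [LinearMap.add_apply, LinearMap.comp_apply, map_add, LinearMap.neg_apply, map_neg,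
    Module.End.one_apply, LinearMap.zero_apply] at h1 h2 h3
  rw [← h2, ← h1, h3, add_zero]

lemma Presented.s₂_eq (h : Presented α P a₁ a₂ s₁ s₂ σ τ) (w : A) : (1 - τ) (s₂ w) = -s₂ w := by
  have h1 := congrArg s₂ (LinearMap.congr_fun h.as w)
  have h2 := LinearMap.congr_fun h.sa₂₂ (s₂ w)
  have h3 := LinearMap.congr_fun h.sa₂₁ (s₁ w)
  simp only [LinearMap.add_apply, LinearMap.comp_apply, map_add, LinearMap.neg_apply, map_neg,
    Module.End.one_apply, LinearMap.zero_apply] at h1 h2 h3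
  rw [← h2, ← h1, h3, zero_add]

lemma Presented.α_eq (h : Presented α P a₁ a₂ s₁ s₂ σ τ) (w : A) : P (α w) = -(s₁ w + s₂ w) := by
  have h1 := congrArg (fun x => P (α x)) (LinearMap.congr_fun h.as w)
  have h2 := LinearMap.congr_fun h.pa₁ (s₁ w)
  have h3 := LinearMap.congr_fun h.pa₂ (s₂ w)
  have h4 := h.s₁_eq w
  have h5 := h.s₂_eq w
  simp only [LinearMap.add_apply, LinearMap.comp_apply, map_add, LinearMap.neg_apply, map_neg,
    Module.End.one_apply, LinearMap.sub_apply] at h1 h2 h3 h4 h5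
  rw [h2, h3, ← neg_sub, h4, ← neg_sub (s₂ w), h5, neg_neg, neg_neg] at h1
  rw [h1, neg_neg]

lemma Presented.eq_zero (h : Presented α P a₁ a₂ s₁ s₂ σ τ) {w : A} (h1 : s₁ w = 0)
    (h2 : s₂ w = 0) : w = 0 := by
  have := LinearMap.congr_fun h.as w
  simpa [h1, h2] using this.symm

lemma Presented.finrank_pos (h : Presented α P a₁ a₂ s₁ s₂ σ τ) (e : V ≃ₗ[k] U × U)
    (hσ : ∀ x, e (σ x) = (1 : ℤ) • (e x).swap) (hτ : ∀ x, e (τ x) = (1 : ℤ) • e x) :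
    Function.Injective α ∧ Module.finrank k (LinearMap.range α) = Module.finrank k U := by
  have ht : τ = 1 := LinearMap.ext fun x => e.injective (by rw [hτ, one_smul]; rfl)
  have hs : ∀ w, s₂ w = 0 := fun w => by
    have := h.s₂_eq w
    rw [ht, sub_self] at this
    simpa using this
  have hP : ∀ w, P (α w) = -s₁ w := fun w => by rw [h.α_eq, hs, add_zero]
  refine ⟨(injective_iff_map_eq_zero _).2 fun w hw => h.eq_zero ?_ (hs w), ?_⟩
  · have := hP w
    rw [hw, map_zero] at this
    simpa using this.symm
  · rw [← finrank_range_swap 1 rfl e hσ, ← LinearMap.finrank_range_of_inj (f := P.domRestrict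
      (LinearMap.range α)) (fun x y hxy => Subtype.ext (h.bij.1 hxy))]
    · refine congrArg (fun W : Submodule k V => Module.finrank k W) (SetLike.ext fun v => ?_)
      constructor
      · rintro ⟨⟨_, w, rfl⟩, rfl⟩
        exact ⟨s₁ w, by rw [h.s₁_eq]; exact (hP w).symm⟩
      · rintro ⟨x, rfl⟩
        refine ⟨⟨α (-a₁ x), _, rfl⟩, ?_⟩
        change P (α (-a₁ x)) = _
        rw [hP, map_neg, neg_neg]
        exact LinearMap.congr_fun h.sa₁₁ x

lemma Presented.finrank_neg (h : Presented α P a₁ a₂ s₁ s₂ σ τ) (h3 : (3 : k) = 0)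
    (e : V ≃ₗ[k] U × U) (hσ : ∀ x, e (σ x) = (-1 : ℤ) • (e x).swap)
    (hτ : ∀ x, e (τ x) = (-1 : ℤ) • e x) :
    Function.Surjective α ∧ Module.finrank k (LinearMap.ker α) = Module.finrank k U := by
  have ht : ∀ x, (1 - τ) x = -x := fun x => e.injective (by
    rw [LinearMap.sub_apply, map_sub, hτ, map_neg, ← sub_eq_zero]
    have : (3 : k) • e x = 0 := by rw [h3, zero_smul]
    rw [← this, show (3 : k) = 1 + 1 + 1 by norm_num, add_smul, add_smul, one_smul]
    simp)
  have hsa₂ : ∀ x, s₂ (a₂ x) = -x := fun x => (LinearMap.congr_fun h.sa₂₂ x).trans (ht x)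
  have hsa₁ : ∀ x, s₁ (a₂ x) = 0 := fun x => LinearMap.congr_fun h.sa₁₂ x
  have hsa₃ : ∀ x, s₂ (a₁ x) = 0 := fun x => LinearMap.congr_fun h.sa₂₁ x
  have hsa₄ : ∀ x, s₁ (a₁ x) = (1 - σ) x := fun x => LinearMap.congr_fun h.sa₁₁ x
  constructor
  · intro c
    refine ⟨a₂ (P c), h.bij.1 ?_⟩
    rw [h.α_eq, hsa₁, hsa₂, zero_add, neg_neg]
  · rw [← finrank_range_swap (-1) rfl e hσ, ← LinearMap.finrank_range_of_inj (f := s₁.domRestrict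
      (LinearMap.ker α)) ?_]
    · refine congrArg (fun W : Submodule k V => Module.finrank k W) (SetLike.ext fun v => ?_)
      constructor
      · rintro ⟨⟨w, hw⟩, rfl⟩
        exact ⟨-s₁ w, by rw [map_neg, h.s₁_eq, neg_neg]; rfl⟩
      · rintro ⟨x, rfl⟩
        refine ⟨⟨a₁ x + a₂ ((1 - σ) x), h.bij.1 ?_⟩, ?_⟩
        · rw [h.α_eq, map_add, map_add, hsa₁, hsa₂, hsa₃, hsa₄, map_zero]
          abel
        · change s₁ (a₁ x + a₂ ((1 - σ) x)) = _
          rw [map_add, hsa₁, hsa₄, add_zero]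
    · rintro ⟨x, hx⟩ ⟨y, hy⟩ hxy
      refine Subtype.ext (sub_eq_zero.1 (h.eq_zero (w := x - y) ?_ ?_))
      · rw [map_sub, sub_eq_zero]; exact hxy
      · have h1 := h.α_eq (x - y)
        have h2 : s₁ (x - y) = 0 := by rw [map_sub, sub_eq_zero]; exact hxy
        have h3 : α (x - y) = 0 := by rw [map_sub, hx, hy, sub_zero]
        rw [h3, h2, map_zero, zero_add] at h1
        exact neg_eq_zero.1 h1.symm

/-- The middle dimension in a five-term exact sequence. -/
lemma finrank_of_exact {A₁ B₁ C₁ T A₀ B₀ C₀ : Type} [AddCommGroup A₁] [Module k A₁]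
    [AddCommGroup B₁] [Module k B₁] [AddCommGroup C₁] [Module k C₁] [AddCommGroup T] [Module k T]
    [AddCommGroup A₀] [Module k A₀] [AddCommGroup B₀] [Module k B₀] [AddCommGroup C₀] [Module k C₀]
    [Module.Finite k C₁] {d₁ : A₁ →ₗ[k] B₁} {j₁ : B₁ →ₗ[k] C₁} {ε : C₁ →ₗ[k] T} {δ : T →ₗ[k] B₀}
    {d₀ : A₀ →ₗ[k] B₀} {j₀ : B₀ →ₗ[k] C₀} (hd₁ : Function.Surjective d₁)
    (hd₀ : Function.Bijective d₀) (h1 : Function.Exact j₁ ε) (h2 : Function.Exact ε δ)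
    (h3 : Function.Exact δ j₀) (hfin : Module.Finite k (LinearMap.ker (j₀ ∘ₗ d₀))) :
    Module.finrank k T + Module.finrank k (LinearMap.range (j₁ ∘ₗ d₁)) =
      Module.finrank k C₁ + Module.finrank k (LinearMap.ker (j₀ ∘ₗ d₀)) := by
  let E : LinearMap.ker (j₀ ∘ₗ d₀) ≃ₗ[k] LinearMap.ker j₀ :=
    LinearEquiv.ofBijective (d₀.restrict fun x hx => hx) (by
      constructor
      · exact fun x y hxy => Subtype.ext (hd₀.1 (congrArg Subtype.val hxy))
      · rintro ⟨y, hy⟩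
        obtain ⟨x, rfl⟩ := hd₀.2 y
        exact ⟨⟨x, hy⟩, rfl⟩)
  have hr : LinearMap.range δ = LinearMap.ker j₀ := (LinearMap.exact_iff.1 h3).symm
  have hk : LinearMap.ker δ = LinearMap.range ε := LinearMap.exact_iff.1 h2
  have hk' : LinearMap.ker ε = LinearMap.range (j₁ ∘ₗ d₁) := by
    rw [LinearMap.exact_iff.1 h1, LinearMap.range_comp, LinearMap.range_eq_top.2 hd₁,
      Submodule.map_top]
  have : Module.Finite k (LinearMap.ker j₀) := Module.Finite.equiv E
  have : Module.Finite k (LinearMap.range δ) := by rw [hr]; infer_instance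
  have : Module.Finite k (LinearMap.ker δ) := by rw [hk]; infer_instance
  have : Module.Finite k (T ⧸ LinearMap.ker δ) :=
    Module.Finite.equiv δ.quotKerEquivRange.symm
  have : Module.Finite k T := Module.Finite.of_submodule_quotient (LinearMap.ker δ)
  have e1 := LinearMap.finrank_range_add_finrank_ker δ
  have e2 := LinearMap.finrank_range_add_finrank_ker ε
  rw [hr, hk, ← E.finrank_eq] at e1
  rw [hk'] at e2
  omega

end LinearAlgebra

section Assembly
variable {k G : Type} [Field k] [Group G] {Z C₁ B C₀ T M : Rep.{0} k G}

lemma SES.bijective_of_acyclic {i : Z ⟶ C₁} {d : C₁ ⟶ B} (h : SES i d)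
    (hZ : ∀ q, Subsingleton (groupHomology Z (q + 1))) (q : ℕ) :
    Function.Bijective (hm (q + 2) d) := by
  constructor
  · refine (injective_iff_map_eq_zero _).2 fun x hx => ?_
    obtain ⟨y, rfl⟩ := (h.exact₂ (q + 2) x).1 hx
    have := hZ (q + 1)
    rw [Subsingleton.elim y 0, map_zero]
  · intro x
    have := hZ q
    exact (h.exact₃ (q + 1) x).1 (Subsingleton.elim _ _)

/-- The dimension count for the homology of a group acting on an acyclic complex. -/
theorem finrank_homology {U : Type} [AddCommGroup U] [Module k U] [Module.Finite k U]
    (h3 : (3 : k) = 0) {i : Z ⟶ C₁} {d : C₁ ⟶ B} (hd : SES i d) {j : B ⟶ C₀} {ε : C₀ ⟶ T}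
    (hj : SES j ε) (hZ : ∀ q, Subsingleton (groupHomology Z (q + 1))) {π : C₀ ⟶ M}
    {a₁ a₂ : M ⟶ C₁} {s₁ s₂ : C₁ ⟶ M} {σ τ : M ⟶ M}
    (hp : ∀ q, 0 < q → Presented (hm q (d ≫ j)) (hm q π) (hm q a₁) (hm q a₂) (hm q s₁) (hm q s₂)
      (hm q σ) (hm q τ))
    (he : ∀ q, ∃ e : groupHomology M q ≃ₗ[k] U × U,
      (∀ x, e (hm q σ x) = periodSign q • (e x).swap) ∧ ∀ x, e (hm q τ x) = periodSign q • e x)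
    (q : ℕ) (hq : 2 < q) :
    Module.finrank k (groupHomology T q) =
      (if periodSign q = 1 then Module.finrank k U else 0) +
        (if periodSign (q - 1) = 1 then 0 else Module.finrank k U) := by
  obtain ⟨q, rfl⟩ : ∃ r, q = r + 3 := ⟨q - 3, by omega⟩
  simp only [show q + 3 - 1 = q + 2 by omega]
  obtain ⟨e, hσ, hτ⟩ := he (q + 3)
  obtain ⟨e', hσ', hτ'⟩ := he (q + 2)
  have p1 := hp (q + 3) (by omega)
  have p0 := hp (q + 2) (by omega)
  have E : groupHomology C₀ (q + 3) ≃ₗ[k] U × U := (LinearEquiv.ofBijective _ p1.bij).trans e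
  have E' : groupHomology C₀ (q + 2) ≃ₗ[k] U × U := (LinearEquiv.ofBijective _ p0.bij).trans e'
  have : Module.Finite k (groupHomology C₀ (q + 3)) := Module.Finite.equiv E.symm
  have dim : Module.finrank k (groupHomology C₀ (q + 3)) = 2 * Module.finrank k U := by
    rw [E.finrank_eq, Module.finrank_prod, two_mul]
  have : Module.Finite k (groupHomology M (q + 2)) := Module.Finite.equiv e'.symm
  have hfin : Module.Finite k (LinearMap.ker (hm (q + 2) j ∘ₗ hm (q + 2) d)) := by
    have hA : Module.Finite k (groupHomology C₁ (q + 2)) :=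
      Module.Finite.of_surjective ((hm (q + 2) a₁).coprod (hm (q + 2) a₂)) fun w =>
        ⟨(-hm _ s₁ w, -hm _ s₂ w), by
          have := LinearMap.congr_fun p0.as w
          simp only [LinearMap.coprod_apply, map_neg, LinearMap.add_apply, LinearMap.comp_apply,
            LinearMap.neg_apply, Module.End.one_apply] at this ⊢
          rw [← neg_add, this, neg_neg]⟩
    infer_instance
  have key := finrank_of_exact (hd.bijective_of_acyclic hZ (q + 1)).2 (hd.bijective_of_acyclic hZ q)
    (hj.exact₂ (q + 3)) (hj.exact₃ (q + 2)) (hj.exact₁ (q + 2)) hfin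
  rw [← hm_comp, ← hm_comp, dim] at key
  have sign : ∀ r, periodSign r = 1 ∨ periodSign r = -1 := fun r => by
    unfold periodSign; split_ifs <;> simp
  have c1 : Module.finrank k (LinearMap.range (hm (q + 3) (d ≫ j))) +
      (if periodSign (q + 3) = 1 then Module.finrank k U else 0) = 2 * Module.finrank k U := by
    rcases sign (q + 3) with s | s
    · rw [if_pos s, (p1.finrank_pos e (by simpa only [s] using hσ) (by simpa only [s] using hτ)).2]
      ring
    · rw [if_neg (by rw [s]; decide), LinearMap.range_eq_top.2 (p1.finrank_neg h3 e
        (by simpa only [s] using hσ) (by simpa only [s] using hτ)).1, finrank_top, dim, add_zero]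
  have c0 : Module.finrank k (LinearMap.ker (hm (q + 2) (d ≫ j))) =
      if periodSign (q + 2) = 1 then 0 else Module.finrank k U := by
    rcases sign (q + 2) with s | s
    · rw [if_pos s, LinearMap.ker_eq_bot.2 (p0.finrank_pos e' (by simpa only [s] using hσ')
        (by simpa only [s] using hτ')).1, finrank_bot]
    · rw [if_neg (by rw [s]; decide), (p0.finrank_neg h3 e' (by simpa only [s] using hσ')
        (by simpa only [s] using hτ')).2]
  omega

end Assembly
end O13

namespace O13
open CategoryTheory

section Sub
variable {k G : Type} [CommRing k] [Group G]

/-- An invariant submodule of a representation. -/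
noncomputable abbrev subRep (A : Rep.{0} k G) (W : Submodule k A) (hW : ∀ g : G, ∀ x ∈ W, A.ρ g x ∈ W) :
    Rep.{0} k G := Rep.subrepresentation A W hW

variable {A B : Rep.{0} k G} {W : Submodule k A} {hW : ∀ g : G, ∀ x ∈ W, A.ρ g x ∈ W}

/-- The inclusion of an invariant submodule. -/
noncomputable def subIncl (A : Rep.{0} k G) (W : Submodule k A) (hW : ∀ g : G, ∀ x ∈ W, A.ρ g x ∈ W) :
    subRep A W hW ⟶ A := Rep.subtype A W hW

/-- A morphism into an invariant submodule. -/
noncomputable def subLift (f : B ⟶ A) (hW : ∀ g : G, ∀ x ∈ W, A.ρ g x ∈ W) (h : ∀ x, f.hom x ∈ W) :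
    B ⟶ subRep A W hW :=
  mkHom (B := subRep A W hW) (LinearMap.codRestrict W f.hom.toLinearMap h) fun g x =>
    Subtype.ext (Rep.hom_comm_apply f g x)

lemma rep_ext {f g : B ⟶ A} (h : ∀ x, f.hom x = g.hom x) : f = g :=
  Rep.hom_ext (Representation.IntertwiningMap.toLinearMap_injective _ _ (LinearMap.ext h))

lemma mapDomain_smul_apply {X : Type} [MulAction G X] (g : G) (z : X →₀ k) (x : X) :
    Finsupp.mapDomain (g • ·) z x = z (g⁻¹ • x) := by
  conv_lhs => rw [← smul_inv_smul g x]
  exact Finsupp.mapDomain_apply (MulAction.injective g) _ _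

end Sub

section Average
variable {k G : Type} [Field k] [Group G] {X P : Type} [MulAction G X] [MulAction G P]

/-- The projection onto an invariant set of basis vectors. -/
noncomputable def permProj (k : Type) [Field k] (Q : X → Prop) (hQ : ∀ (g : G) x, Q (g • x) ↔ Q x) :
    perm k G X ⟶ perm k G X := by
  classical
  exact permLift (fun x => if Q x then pt k G x else 0) fun g x => by
    simp only [hQ]
    split_ifs with h
    · rw [perm_ρ_pt]
    · rw [map_zero]

lemma permProj_pos {Q : X → Prop} {hQ : ∀ (g : G) x, Q (g • x) ↔ Q x} {x : X} (h : Q x) :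
    (permProj k Q hQ).hom (pt k G x) = pt k G x := by
  rw [permProj, permLift_pt, if_pos h]

lemma permProj_neg {Q : X → Prop} {hQ : ∀ (g : G) x, Q (g • x) ↔ Q x} {x : X} (h : ¬ Q x) :
    (permProj k Q hQ).hom (pt k G x) = 0 := by
  rw [permProj, permLift_pt, if_neg h]

/-- The projection vanishes on homology when the points of the set carry an equivariant
finite set of labels from a free set, of invertible cardinality. -/
theorem hm_permProj {A B : Rep.{0} k G} {Q : X → Prop} (hQ : ∀ (g : G) x, Q (g • x) ↔ Q x)
    (hfree : ∀ (g : G) (p : P), g • p = p → g = 1) (S : X → Finset P)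
    (hS : ∀ (g : G) x p, Q x → (g • p ∈ S (g • x) ↔ p ∈ S x)) (hcard : ∀ x, Q x → ((S x).card : k) ≠ 0)
    (f : A ⟶ perm k G X) (h : perm k G X ⟶ B) {q : ℕ} (hq : 0 < q) :
    hm q (f ≫ permProj k Q hQ ≫ h) = 0 := by
  classical
  have hSg : ∀ (g : G) x, Q x → S (g • x) = (S x).image (g • ·) := fun g x hx => by
    ext p
    rw [Finset.mem_image]
    constructor
    · intro hp
      refine ⟨g⁻¹ • p, ?_, smul_inv_smul _ _⟩
      rw [← hS g _ _ hx, smul_inv_smul]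
      exact hp
    · rintro ⟨p, hp, rfl⟩
      exact (hS g x p hx).2 hp
  let φ : X → perm k G (X × P) := fun x =>
    if Q x then ((S x).card : k)⁻¹ • ∑ p ∈ S x, pt k G (x, p) else 0
  have hφ : ∀ (g : G) x, φ (g • x) = (perm k G (X × P)).ρ g (φ x) := fun g x => by
    simp only [φ, hQ]
    split_ifs with hx
    · rw [map_smul, map_sum, hSg g x hx, Finset.card_image_of_injective _ (MulAction.injective g),
        Finset.sum_image fun a _ b _ hab => MulAction.injective g hab]
      congr 1
      exact Finset.sum_congr rfl fun p _ => (perm_ρ_pt k g (x, p)).symm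
    · rw [map_zero]
  have key : permProj k Q hQ = permLift φ hφ ≫ permMap Prod.fst (fun _ _ => rfl) :=
    perm_hom_ext fun x => by
      change _ = (permMap Prod.fst (fun _ _ => rfl)).hom ((permLift φ hφ).hom (pt k G x))
      rw [permLift_pt]
      by_cases hx : Q x
      · rw [permProj_pos hx]
        simp only [φ, if_pos hx]
        rw [map_smul, map_sum, Finset.sum_congr (g := fun _ => pt k G x) rfl
            fun p _ => permMap_pt _ _ (x, p), Finset.sum_const, ← Nat.cast_smul_eq_nsmul k, smul_smul, inv_mul_cancel₀ (hcard x hx),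
          one_smul]
      · rw [permProj_neg hx]
        simp only [φ, if_neg hx, map_zero]
  have hfree' : ∀ (g : G) (x : X × P), g • x = x → g = 1 := fun g x hx =>
    hfree g x.2 (congrArg Prod.snd hx)
  rw [key, Category.assoc, ← Category.assoc]
  exact hm_eq_zero_of_factor hfree' _ _ hq

end Average

section Complex
variable {k G C E : Type} [Field k] [Group G] [MulAction G C] [MulAction G E]

/-- A group action on the data of a complex, free on edges. -/
structure MorseData.Equivariant (D : MorseData k C E) (G : Type) [Group G] [MulAction G C]
    [MulAction G E] : Prop where
  adj_smul : ∀ (g : G) c c', D.adj c c' → D.adj (g • c) (g • c')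
  S_smul : ∀ (g : G) e, D.S (g • e) = Finsupp.mapDomain (g • ·) (D.S e)
  flip_smul : ∀ (g : G) e, D.flip (g • e) = g • D.flip e
  S_ne : ∀ e, D.S e ≠ 0
  free : ∀ (g : G) (e : E), g • e = e → g = 1

namespace MorseData.Equivariant
variable {D : MorseData k C E} (h : D.Equivariant G)
include h

lemma chains₂_mem (g : G) (x : perm k G E) (hx : x ∈ D.chains₂) :
    (perm k G E).ρ g x ∈ D.chains₂ := fun e => by
  rw [perm_ρ_apply, mapDomain_smul_apply, mapDomain_smul_apply, ← hx, h.flip_smul]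

lemma chains₁_mem (g : G) (x : perm k G (C × C)) (hx : x ∈ D.chains₁) :
    (perm k G (C × C)).ρ g x ∈ D.chains₁ := fun c c' => by
  rw [perm_ρ_apply, mapDomain_smul_apply, mapDomain_smul_apply]
  refine ⟨(hx _ _).1, fun h0 => ?_⟩
  have := h.adj_smul g _ _ ((hx _ _).2 h0)
  rwa [smul_inv_smul, smul_inv_smul] at this

/-- The representation on antisymmetric chains of edges. -/
noncomputable abbrev rep₂ : Rep.{0} k G := subRep (perm k G E) D.chains₂ h.chains₂_mem

/-- The representation on antisymmetric chains of adjacent cells. -/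
noncomputable abbrev rep₁ : Rep.{0} k G := subRep (perm k G (C × C)) D.chains₁ h.chains₁_mem

/-- The inclusion of chains of adjacent cells in all chains. -/
noncomputable def incl₁ : h.rep₁ ⟶ perm k G (C × C) := subIncl _ _ _

/-- The augmentation. -/
noncomputable def aug (k G C : Type) [Field k] [Group G] [MulAction G C] :
    perm k G C ⟶ Rep.trivial k G k :=
  permLift (B := Rep.trivial k G k) (fun _ => (1 : k)) fun _ _ => rfl

omit h in
lemma aug_apply (x : C →₀ k) : (aug k G C).hom x = x.sum (fun _ a => a) := by
  change Finsupp.linearCombination k (fun _ => (1 : k)) x = _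
  rw [Finsupp.linearCombination_apply]
  simp

omit h in
lemma aug_pt (c : C) : (aug k G C).hom (pt k G c) = (1 : k) := permLift_pt (B := Rep.trivial k G k) _ _ _

/-- The difference of end points. -/
noncomputable def bdry : h.rep₁ ⟶ perm k G C := h.incl₁ ≫ permMap Prod.snd fun _ _ => rfl

lemma bdry_apply (x : h.rep₁) : h.bdry.hom x = Finsupp.mapDomain Prod.snd x.1 :=
  permMap_apply (G := G) Prod.snd (fun _ _ => rfl) x.1

omit [MulAction G E] h in
lemma arrow_mem {c c' : C} (hcc : D.adj c c') :
    (pt k G (c, c') - pt k G (c', c) : C × C →₀ k) ∈ D.chains₁ := fun a b => by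
  classical
  simp only [pt, Finsupp.sub_apply, Finsupp.single_apply, Prod.mk.injEq]
  refine ⟨?_, fun h0 => ?_⟩
  · simp only [and_comm]
    ring
  · by_cases h1 : c = a ∧ c' = b
    · rw [← h1.1, ← h1.2]; exact hcc
    · by_cases h2 : c' = a ∧ c = b
      · rw [← h2.1, ← h2.2]; exact D.adj_symm _ _ hcc
      · simp [h1, h2] at h0

/-- The antisymmetric chain of an adjacent pair. -/
noncomputable def arrow {c c' : C} (hcc : D.adj c c') : h.rep₁ :=
  ⟨pt k G (c, c') - pt k G (c', c), arrow_mem hcc⟩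

lemma arrow_smul (g : G) {c c' : C} (hcc : D.adj c c') :
    h.arrow (h.adj_smul g _ _ hcc) = h.rep₁.ρ g (h.arrow hcc) := Subtype.ext (by
  change pt k G (g • c, g • c') - pt k G (g • c', g • c) =
    (perm k G (C × C)).ρ g (pt k G (c, c') - pt k G (c', c))
  rw [map_sub, perm_ρ_pt, perm_ρ_pt]
  rfl)

lemma arrow_symm {c c' : C} (hcc : D.adj c c') :
    h.arrow (D.adj_symm _ _ hcc) = - h.arrow hcc := Subtype.ext (neg_sub _ _).symm

lemma incl₁_arrow {c c' : C} (hcc : D.adj c c') :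
    h.incl₁.hom (h.arrow hcc) = pt k G (c, c') - pt k G (c', c) := rfl

/-- Antisymmetrization. -/
noncomputable def anti : perm k G (C × C) ⟶ h.rep₁ := by
  classical
  exact permLift (B := h.rep₁) (fun p => if hp : D.adj p.1 p.2 then (2 : k)⁻¹ • h.arrow hp else 0)
    fun g p => by
      have hiff : D.adj (g • p).1 (g • p).2 ↔ D.adj p.1 p.2 := ⟨fun hp => by
        have := h.adj_smul g⁻¹ _ _ hp
        change D.adj (g⁻¹ • g • p.1) (g⁻¹ • g • p.2) at this
        rwa [inv_smul_smul, inv_smul_smul] at this, h.adj_smul g _ _⟩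
      by_cases hp : D.adj p.1 p.2
      · rw [dif_pos hp, dif_pos (hiff.2 hp), map_smul, ← h.arrow_smul]
      · rw [dif_neg hp, dif_neg (hiff.not.2 hp), map_zero]

lemma anti_pos {c c' : C} (hcc : D.adj c c') :
    h.anti.hom (pt k G (c, c')) = (2 : k)⁻¹ • h.arrow hcc := by
  rw [anti, permLift_pt, dif_pos hcc]

lemma anti_neg {c c' : C} (hcc : ¬ D.adj c c') : h.anti.hom (pt k G (c, c')) = 0 := by
  rw [anti, permLift_pt, dif_neg hcc]

lemma anti_arrow (h2 : (2 : k) ≠ 0) {c c' : C} (hcc : D.adj c c') :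
    h.anti.hom (h.incl₁.hom (h.arrow hcc)) = h.arrow hcc := by
  rw [incl₁_arrow, map_sub, h.anti_pos hcc, h.anti_pos (D.adj_symm _ _ hcc), h.arrow_symm hcc, smul_neg,
    sub_neg_eq_add, ← two_smul k, smul_smul, mul_inv_cancel₀ h2, one_smul]

lemma incl₁_anti (h2 : (2 : k) ≠ 0) : h.incl₁ ≫ h.anti = 𝟙 _ := rep_ext fun x => by
  have hx := x.2
  have h1 : ∀ y : C × C →₀ k, (∀ p, y p ≠ 0 → D.adj p.1 p.2) → (h.anti.hom y).1 =
      (2 : k)⁻¹ • (y - Finsupp.mapDomain Prod.swap y) := fun y hy => by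
    have e1 : h.anti.hom y = y.sum fun p a => a • h.anti.hom (pt k G p) := by
      conv_lhs => rw [← Finsupp.sum_single y]
      rw [Finsupp.sum, map_sum]
      refine Finset.sum_congr rfl fun p _ => ?_
      change _ = y p • h.anti.hom (pt k G p)
      rw [← map_smul, pt, Finsupp.smul_single, smul_eq_mul, mul_one]
    have e2 : (2 : k)⁻¹ • (y - Finsupp.mapDomain Prod.swap y) = y.sum fun p a =>
        a • (2 : k)⁻¹ • (pt k G p - pt k G p.swap) := by
      have : y - Finsupp.mapDomain Prod.swap y =
          y.sum fun p a => (Finsupp.single p a - Finsupp.single p.swap a) := by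
        rw [Finsupp.sum_sub, Finsupp.sum_single]
        rfl
      rw [this, Finsupp.sum, Finset.smul_sum, Finsupp.sum]
      refine Finset.sum_congr rfl fun p _ => ?_
      rw [smul_comm, smul_sub (y p), pt, pt, Finsupp.smul_single, Finsupp.smul_single, smul_eq_mul,
        mul_one]
    rw [e1, e2, Finsupp.sum, Finsupp.sum, AddSubmonoidClass.coe_finsetSum]
    refine Finset.sum_congr rfl fun p hp => ?_
    rw [h.anti_pos (hy p (Finsupp.mem_support_iff.1 hp))]
    rfl
  have h3 : Finsupp.mapDomain Prod.swap x.1 = -x.1 := Finsupp.ext fun p => by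
    conv_lhs => rw [← Prod.swap_swap p]
    rw [Finsupp.mapDomain_apply Prod.swap_injective]
    exact (hx p.1 p.2).1
  refine Subtype.ext ((h1 x.1 fun p => (hx p.1 p.2).2).trans ?_)
  rw [h3, sub_neg_eq_add, ← two_smul k, smul_smul, inv_mul_cancel₀ h2, one_smul]
  rfl

lemma rep₁_ext (h2 : (2 : k) ≠ 0) {B : Rep.{0} k G} {f g : h.rep₁ ⟶ B}
    (hfg : ∀ {c c'} (hcc : D.adj c c'), f.hom (h.arrow hcc) = g.hom (h.arrow hcc)) : f = g := by
  have h1 : h.anti ≫ f = h.anti ≫ g := perm_hom_ext fun p => by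
    change f.hom (h.anti.hom (pt k G p)) = g.hom (h.anti.hom (pt k G p))
    by_cases hp : D.adj p.1 p.2
    · rw [h.anti_pos hp, map_smul, map_smul, hfg]
    · rw [h.anti_neg hp, map_zero, map_zero]
  rw [← Category.id_comp f, ← Category.id_comp g, ← h.incl₁_anti h2, Category.assoc, h1,
    Category.assoc]

lemma bdry_arrow {c c' : C} (hcc : D.adj c c') :
    h.bdry.hom (h.arrow hcc) = pt k G c' - pt k G c := by
  change (permMap Prod.snd fun _ _ => rfl).hom (pt k G (c, c') - pt k G (c', c)) = _
  rw [map_sub, permMap_pt, permMap_pt]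

lemma bdry_aug (h2 : (2 : k) ≠ 0) : h.bdry ≫ aug k G C = 0 := h.rep₁_ext h2 fun {c c'} hcc => by
  change (aug k G C).hom (h.bdry.hom (h.arrow hcc)) = 0
  rw [h.bdry_arrow, map_sub, aug_pt, aug_pt, sub_self]

/-- The boundary map onto the augmentation kernel. -/
noncomputable def bdry' (h2 : (2 : k) ≠ 0) : h.rep₁ ⟶ kerRep (aug k G C) :=
  kerLift _ h.bdry (h.bdry_aug h2)

/-- The sum over the link of an edge. -/
noncomputable def link₂ : h.rep₂ ⟶ h.rep₁ :=
  subLift (subIncl _ _ _ ≫ permLift (B := perm k G (C × C)) D.S h.S_smul) h.chains₁_mem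
    fun x => D.linearCombination_mem x.1

lemma ses_link (h2 : (2 : k) ≠ 0) : SES h.link₂ (h.bdry' h2) where
  inj := (injective_iff_map_eq_zero _).2 fun x hx =>
    Subtype.ext (D.injective₂ h2 x.2 (congrArg Subtype.val hx) h.S_ne)
  surj := by
    rintro ⟨y, hy⟩
    obtain ⟨z, hz, rfl⟩ := D.exact₀ ((aug_apply (G := G) y).symm.trans hy)
    exact ⟨⟨z, hz⟩, Subtype.ext (h.bdry_apply ⟨z, hz⟩)⟩
  exact := by
    rintro ⟨z, hz⟩
    have h0 : (h.bdry' h2).hom ⟨z, hz⟩ = 0 ↔ Finsupp.mapDomain Prod.snd z = 0 := by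
      rw [← Subtype.coe_inj, ← h.bdry_apply ⟨z, hz⟩]
      rfl
    rw [h0]
    constructor
    · intro hz0
      obtain ⟨x, hx, rfl⟩ := D.exact₁ h2 hz hz0
      exact ⟨⟨x, hx⟩, rfl⟩
    · rintro ⟨x, hx⟩
      have hx' : Finsupp.linearCombination k D.S x.1 = z := congrArg Subtype.val hx
      rw [← hx']
      exact D.mapDomain_linearCombination x.1

omit [MulAction G E] h in
lemma ses_aug (D : MorseData k C E) : SES (kerIncl (aug k G C)) (aug k G C) := ses_kerIncl _ fun (a : k) =>
  ⟨(Finsupp.single D.bot a : C →₀ k), by rw [aug_apply]; simp⟩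

omit [MulAction G C] h in
lemma edge_arrow_mem (e : E) : (pt k G e - pt k G (D.flip e) : E →₀ k) ∈ D.chains₂ := fun f => by
  classical
  have : ∀ a b : E, a = D.flip b ↔ D.flip a = b := fun a b =>
    ⟨fun h => by rw [h, D.flip_flip], fun h => by rw [← h, D.flip_flip]⟩
  have e1 : (D.flip e = D.flip f) = (e = f) := by rw [← this, D.flip_flip]
  have e2 : (e = D.flip f) = (D.flip e = f) := by rw [this]
  simp only [pt, Finsupp.sub_apply, Finsupp.single_apply, e1, e2]
  ring

/-- Antisymmetrization of edges. -/
noncomputable def anti₂ : perm k G E ⟶ h.rep₂ :=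
  subLift (permLift (B := perm k G E) (fun e => (2 : k)⁻¹ • (pt k G e - pt k G (D.flip e)))
    fun g e => by rw [map_smul, map_sub, perm_ρ_pt, perm_ρ_pt, h.flip_smul]) h.chains₂_mem fun x => by
      change Finsupp.linearCombination k _ x ∈ _
      rw [Finsupp.linearCombination_apply]
      exact Submodule.sum_mem _ fun e _ => Submodule.smul_mem _ _
        (Submodule.smul_mem _ _ (edge_arrow_mem e))

lemma incl₂_anti (h2 : (2 : k) ≠ 0) : subIncl _ _ _ ≫ h.anti₂ = 𝟙 h.rep₂ := rep_ext fun x => by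
  have h1 : ∀ y : E →₀ k, Finsupp.linearCombination k
      (fun e => (2 : k)⁻¹ • (pt k G e - pt k G (D.flip e))) y =
      (2 : k)⁻¹ • (y - Finsupp.mapDomain D.flip y) := fun y =>
    LinearMap.congr_fun (g := (2 : k)⁻¹ • (LinearMap.id - Finsupp.lmapDomain k k D.flip))
      (Finsupp.lhom_ext' fun e => LinearMap.ext_ring (by simp [pt])) y
  have hinj : Function.Injective D.flip := fun a b hab => by
    rw [← D.flip_flip a, hab, D.flip_flip]
  have h3 : Finsupp.mapDomain D.flip x.1 = -x.1 := Finsupp.ext fun e => by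
    conv_lhs => rw [← D.flip_flip e]
    rw [Finsupp.mapDomain_apply hinj]
    exact x.2 e
  refine Subtype.ext ((h1 x.1).trans ?_)
  rw [h3, sub_neg_eq_add, ← two_smul k, smul_smul, inv_mul_cancel₀ h2, one_smul]
  rfl

lemma acyclic₂ (h2 : (2 : k) ≠ 0) (q : ℕ) : Subsingleton (groupHomology h.rep₂ (q + 1)) := by
  refine ⟨fun a b => ?_⟩
  have h0 := hm_eq_zero_of_factor h.free (subIncl _ _ h.chains₂_mem) h.anti₂ q.succ_pos
  rw [h.incl₂_anti h2, hm_id] at h0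
  exact (LinearMap.congr_fun h0 a).trans (LinearMap.congr_fun h0 b).symm

end MorseData.Equivariant
end Complex
end O13

namespace O13
open CategoryTheory

section Retract
variable {k G X Y : Type} [CommRing k] [Group G] [MulAction G X] [MulAction G Y] {f : X → Y}

/-- The retraction of permutation modules defined by an injective equivariant map. -/
noncomputable def permRet (k : Type) [CommRing k] (hf : Function.Injective f)
    (hg : ∀ (g : G) x, f (g • x) = g • f x) : perm k G Y ⟶ perm k G X := by
  classical
  exact permLift (fun y => if h : ∃ x, f x = y then pt k G h.choose else 0) fun g y => by
    by_cases h : ∃ x, f x = y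
    · obtain ⟨x, rfl⟩ := h
      have h1 : ∃ x', f x' = f x := ⟨x, rfl⟩
      have h2 : ∃ x', f x' = g • f x := ⟨g • x, hg g x⟩
      rw [dif_pos h1, dif_pos h2, perm_ρ_pt, hf h1.choose_spec, hf (h2.choose_spec.trans (hg g x).symm)]
    · rw [dif_neg h, map_zero, dif_neg]
      rintro ⟨x, hx⟩
      exact h ⟨g⁻¹ • x, by rw [hg, hx, inv_smul_smul]⟩

variable {hf : Function.Injective f} {hg : ∀ (g : G) x, f (g • x) = g • f x}

lemma permRet_apply (x : X) : (permRet k hf hg).hom (pt k G (f x)) = pt k G x := by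
  have h1 : ∃ x', f x' = f x := ⟨x, rfl⟩
  rw [permRet, permLift_pt, dif_pos h1, hf h1.choose_spec]

lemma permRet_of_ne {y : Y} (h : ∀ x, f x ≠ y) : (permRet k hf hg).hom (pt k G y) = 0 := by
  rw [permRet, permLift_pt, dif_neg]
  rintro ⟨x, hx⟩
  exact h x hx

end Retract

section Orbits
variable {k G X : Type} [Field k] [Group G] [MulAction G X] {V : Type} [MulAction G V]
  {p : V → X} {ρ : V → V}

/-- The action of reversing symmetries on the homology of a permutation module with
stabilizers of order three. -/
theorem Triple.exists_equiv (h : Triple G p ρ) (h3 : (3 : k) = 0) {σ τ : X → X} {φσ φτ : V → V}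
    (hσ : ∀ (g : G) x, σ (g • x) = g • σ x) (hτ : ∀ (g : G) x, τ (g • x) = g • τ x)
    (hφσ : ∀ (g : G) x, φσ (g • x) = g • φσ x) (hφτ : ∀ (g : G) x, φτ (g • x) = g • φτ x)
    (hpσ : ∀ v, p (φσ v) = σ (p v)) (hpτ : ∀ v, p (φτ v) = τ (p v))
    (hρσ : ∀ v, φσ (ρ v) = ρ (ρ (φσ v))) (hρτ : ∀ v, φτ (ρ v) = ρ (ρ (φτ v)))
    (l : X → Bool ⊕ Bool) (hl : Function.Surjective l)
    (horb : ∀ x y, l x = l y ↔ ∃ g : G, g • x = y) (hlσ : ∀ x, l (σ x) = (l x).swap)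
    (hlτ : ∀ x, l (τ x) = l x) (q : ℕ) :
    ∃ e : groupHomology (perm k G X) q ≃ₗ[k] (Bool →₀ k) × (Bool →₀ k),
      (∀ x, e (hm q (permMap σ hσ) x) = periodSign q • (e x).swap) ∧
        ∀ x, e (hm q (permMap τ hτ) x) = periodSign q • e x := by
  obtain ⟨e₀, he₀⟩ := (h.periodic (k := k)).exists_equiv h3 q
  obtain ⟨e₁, he₁⟩ := exists_basis_zero (k := k) l hl horb
  let e₂ := Finsupp.sumFinsuppLEquivProdFinsupp (α := Bool) (β := Bool) (M := k) k
  obtain ⟨ψσ, rσ⟩ := h.reverses (k := k) hσ hφσ hpσ hρσ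
  obtain ⟨ψτ, rτ⟩ := h.reverses (k := k) hτ hφτ hpτ hρτ
  have sw : ∀ s : Bool ⊕ Bool, e₂ (Finsupp.single s.swap 1) = (e₂ (Finsupp.single s 1)).swap := by
    rintro (s | s) <;> refine Prod.ext (Finsupp.ext fun b => ?_) (Finsupp.ext fun b => ?_) <;>
      simp [e₂, Finsupp.single_apply]
  have kσ : ∀ y, e₂ (e₁ (hm 0 (permMap σ hσ) y)) = (e₂ (e₁ y)).swap := fun y => by
    obtain ⟨a, rfl⟩ := cls_surjective _ y
    refine LinearMap.congr_fun
      (f := e₂.toLinearMap ∘ₗ e₁.toLinearMap ∘ₗ hm 0 (permMap σ hσ) ∘ₗ cls _)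
      (g := (LinearEquiv.prodComm k _ _).toLinearMap ∘ₗ e₂.toLinearMap ∘ₗ e₁.toLinearMap ∘ₗ cls _)
      (perm_lhom_ext fun x => ?_) a
    change e₂ (e₁ (hm 0 (permMap σ hσ) (cls _ (pt k G x)))) = (e₂ (e₁ (cls _ (pt k G x)))).swap
    rw [hm_cls, permMap_pt, he₁, he₁, hlσ, sw]
  have kτ : ∀ y, e₁ (hm 0 (permMap τ hτ) y) = e₁ y := fun y => by
    obtain ⟨a, rfl⟩ := cls_surjective _ y
    refine LinearMap.congr_fun (f := e₁.toLinearMap ∘ₗ hm 0 (permMap τ hτ) ∘ₗ cls _)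
      (g := e₁.toLinearMap ∘ₗ cls _) (perm_lhom_ext fun x => ?_) a
    change e₁ (hm 0 (permMap τ hτ) (cls _ (pt k G x))) = e₁ (cls _ (pt k G x))
    rw [hm_cls, permMap_pt, he₁, he₁, hlτ]
  refine ⟨(e₀.trans e₁).trans e₂, fun x => ?_, fun x => ?_⟩
  · change e₂ (e₁ (e₀ _)) = periodSign q • (e₂ (e₁ (e₀ x))).swap
    rw [he₀ _ _ _ rσ, map_zsmul, map_zsmul, kσ]
  · change e₂ (e₁ (e₀ _)) = periodSign q • (e₂ (e₁ (e₀ x)))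
    rw [he₀ _ _ _ rτ, map_zsmul, map_zsmul, kτ]

end Orbits

section Main
variable {k G C E X P : Type} [Field k] [Group G] [MulAction G C] [MulAction G E] [MulAction G X]
  [MulAction G P] {D : MorseData k C E}

/-- Cells with stabilizers of order three, and the symmetries across their special facets. -/
structure Special (D : MorseData k C E) (G : Type) [Group G] [MulAction G C] [MulAction G X]
    (ι : X → C) (σ τ : X → X) : Prop where
  inj : Function.Injective ι
  smul_ι : ∀ (g : G) x, ι (g • x) = g • ι x
  smul_σ : ∀ (g : G) x, σ (g • x) = g • σ x
  smul_τ : ∀ (g : G) x, τ (g • x) = g • τ x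
  σσ : ∀ x, σ (σ x) = x
  ττ : ∀ x, τ (τ x) = x
  ne : ∀ x, σ x ≠ τ x
  adj_σ : ∀ x, D.adj (ι x) (ι (σ x))
  adj_τ : ∀ x, D.adj (ι x) (ι (τ x))

namespace Special
variable {ι : X → C} {σ τ : X → X} (h : D.Equivariant G) (s : Special D G ι σ τ)

omit [MulAction G E] in
lemma swap (s : Special D G ι σ τ) : Special D G ι τ σ where
  inj := s.inj
  smul_ι := s.smul_ι
  smul_σ := s.smul_τ
  smul_τ := s.smul_σ
  σσ := s.ττ
  ττ := s.σσ
  ne := fun x => (s.ne x).symm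
  adj_σ := s.adj_τ
  adj_τ := s.adj_σ

omit [MulAction G E] in
include s in
lemma smul_pair (g : G) (x : X) : (ι (g • x), ι (σ (g • x))) = g • (ι x, ι (σ x)) := by
  rw [s.smul_σ, s.smul_ι, s.smul_ι]
  rfl

omit [MulAction G E] in
include s in
lemma pair_injective : Function.Injective fun x => (ι x, ι (σ x)) := fun _ _ hxy =>
  s.inj (congrArg Prod.fst hxy)

/-- The antisymmetric chain through a special facet. -/
noncomputable def chain : perm k G X ⟶ h.rep₁ :=
  permLift (B := h.rep₁) (fun x => h.arrow (s.adj_σ x)) fun g x => by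
    rw [← h.arrow_smul]
    refine Subtype.ext ?_
    change pt k G (_, _) - pt k G (_, _) = pt k G (_, _) - pt k G (_, _)
    rw [s.smul_σ, s.smul_ι, s.smul_ι]

lemma chain_pt (x : X) : (s.chain h).hom (pt k G x) = h.arrow (s.adj_σ x) := permLift_pt _ _ _

/-- The coefficients of a chain along the special facets. -/
noncomputable def coeff : h.rep₁ ⟶ perm k G X :=
  h.incl₁ ≫ permRet k s.pair_injective s.smul_pair

lemma coeff_arrow {c c' : C} (hcc : D.adj c c') : (s.coeff h).hom (h.arrow hcc) =
    (permRet k s.pair_injective s.smul_pair).hom (pt k G (c, c')) -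
      (permRet k s.pair_injective s.smul_pair).hom (pt k G (c', c)) :=
  (congrArg (permRet k s.pair_injective s.smul_pair).hom (h.incl₁_arrow hcc)).trans (map_sub _ _ _)

lemma coeff_special (x : X) :
    (s.coeff h).hom (h.arrow (s.adj_σ x)) = pt k G x - pt k G (σ x) := by
  rw [coeff_arrow, permRet_apply (f := fun x => (ι x, ι (σ x)))]
  congr 1
  have := permRet_apply (k := k) (hf := s.pair_injective) (hg := s.smul_pair) (σ x)
  rwa [s.σσ] at this

lemma coeff_ne {c c' : C} (hcc : D.adj c c') (h1 : ∀ x, (ι x, ι (σ x)) ≠ (c, c')) :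
    (s.coeff h).hom (h.arrow hcc) = 0 := by
  rw [coeff_arrow, permRet_of_ne h1, permRet_of_ne, sub_zero]
  intro x hx
  rw [Prod.mk.injEq] at hx
  exact h1 (σ x) (by rw [s.σσ, hx.1, hx.2])

lemma coeff_other (x : X) : (s.coeff h).hom (h.arrow (s.adj_τ x)) = 0 :=
  s.coeff_ne h _ fun y hy => by
    rw [Prod.mk.injEq] at hy
    have := s.inj hy.1
    subst this
    exact s.ne _ (s.inj hy.2)

lemma chain_coeff : s.chain h ≫ s.coeff h = 𝟙 _ - permMap σ s.smul_σ := perm_hom_ext fun x => by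
  change (s.coeff h).hom ((s.chain h).hom (pt k G x)) = pt k G x - (permMap σ s.smul_σ).hom (pt k G x)
  rw [chain_pt, coeff_special, permMap_pt]

lemma chain_coeff_swap : s.chain h ≫ s.swap.coeff h = 0 := perm_hom_ext fun x => by
  change (s.swap.coeff h).hom ((s.chain h).hom (pt k G x)) = 0
  rw [chain_pt]
  exact s.swap.coeff_other h x

/-- The retraction onto chains of special cells. -/
noncomputable def ret : perm k G C ⟶ perm k G X := permRet k s.inj s.smul_ι

lemma chain_bdry : s.chain h ≫ h.bdry ≫ s.ret = permMap σ s.smul_σ - 𝟙 _ :=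
  perm_hom_ext fun x => by
    change s.ret.hom (h.bdry.hom ((s.chain h).hom (pt k G x))) =
      (permMap σ s.smul_σ).hom (pt k G x) - pt k G x
    rw [chain_pt, h.bdry_arrow, map_sub, permMap_pt, ret, permRet_apply, permRet_apply]

omit [MulAction G E] in
lemma incl_ret : permMap ι s.smul_ι ≫ s.ret = 𝟙 (perm k G X) := perm_hom_ext fun x => by
  change s.ret.hom ((permMap ι s.smul_ι).hom (pt k G x)) = pt k G x
  rw [permMap_pt, ret, permRet_apply]

omit [MulAction G E] in
include s in
lemma notMem_smul (g : G) (c : C) : (∀ x, ι x ≠ g • c) ↔ ∀ x, ι x ≠ c := by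
  constructor
  · intro h1 x hx
    exact h1 (g • x) (by rw [s.smul_ι, hx])
  · intro h1 x hx
    exact h1 (g⁻¹ • x) (by rw [s.smul_ι, hx, inv_smul_smul])

omit [MulAction G E] in
lemma ret_incl : s.ret ≫ permMap ι s.smul_ι =
    𝟙 (perm k G C) - permProj k (fun c => ∀ x, ι x ≠ c) s.notMem_smul := perm_hom_ext fun c => by
  change (permMap ι s.smul_ι).hom (s.ret.hom (pt k G c)) = pt k G c - (permProj k _ _).hom (pt k G c)
  by_cases hc : ∀ x, ι x ≠ c
  · rw [permProj_pos hc, ret, permRet_of_ne hc, map_zero, sub_self]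
  · rw [permProj_neg hc]
    push Not at hc
    obtain ⟨x, rfl⟩ := hc
    rw [ret, permRet_apply, permMap_pt, sub_zero]

/-- The pairs of adjacent cells that are not across a special facet. -/
def Ordinary (D : MorseData k C E) (ι : X → C) (σ τ : X → X) (p : C × C) : Prop :=
  D.adj p.1 p.2 ∧ (∀ x, (ι x, ι (σ x)) ≠ p) ∧ ∀ x, (ι x, ι (τ x)) ≠ p

include h s in
lemma ordinary_smul (g : G) (p : C × C) :
    Ordinary D ι σ τ (g • p) ↔ Ordinary D ι σ τ p := by
  have key : ∀ (g : G) (p : C × C), Ordinary D ι σ τ p → Ordinary D ι σ τ (g • p) :=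
    fun g p hp => ⟨h.adj_smul g _ _ hp.1, fun x hx => hp.2.1 (g⁻¹ • x) (by
      rw [s.smul_pair, hx, inv_smul_smul]), fun x hx => hp.2.2 (g⁻¹ • x) (by
      rw [s.swap.smul_pair, hx, inv_smul_smul])⟩
  exact ⟨fun hp => by simpa using key g⁻¹ _ hp, key g p⟩

lemma chain_coeff_special (x : X) : (s.chain h).hom ((s.coeff h).hom (h.arrow (s.adj_σ x))) =
    h.arrow (s.adj_σ x) + h.arrow (s.adj_σ x) := by
  rw [coeff_special, map_sub, chain_pt, chain_pt, sub_eq_add_neg]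
  congr 1
  rw [← h.arrow_symm]
  refine Subtype.ext ?_
  change pt k G (_, _) - pt k G (_, _) = pt k G (_, _) - pt k G (_, _)
  rw [s.σσ]

omit [MulAction G E] in
include s in
lemma not_ordinary_symm (x : X) : ¬ Ordinary D ι σ τ (ι (σ x), ι x) := fun hp =>
  hp.2.1 (σ x) (by rw [s.σσ])

omit [MulAction G E] in
lemma Ordinary.symm (s : Special D G ι σ τ) {c c' : C} (hp : Ordinary D ι σ τ (c, c')) :
    Ordinary D ι σ τ (c', c) := by
  refine ⟨D.adj_symm _ _ hp.1, fun x hx => ?_, fun x hx => ?_⟩ <;> rw [Prod.mk.injEq] at hx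
  · exact hp.2.1 (σ x) (by rw [s.σσ, hx.1, hx.2])
  · exact hp.2.2 (τ x) (by rw [s.ττ, hx.1, hx.2])

omit [MulAction G E] in
lemma Ordinary.swap {p : C × C} (hp : Ordinary D ι σ τ p) : Ordinary D ι τ σ p :=
  ⟨hp.1, hp.2.2, hp.2.1⟩

lemma permProj_arrow {c c' : C} (hcc : D.adj c c') (h1 : ¬ Ordinary D ι σ τ (c, c'))
    (h2 : ¬ Ordinary D ι σ τ (c', c)) :
    (permProj k (Ordinary D ι σ τ) (s.ordinary_smul h)).hom (h.incl₁.hom (h.arrow hcc)) = 0 := by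
  rw [h.incl₁_arrow, map_sub, permProj_neg h1, permProj_neg h2, sub_zero]

lemma coeff_chain (h3 : (3 : k) = 0) (h2 : (2 : k) ≠ 0) :
    s.coeff h ≫ s.chain h + s.swap.coeff h ≫ s.swap.chain h + 𝟙 _ =
      h.incl₁ ≫ permProj k (Ordinary D ι σ τ) (s.ordinary_smul h) ≫ h.anti :=
  h.rep₁_ext h2 fun {c c'} hcc => by
    have three : ∀ a : h.rep₁, a + a + a = 0 := fun a => by
      have : (3 : k) • a = a + a + a := by
        rw [show (3 : k) = 1 + 1 + 1 by norm_num, add_smul, add_smul, one_smul]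
      rw [← this, h3, zero_smul]
    change (s.chain h).hom ((s.coeff h).hom (h.arrow hcc)) +
      (s.swap.chain h).hom ((s.swap.coeff h).hom (h.arrow hcc)) + h.arrow hcc =
      h.anti.hom ((permProj k _ _).hom (h.incl₁.hom (h.arrow hcc)))
    by_cases h1 : ∀ x, (ι x, ι (σ x)) ≠ (c, c')
    · by_cases h1' : ∀ x, (ι x, ι (τ x)) ≠ (c, c')
      · have ho : Ordinary D ι σ τ (c, c') := ⟨hcc, h1, h1'⟩
        rw [s.coeff_ne h hcc h1, s.swap.coeff_ne h hcc h1', h.incl₁_arrow, map_sub, permProj_pos ho,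
          permProj_pos (ho.symm s), ← h.incl₁_arrow hcc, h.anti_arrow h2, map_zero, map_zero, zero_add,
          zero_add]
      · push Not at h1'
        obtain ⟨x, hx⟩ := h1'
        rw [Prod.mk.injEq] at hx
        obtain ⟨rfl, rfl⟩ := hx
        rw [s.coeff_other h x, s.swap.chain_coeff_special h x, s.permProj_arrow h hcc
          (fun hp => hp.2.2 x rfl) fun hp => s.swap.not_ordinary_symm x hp.swap, map_zero, map_zero,
          zero_add, three]
    · push Not at h1
      obtain ⟨x, hx⟩ := h1
      rw [Prod.mk.injEq] at hx
      obtain ⟨rfl, rfl⟩ := hx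
      rw [s.swap.coeff_other h x, s.chain_coeff_special h x, s.permProj_arrow h hcc
        (fun hp => hp.2.1 x rfl) (s.not_ordinary_symm x), map_zero, map_zero, add_zero, three]

variable (hfree : ∀ (g : G) (p : P), g • p = p → g = 1) (S₀ : C → Finset P) (S₁ : C × C → Finset P)
  (hS₀ : ∀ (g : G) c p, (∀ x, ι x ≠ c) → (g • p ∈ S₀ (g • c) ↔ p ∈ S₀ c))
  (hS₁ : ∀ (g : G) c p, Ordinary D ι σ τ c → (g • p ∈ S₁ (g • c) ↔ p ∈ S₁ c))
  (hc₀ : ∀ c, (∀ x, ι x ≠ c) → ((S₀ c).card : k) ≠ 0)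
  (hc₁ : ∀ c, Ordinary D ι σ τ c → ((S₁ c).card : k) ≠ 0)
include h s hfree hS₀ hS₁ hc₀ hc₁

theorem presented (h3 : (3 : k) = 0) (h2 : (2 : k) ≠ 0) {q : ℕ} (hq : 0 < q) :
    Presented (hm q (h.bdry' h2 ≫ kerIncl (MorseData.Equivariant.aug k G C))) (hm q s.ret)
      (hm q (s.chain h)) (hm q (s.swap.chain h)) (hm q (s.coeff h)) (hm q (s.swap.coeff h))
      (hm q (permMap σ s.smul_σ)) (hm q (permMap τ s.smul_τ)) := by
  have hd : h.bdry' h2 ≫ kerIncl (MorseData.Equivariant.aug k G C) = h.bdry := kerLift_incl _ _ _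
  have hproj : hm q (permProj k (fun c => ∀ x, ι x ≠ c) s.notMem_smul) = 0 := by
    have := hm_permProj s.notMem_smul hfree S₀ hS₀ hc₀ (𝟙 (perm k G C)) (𝟙 _) hq
    rwa [Category.id_comp, Category.comp_id] at this
  have hleft : hm q (permMap ι s.smul_ι) ∘ₗ hm q (s.ret (k := k)) = LinearMap.id := by
    rw [← hm_comp, s.ret_incl, hm_sub, hproj, sub_zero, hm_id]
  have hright : hm q (s.ret (k := k)) ∘ₗ hm q (permMap ι s.smul_ι) = LinearMap.id := by
    rw [← hm_comp, s.incl_ret, hm_id]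
  rw [hd]
  exact
  { bij := ⟨fun x y hxy => by
      have h1 := LinearMap.congr_fun hleft x
      have h2 := LinearMap.congr_fun hleft y
      rw [LinearMap.comp_apply] at h1 h2
      exact h1.symm.trans ((congrArg _ hxy).trans h2), fun y => ⟨_, LinearMap.congr_fun hright y⟩⟩
    as := by
      have h0 := hm_permProj (s.ordinary_smul h) hfree S₁ hS₁ hc₁ h.incl₁ h.anti hq
      rw [← s.coeff_chain h h3 h2, hm_add, hm_add, hm_comp, hm_comp, hm_id] at h0
      exact eq_neg_of_add_eq_zero_left h0
    sa₁₁ := by rw [← hm_comp, chain_coeff, hm_sub, hm_id]; rfl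
    sa₂₂ := by rw [← hm_comp, chain_coeff, hm_sub, hm_id]; rfl
    sa₁₂ := by rw [← hm_comp]; exact (congrArg _ (s.swap.chain_coeff_swap h)).trans (hm_zero _ _ _)
    sa₂₁ := by rw [← hm_comp, s.chain_coeff_swap h, hm_zero]
    pa₁ := by rw [← hm_comp, ← hm_comp, Category.assoc, s.chain_bdry, hm_sub, hm_id]; rfl
    pa₂ := by
      rw [← hm_comp, ← hm_comp, Category.assoc]
      exact (congrArg _ (s.swap.chain_bdry h)).trans (by rw [hm_sub, hm_id]; rfl) }

/-- The homology of a group acting on an acyclic complex with special cells. -/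
theorem finrank_homology (h3 : (3 : k) = 0) {V : Type} [MulAction G V] {p : V → X} {ρ : V → V}
    (ht : Triple G p ρ) {φσ φτ : V → V}
    (hφσ : ∀ (g : G) x, φσ (g • x) = g • φσ x) (hφτ : ∀ (g : G) x, φτ (g • x) = g • φτ x)
    (hpσ : ∀ v, p (φσ v) = σ (p v)) (hpτ : ∀ v, p (φτ v) = τ (p v))
    (hρσ : ∀ v, φσ (ρ v) = ρ (ρ (φσ v))) (hρτ : ∀ v, φτ (ρ v) = ρ (ρ (φτ v)))
    (l : X → Bool ⊕ Bool) (hl : Function.Surjective l)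
    (horb : ∀ x y, l x = l y ↔ ∃ g : G, g • x = y) (hlσ : ∀ x, l (σ x) = (l x).swap)
    (hlτ : ∀ x, l (τ x) = l x) (q : ℕ) (hq : 2 < q) :
    Module.finrank k (groupHomology (Rep.trivial k G k) q) =
      (if periodSign q = 1 then 2 else 0) + (if periodSign (q - 1) = 1 then 0 else 2) := by
  have h2 : (2 : k) ≠ 0 := fun h2 => one_ne_zero (α := k) (by
    have : (3 : k) = 2 + 1 := by norm_num
    rw [h3, h2, zero_add] at this
    exact this.symm)
  have := O13.finrank_homology (U := Bool →₀ k) h3 (h.ses_link h2)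
    (MorseData.Equivariant.ses_aug (G := G) D) (h.acyclic₂ h2)
    (fun q hq => presented h s hfree S₀ S₁ hS₀ hS₁ hc₀ hc₁ h3 h2 hq)
    (ht.exists_equiv h3 s.smul_σ s.smul_τ hφσ hφτ hpσ hpτ hρσ hρτ l hl horb hlσ hlτ) q hq
  rwa [Module.finrank_finsupp_self, Fintype.card_bool] at this

end Special
end Main
end O13

namespace O13
open Matrix

instance : NoZeroDivisors R13 where
  eq_zero_or_eq_zero_of_mul_eq_zero {a b} h := by
    have h := congrArg Zsqrtd.norm h
    rwa [Zsqrtd.norm_mul, Zsqrtd.norm_zero, mul_eq_zero, Zsqrtd.norm_eq_zero_iff (by decide),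
      Zsqrtd.norm_eq_zero_iff (by decide)] at h

instance : IsDomain R13 := NoZeroDivisors.to_isDomain _

lemma eq_of_sq_add {x t m : ℤ} (hx : 0 < x) (h : x ^ 2 * t ^ 2 + 52 * m ^ 2 = 4 * x ^ 2) :
    (t = 2 ∨ t = -2) ∧ m = 0 := by
  have h1 : t ^ 2 ≤ 4 := by nlinarith [sq_nonneg m, pow_pos hx 2]
  have h2 : t ≤ 2 := by nlinarith
  have h3 : -2 ≤ t := by nlinarith
  have irr : ∀ r : ℕ, ¬ IsSquare r → ∀ m : ℤ, r * m ^ 2 ≠ x ^ 2 := by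
    intro r hr m hm
    apply hr
    have hm0 : m ≠ 0 := by rintro rfl; nlinarith [pow_pos hx 2]
    have : IsSquare (r : ℚ) := ⟨x / m, by
      field_simp
      exact_mod_cast hm⟩
    exact_mod_cast (Rat.isSquare_natCast_iff.1 this)
  have h13 : ¬ IsSquare 13 := by decide +kernel
  have h39 : ¬ IsSquare 39 := by decide +kernel
  obtain rfl | rfl | rfl | rfl | rfl : t = -2 ∨ t = -1 ∨ t = 0 ∨ t = 1 ∨ t = 2 := by omega
  · exact ⟨Or.inr rfl, by nlinarith⟩
  · have : 3 * (x ^ 2) = 52 * m ^ 2 := by linarith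
    have h3 : (3 : ℤ) ∣ m := by
      have : (3 : ℤ) ∣ m ^ 2 := by omega
      exact Int.prime_three.dvd_of_dvd_pow this
    obtain ⟨m, rfl⟩ := h3
    exact absurd (by push_cast; linarith) (irr 39 h39 (2 * m))
  · exact absurd (by push_cast; linarith) (irr 13 h13 m)
  · have : 3 * (x ^ 2) = 52 * m ^ 2 := by linarith
    have h3 : (3 : ℤ) ∣ m := by
      have : (3 : ℤ) ∣ m ^ 2 := by omega
      exact Int.prime_three.dvd_of_dvd_pow this
    obtain ⟨m, rfl⟩ := h3
    exact absurd (by push_cast; linarith) (irr 39 h39 (2 * m))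
  · exact ⟨Or.inl rfl, by nlinarith⟩

/-- The stabilizer of a null vector is unipotent up to sign. -/
lemma fix_null (g : SLR) {v : Lat} (hv : IsNull v) (h : act (g : Mat) v = v) :
    ∃ ε : ℤ, (ε = 1 ∨ ε = -1) ∧ (g : Mat).trace = 2 * (ε : R13) ∧
      (g : Mat) * herm v = (ε : R13) • herm v := by
  have hs := sq_of_null hv.1
  have h0 := herm_act (g : Mat) v
  rw [h] at h0
  have hdet := g.det_coe
  generalize (g : Mat) = M at *
  obtain ⟨x, y₁, y₂, z⟩ := v
  replace hs : x * z = y₁ ^ 2 + 13 * y₂ ^ 2 := hs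
  have hx0 : 0 ≤ x := hv.2.1
  have hz0 : 0 ≤ z := hv.2.2.1
  have e := fun i j => congrFun (congrFun h0 i) j
  have e00 := e 0 0
  have e01 := e 0 1
  have e10 := e 1 0
  have e11 := e 1 1
  clear e
  obtain ⟨a, b, c, d, rfl⟩ : ∃ a b c d, M = !![a, b; c, d] := ⟨_, _, _, _, Matrix.eta_fin_two M⟩
  rw [det_fin_two_of] at hdet
  have hst : (⟨y₁, -y₂⟩ : R13) = star ⟨y₁, y₂⟩ := rfl
  have hx' : (⟨x, 0⟩ : R13) = (x : R13) := by ext <;> simp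
  have hz' : (⟨z, 0⟩ : R13) = (z : R13) := by ext <;> simp
  have hxz : (x : R13) * z = ⟨y₁, y₂⟩ * star (⟨y₁, y₂⟩ : R13) := by
    rw [← hst]; ext <;> simp <;> linarith
  simp only [herm, Matrix.mul_apply, Fin.sum_univ_two, conjTranspose_apply, of_apply, cons_val',
    cons_val_zero, cons_val_one, cons_val_fin_one, hst, hx', hz'] at e00 e01 e10 e11
  have close : ∀ ε : R13, a * x + b * star ⟨y₁, y₂⟩ = ε * x → a * ⟨y₁, y₂⟩ + b * z = ε * ⟨y₁, y₂⟩ →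
      c * x + d * star ⟨y₁, y₂⟩ = ε * star ⟨y₁, y₂⟩ → c * ⟨y₁, y₂⟩ + d * z = ε * z →
      !![a, b; c, d] * herm (x, y₁, y₂, z) = ε • herm (x, y₁, y₂, z) := by
    intro ε h1 h2 h3 h4
    ext1 i j
    fin_cases i <;> fin_cases j <;>
      simp only [herm, Matrix.mul_apply, Fin.sum_univ_two, of_apply, cons_val', cons_val_zero,
        cons_val_one, cons_val_fin_one, hst, hx', hz', Matrix.smul_apply, smul_eq_mul, Fin.zero_eta,
        Fin.mk_one] <;> assumption
  rw [trace_fin_two_of]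
  rcases hx0.eq_or_lt with rfl | hx
  · have e1 : y₁ = 0 := by nlinarith [sq_nonneg y₁, sq_nonneg y₂]
    have e2 : y₂ = 0 := by nlinarith [sq_nonneg y₁, sq_nonneg y₂]
    subst e1 e2
    have hz : 0 < z := by have := null_pos hv; simpa using this
    have hzne : (z : R13) ≠ 0 := by exact_mod_cast hz.ne'
    generalize hY : (⟨0, 0⟩ : R13) = Y at *
    obtain rfl : Y = 0 := hY.symm
    simp only [star_zero, mul_zero, zero_mul, add_zero, zero_add, Int.cast_zero] at *
    have hb : b = 0 := by
      by_contra hb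
      exact mul_ne_zero (mul_ne_zero hb hzne) (star_ne_zero.2 hb) e00.symm
    subst hb
    have hn : d * star d = 1 := mul_left_cancel₀ hzne (by linear_combination -e11)
    have hn' := congrArg Zsqrtd.re hn
    simp at hn'
    have him : d.im = 0 := by nlinarith [sq_nonneg d.im, sq_nonneg d.re]
    have hre : d.re = 1 ∨ d.re = -1 := by
      rw [him] at hn'
      exact mul_self_eq_one_iff.1 (by linarith)
    have hd : d = ((d.re : ℤ) : R13) := by ext <;> simp [him]
    have had : a = d := by
      have hdd : d * d = 1 := by
        rw [hd]; rcases hre with h | h <;> rw [h] <;> norm_num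
      linear_combination d * hdet - a * hdd
    refine ⟨d.re, hre, by rw [had, ← hd]; ring, close _ ?_ ?_ ?_ ?_⟩ <;> simp [← hd]
  · have hxne : (x : R13) ≠ 0 := by exact_mod_cast hx.ne'
    generalize hY : (⟨y₁, y₂⟩ : R13) = Y at *
    have hn1 : (a * x + b * star Y) * (star a * x + star b * Y) = x * x := by
      linear_combination (-(x : R13)) * e00 - b * star b * hxz
    have hn2 : star a * x + star b * Y = d * x - b * star Y := by
      linear_combination -d * e00 + b * e10 - (star a * x + star b * Y) * hdet
    have hn3 : (c * x + d * star Y) * (star a * x + star b * Y) = x * star Y := by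
      linear_combination (-(x : R13)) * e10 - d * star b * hxz
    have hsn : star a * x + star b * Y = star (a * x + b * star Y) := by
      simp [mul_comm]
    generalize hN : a * x + b * star Y = n at *
    rw [hsn] at hn1 hn2 hn3
    have ht : x * (a + d) = n + star n := by
      linear_combination hN - hn2
    have htr := congrArg Zsqrtd.re ht
    have hti := congrArg Zsqrtd.im ht
    have hnr := congrArg Zsqrtd.re hn1
    simp at htr hti hnr
    have hti : (a + d).im = 0 := by
      rcases hti with h | h
      · omega
      · simpa using h
    obtain ⟨h2, him⟩ := eq_of_sq_add (x := x) (t := a.re + d.re) (m := n.im) hx (by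
      rw [← mul_pow, htr]; linear_combination 4 * hnr)
    obtain ⟨ε, hε, hε'⟩ : ∃ ε : ℤ, (ε = 1 ∨ ε = -1) ∧ a.re + d.re = 2 * ε := by
      rcases h2 with h | h
      · exact ⟨1, Or.inl rfl, h⟩
      · exact ⟨-1, Or.inr rfl, h⟩
    have hεε : (ε : R13) * ε = 1 := by rcases hε with rfl | rfl <;> norm_num
    have hnx : n = ε * x := by
      rw [hε'] at htr
      ext
      · simp; linarith
      · simp [him]
    have hA : c * x + d * star Y = ε * star Y := by
      have : star n = ε * x := by rw [hnx]; simp [mul_comm]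
      rw [this] at hn3
      refine mul_left_cancel₀ hxne ?_
      linear_combination ε * hn3 - x * (c * x + d * star Y) * hεε
    refine ⟨ε, hε, by ext <;> simp [hε'] ; simpa using hti, close _ hnx ?_ hA ?_⟩
    · refine mul_left_cancel₀ hxne ?_
      linear_combination Y * hN + Y * hnx + b * hxz
    · refine mul_left_cancel₀ hxne ?_
      linear_combination Y * hA + (d - ε) * hxz

/-- The group acts freely on pairs of distinct cusps. -/
lemma eq_one_of_fix {a : Aut} (ha : a ∈ Gam) {u v : Lat} (hu : IsNull u) (hv : IsNull v)
    (huv : 0 < bil u v) (h1 : a u = u) (h2 : a v = v) : a = 1 := by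
  obtain ⟨g, rfl⟩ := ha
  obtain ⟨ε, hε, ht, he⟩ := fix_null g hu h1
  obtain ⟨ε', -, ht', he'⟩ := fix_null g hv h2
  have : ε' = ε := by
    rw [ht] at ht'
    have : (2 : ℤ) * ε = 2 * ε' := by exact_mod_cast ht'
    omega
  subst this
  have hsum : ((g : Mat) - (ε' : R13) • (1 : Mat)) * herm (u + v) = 0 := by
    rw [Matrix.sub_mul, herm_add, Matrix.mul_add, he, he', smul_mul, Matrix.one_mul, smul_add, sub_self]
  have hdet : (herm (u + v)).det = ((bil u v : ℤ) : R13) := by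
    have h1 := sq_of_null hu.1
    have h2 := sq_of_null hv.1
    rw [det_fin_two]
    ext <;> simp [herm, bil] <;> linarith
  have hg : (g : Mat) = (ε' : R13) • (1 : Mat) := by
    have := congrArg (· * (herm (u + v)).adjugate) hsum
    simp only [Matrix.zero_mul, Matrix.mul_assoc, mul_adjugate, hdet, Matrix.mul_smul,
      Matrix.mul_one] at this
    refine sub_eq_zero.1 ((smul_eq_zero.1 this).resolve_left ?_)
    exact_mod_cast huv.ne'
  refine LinearEquiv.ext fun w => ?_
  rw [actHom_apply, act, hg]
  rcases hε with rfl | rfl <;> simp [coords_herm]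

end O13

namespace O13
open Finsupp

/-- The action of `Γ` on an invariant set of pairs of lattice vectors. -/
abbrev subAction (p : Lat × Lat → Prop) (hp : ∀ a ∈ Gam, ∀ c, p c → p (pr a c)) :
    MulAction Gam {c // p c} where
  smul g c := ⟨pr g c.1, hp _ g.2 _ c.2⟩
  one_smul _ := rfl
  mul_smul _ _ _ := rfl

instance : MulAction Gam Cell := subAction _ fun _ ha _ hc => hc.pr (Gam_le_AA ha)

instance : MulAction Gam Edge := subAction _ fun a ha e he =>
  ⟨(edgeCond_pr_iff (Gam_le_AA ha)).2 he.1, by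
    obtain ⟨c, hc, h⟩ := he.2
    exact ⟨pr a c, hc.pr (Gam_le_AA ha), (On.pr_iff (Gam_le_AA ha) _ _).2 h⟩⟩

/-- Ordered pairs of distinct cusps. -/
abbrev CuspPair : Type := {p : Lat × Lat // IsNull p.1 ∧ IsNull p.2 ∧ 0 < bil p.1 p.2}

instance : MulAction Gam CuspPair := subAction _ fun _ ha _ hp =>
  ⟨null_AA (Gam_le_AA ha) hp.1, null_AA (Gam_le_AA ha) hp.2.1,
    hp.2.2.trans_eq (bil_AA (Gam_le_AA ha) _ _).symm⟩

lemma cell_smul_val (g : Gam) (c : Cell) : (g • c).1 = pr g c.1 := rfl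
lemma edge_smul_val (g : Gam) (e : Edge) : (g • e).1 = pr g e.1 := rfl
lemma cuspPair_smul_val (g : Gam) (e : CuspPair) : (g • e).1 = pr g e.1 := rfl

lemma cuspPair_free (g : Gam) (p : CuspPair) (h : g • p = p) : g = 1 := by
  have h := congrArg Subtype.val h
  rw [cuspPair_smul_val, Prod.ext_iff] at h
  exact Subtype.ext (eq_one_of_fix g.2 p.2.1 p.2.2.1 p.2.2.2 h.1 h.2)

lemma sg_Gam (g : Gam) (e c c' : Lat × Lat) : sg (pr g e) (pr g c) (pr g c') = sg e c c' := by
  simp only [sg, pr, ← map_sub, vol_Gam g.2]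

lemma around_smul (g : Gam) (e : Edge) (p : Cell × Cell) : Around (g • e) (g • p) ↔ Around e p := by
  simp only [Around, edge_smul_val, Prod.smul_fst, Prod.smul_snd, cell_smul_val]
  rw [Adj.pr_iff (Gam_le_AA g.2), On.pr_iff (Gam_le_AA g.2), On.pr_iff (Gam_le_AA g.2)]

lemma equivariant (k : Type) [Field k] : (morse k).Equivariant Gam where
  adj_smul g _ _ h := Adj.pr h (Gam_le_AA g.2)
  S_smul g e := by
    change link k (g • e) = mapDomain (g • ·) (link k e)
    ext p
    rw [mapDomain_smul_apply, link_apply, link_apply]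
    have h := around_smul g e (g⁻¹ • p)
    rw [smul_inv_smul] at h
    by_cases h' : Around e (g⁻¹ • p)
    · rw [if_pos h', if_pos (h.2 h')]
      congr 1
      have := sg_Gam g e.1 (g⁻¹ • p).1.1 (g⁻¹ • p).2.1
      rw [← this]
      change sg _ p.1.1 p.2.1 = sg _ (g • g⁻¹ • p).1.1 (g • g⁻¹ • p).2.1
      rw [smul_inv_smul]
      rfl
    · rw [if_neg h', if_neg fun h2 => h' (h.1 h2)]
  flip_smul _ _ := rfl
  S_ne := link_ne_zero
  free g e h := by
    obtain ⟨h1, c, -, h2⟩ := e.2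
    have h := congrArg Subtype.val h
    rw [edge_smul_val, Prod.ext_iff] at h
    exact Subtype.ext (eq_one_of_fix g.2 h2.1.1 h2.2.1 h1.pos h.1 h.2)

end O13

namespace O13

/-- The cusp pairs of given products on the common boundary of two cells. -/
def diagonals (c c' : Lat × Lat) (β : List ℤ) : Set (Lat × Lat) :=
  {p | On p c ∧ On p c' ∧ bil p.1 p.2 ∈ β}

lemma diagonals_pr {a : Aut} (ha : a ∈ AA) (c c' : Lat × Lat) (β : List ℤ) (p : Lat × Lat) :
    pr a p ∈ diagonals (pr a c) (pr a c') β ↔ p ∈ diagonals c c' β := by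
  simp only [diagonals, Set.mem_ofPred_eq, On.pr_iff ha]
  simp only [pr, bil_AA ha]

lemma diagonals_pr_eq {a : Aut} (ha : a ∈ AA) (c c' : Lat × Lat) (β : List ℤ) :
    diagonals (pr a c) (pr a c') β = pr a '' diagonals c c' β := by
  ext p
  rw [Set.mem_image]
  constructor
  · intro h
    refine ⟨pr a⁻¹ p, ?_, pr_self_inv a p⟩
    rwa [← diagonals_pr ha, pr_self_inv]
  · rintro ⟨p, hp, rfl⟩
    rwa [diagonals_pr ha]

/-- The pairs of vertices of a facet with given products. -/
def facetDiagonals (i : Fin 3) (m : Lat) (β : List ℤ) : Finset (Lat × Lat) :=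
  ((verts i).toFinset ×ˢ (verts i).toFinset).filter fun p =>
    bil m p.1 = 0 ∧ bil m p.2 = 0 ∧ bil p.1 p.2 ∈ β

lemma diagonals_base (i : Fin 3) (β : List ℤ) :
    diagonals (base i) (base i) β = facetDiagonals i 0 β := by
  ext p
  simp only [diagonals, facetDiagonals, Set.mem_ofPred_eq, Finset.coe_filter, Finset.mem_product,
    List.mem_toFinset, On, Vs_iff, bil_zero_left, true_and]
  tauto

lemma diagonals_nbc (i : Fin 3) (j : Fin (nf i)) (β : List ℤ) :
    diagonals (base i) (nbc i j) β = facetDiagonals i (nr i j) β := by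
  ext p
  simp only [diagonals, facetDiagonals, Set.mem_ofPred_eq, Finset.coe_filter, Finset.mem_product,
    List.mem_toFinset, On, Vs_iff]
  constructor
  · rintro ⟨⟨h1, h2⟩, ⟨h3, h4⟩, h5⟩
    exact ⟨⟨h1, h2⟩, (facet_iff i j _ h1).1 h3, (facet_iff i j _ h2).1 h4, h5⟩
  · rintro ⟨⟨h1, h2⟩, h3, h4, h5⟩
    exact ⟨⟨h1, h2⟩, ⟨(facet_iff i j _ h1).2 h3, (facet_iff i j _ h2).2 h4⟩, h5⟩

lemma card_cell_diagonals : (facetDiagonals 1 0 [11]).card = 4 ∧ (facetDiagonals 2 0 [11]).card = 16 := by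
  decide +kernel

lemma card_facet_diagonals : ∀ i, ∀ j : Fin (nf i),
    (i = 0 ∧ (nbc i j = nbc 0 (0 : Fin 8) ∨ nbc i j = nbc 0 (7 : Fin 8))) ∨
      (facetDiagonals i (nr i j) [4, 8, 9]).card = 2 ∨
      (facetDiagonals i (nr i j) [4, 8, 9]).card = 4 := by
  decide +kernel

lemma finite_diagonals {c c' : Lat × Lat} (hc : IsCell c) (β : List ℤ) :
    (diagonals c c' β).Finite := by
  obtain ⟨a, ha, i, rfl⟩ := hc
  have h : (diagonals (pr a (base i)) (pr a (base i)) β).Finite := by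
    rw [diagonals_pr_eq ha, diagonals_base]
    exact (Finset.finite_toSet _).image _
  have hv : {v | Vs (pr a (base i)) v}.Finite := by
    refine ((verts i).finite_toSet.image a).subset fun v hv => ?_
    exact ⟨a⁻¹ v, (Vs_iff i _).1 ((Vs_pr' ha _ _).1 hv), apply_inv_self a v⟩
  exact (hv.prod hv).subset fun p hp => ⟨hp.1.1, hp.1.2⟩

/-- The diagonals as a finite set of cusp pairs. -/
noncomputable def label (c c' : Cell) (β : List ℤ) : Finset CuspPair :=
  (((finite_diagonals (c' := c'.1) c.2 β).preimage
    (f := (Subtype.val : CuspPair → Lat × Lat)) Subtype.val_injective.injOn)).toFinset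

lemma mem_label {c c' : Cell} {β : List ℤ} {p : CuspPair} :
    p ∈ label c c' β ↔ p.1 ∈ diagonals c.1 c'.1 β := by
  rw [label, Set.Finite.mem_toFinset, Set.mem_preimage]

lemma smul_mem_label (g : Gam) (c c' : Cell) (β : List ℤ) (p : CuspPair) :
    g • p ∈ label (g • c) (g • c') β ↔ p ∈ label c c' β := by
  rw [mem_label, mem_label]
  exact diagonals_pr (Gam_le_AA g.2) _ _ _ _

lemma card_label (c c' : Cell) {β : List ℤ} (hβ : ∀ n ∈ β, 0 < n) :
    (label c c' β).card = (diagonals c.1 c'.1 β).ncard := by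
  rw [← Set.ncard_coe_finset, ← Set.ncard_image_of_injective _ Subtype.val_injective]
  congr 1
  ext p
  simp only [Set.mem_image, Finset.mem_coe, mem_label]
  constructor
  · rintro ⟨p, hp, rfl⟩
    exact hp
  · intro hp
    exact ⟨⟨p, hp.1.1.1, hp.1.2.1, hβ _ hp.2.2⟩, hp, rfl⟩

lemma ncard_diagonals_pr {a : Aut} (ha : a ∈ AA) (c c' : Lat × Lat) (β : List ℤ) :
    (diagonals (pr a c) (pr a c') β).ncard = (diagonals c c' β).ncard := by
  rw [diagonals_pr_eq ha, Set.ncard_image_of_injective _ (pr_injective a)]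

/-- The translates of the cupola. -/
def IsCupola (c : Lat × Lat) : Prop := ∃ a ∈ AA, c = pr a (base 0)

lemma IsCupola.isCell {c : Lat × Lat} (h : IsCupola c) : IsCell c := by
  obtain ⟨a, ha, h⟩ := h
  exact ⟨a, ha, 0, h⟩

lemma IsCupola.pr {c : Lat × Lat} (hc : IsCupola c) {a : Aut} (ha : a ∈ AA) :
    IsCupola (pr a c) := by
  obtain ⟨b, hb, rfl⟩ := hc
  exact ⟨a * b, AA.mul_mem ha hb, rfl⟩

abbrev Cupola : Type := {c // IsCupola c}

instance : MulAction Gam Cupola := subAction _ fun _ ha _ hc => hc.pr (Gam_le_AA ha)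

/-- The reflection of the cutting data across the triangular face. -/
def sig (c : Lat × Lat) : Lat × Lat :=
  ((25 : ℤ) • c.1 - (468 : ℤ) • c.2,
    (4 : ℤ) • ((c.1.1 / 3, c.1.2.1 / 3, c.1.2.2.1 / 3, c.1.2.2.2 / 3) : Lat) - (25 : ℤ) • c.2)

/-- The other half of the cuboctahedron. -/
def tau (c : Lat × Lat) : Lat × Lat := (c.1, -c.2)

lemma sig_three (u m : Lat) : sig ((3 : ℤ) • u, m) =
    ((75 : ℤ) • u - (468 : ℤ) • m, (4 : ℤ) • u - (25 : ℤ) • m) := by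
  simp only [sig, Prod.smul_fst, Prod.smul_snd, smul_eq_mul]
  simp only [Int.mul_ediv_cancel_left _ (show (3 : ℤ) ≠ 0 by decide), smul_smul]
  rfl

lemma sig_pr (a : Aut) (u m : Lat) : sig (pr a ((3 : ℤ) • u, m)) = pr a (sig ((3 : ℤ) • u, m)) := by
  simp only [pr, sig_three, map_sub, map_zsmul]

lemma IsCupola.three {c : Lat × Lat} (hc : IsCupola c) : ∃ u, c.1 = (3 : ℤ) • u := by
  obtain ⟨a, -, rfl⟩ := hc
  exact ⟨a (26, 13, 6, 26), by rw [← map_zsmul]; rfl⟩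

lemma sig_pr_cupola (a : Aut) {c : Lat × Lat} (hc : IsCupola c) : sig (O13.pr a c) = O13.pr a (sig c) := by
  obtain ⟨u, hu⟩ := hc.three
  obtain ⟨q, m⟩ := c
  obtain rfl : q = (3 : ℤ) • u := hu
  exact sig_pr a u m

lemma tau_pr (a : Aut) (c : Lat × Lat) : tau (pr a c) = pr a (tau c) := by
  simp only [tau, pr, map_neg]

lemma isCupola_base : IsCupola (base 0) := ⟨1, AA.one_mem, rfl⟩

lemma sig_base : sig (base 0) = nbc 0 (0 : Fin 8) := by decide

lemma tau_base : tau (base 0) = nbc 0 (7 : Fin 8) := by decide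

lemma IsCupola.sig {c : Lat × Lat} (hc : IsCupola c) : IsCupola (sig c) := by
  obtain ⟨a, ha, rfl⟩ := hc
  rw [sig_pr_cupola a isCupola_base, sig_base]
  exact IsCupola.pr (nbc_translate 0 (0 : Fin 8)) ha

lemma IsCupola.tau {c : Lat × Lat} (hc : IsCupola c) : IsCupola (tau c) := by
  obtain ⟨a, ha, rfl⟩ := hc
  rw [tau_pr, tau_base]
  exact IsCupola.pr (nbc_translate 0 (7 : Fin 8)) ha

lemma IsCupola.sig_sig {c : Lat × Lat} (hc : IsCupola c) : O13.sig (O13.sig c) = c := by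
  obtain ⟨a, ha, rfl⟩ := hc
  rw [sig_pr_cupola a isCupola_base, sig_pr_cupola a isCupola_base.sig]
  exact congrArg _ (by decide)

namespace Cupola

def toCell (c : Cupola) : Cell := ⟨c.1, c.2.isCell⟩
def σ (c : Cupola) : Cupola := ⟨sig c.1, c.2.sig⟩
def τ (c : Cupola) : Cupola := ⟨tau c.1, c.2.tau⟩

lemma special (k : Type) [Field k] : Special (morse k) Gam toCell σ τ where
  inj _ _ h := Subtype.ext (congrArg (fun c : Cell => c.1) h)
  smul_ι _ _ := rfl
  smul_σ g x := Subtype.ext (sig_pr_cupola g x.2)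
  smul_τ g x := Subtype.ext (tau_pr g x.1)
  σσ x := Subtype.ext x.2.sig_sig
  ττ x := Subtype.ext (by
    change tau (tau x.1) = x.1
    simp [tau])
  ne x h := by
    have h := congrArg Subtype.val h
    change sig x.1 = tau x.1 at h
    obtain ⟨a, ha, hx⟩ := x.2
    rw [hx, sig_pr_cupola a isCupola_base, tau_pr] at h
    exact absurd (pr_injective a h) (by decide)
  adj_σ x := by
    change Adj x.1 (sig x.1)
    obtain ⟨a, ha, hx⟩ := x.2
    rw [hx, sig_pr_cupola a isCupola_base, sig_base]
    exact (adj_nbc 0 (0 : Fin 8)).pr ha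
  adj_τ x := by
    change Adj x.1 (tau x.1)
    obtain ⟨a, ha, hx⟩ := x.2
    rw [hx, tau_pr, tau_base]
    exact (adj_nbc 0 (7 : Fin 8)).pr ha

lemma card_label_ne_zero (c : Cell) (hc : ∀ x : Cupola, x.toCell ≠ c) :
    ((label c c [11]).card : ZMod 3) ≠ 0 := by
  obtain ⟨a, ha, i, h⟩ := c.2
  rw [card_label _ _ (by decide), h, ncard_diagonals_pr ha, diagonals_base, Set.ncard_coe_finset]
  fin_cases i
  · exact absurd (Subtype.ext h.symm) (hc ⟨_, a, ha, rfl⟩)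
  · exact (congrArg (fun n : ℕ => (n : ZMod 3)) card_cell_diagonals.1).trans_ne (by decide)
  · exact (congrArg (fun n : ℕ => (n : ZMod 3)) card_cell_diagonals.2).trans_ne (by decide)

lemma card_label_ne_zero_of_ordinary (p : Cell × Cell)
    (hp : Special.Ordinary (morse (ZMod 3)) toCell σ τ p) :
    ((label p.1 p.2 [4, 8, 9]).card : ZMod 3) ≠ 0 := by
  obtain ⟨⟨c, hc⟩, ⟨c', hc'⟩⟩ := p
  obtain ⟨h1, h2, h3⟩ := hp
  change Adj c c' at h1
  obtain ⟨a, ha, i, rfl⟩ := hc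
  obtain ⟨c', rfl⟩ := pr_surjective a c'
  rw [Adj.pr_iff ha, adj_base_iff ((isCell_pr_iff ha).1 hc')] at h1
  obtain ⟨j, rfl⟩ := h1
  rw [card_label _ _ (by decide)]
  simp only []
  rw [ncard_diagonals_pr ha, diagonals_nbc, Set.ncard_coe_finset]
  rcases card_facet_diagonals i j with ⟨rfl, h | h⟩ | h | h
  · refine absurd ?_ (h2 ⟨pr a (base 0), a, ha, rfl⟩)
    refine Prod.ext rfl (Subtype.ext ?_)
    exact (sig_pr_cupola a isCupola_base).trans (congrArg (pr a) (sig_base.trans h.symm))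
  · refine absurd ?_ (h3 ⟨pr a (base 0), a, ha, rfl⟩)
    refine Prod.ext rfl (Subtype.ext ?_)
    exact (tau_pr a (base 0)).trans (congrArg (pr a) (tau_base.trans h.symm))
  · exact (congrArg (fun n : ℕ => (n : ZMod 3)) h).trans_ne (by decide)
  · exact (congrArg (fun n : ℕ => (n : ZMod 3)) h).trans_ne (by decide)

end Cupola
end O13

namespace O13
open Matrix

lemma mem_Gam_conj {a : Aut} {g h : SLR} (H : ∀ v, a (act (g : Mat) v) = act (h : Mat) (a v)) :
    a * actHom g * a⁻¹ ∈ Gam := by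
  refine ⟨h, LinearEquiv.ext fun v => ?_⟩
  change act (h : Mat) v = a (act (g : Mat) (a⁻¹ v))
  rw [H, apply_inv_self]

lemma slm_eta (g : SLR) : ∃ a b c d h, g = slm a b c d h := by
  have h := g.det_coe
  rw [Matrix.det_fin_two] at h
  exact ⟨_, _, _, _, h, Subtype.ext (Matrix.eta_fin_two (g : Mat))⟩

lemma act_slm (a b c d : R13) (h) (v : Lat) : act (slm a b c d h : Mat) v =
    coords (!![a, b; c, d] * herm v * !![a, b; c, d]ᴴ) := rfl

lemma cA_conj (g : SLR) : cA * actHom g * cA⁻¹ ∈ Gam := by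
  obtain ⟨a, b, c, d, h, rfl⟩ := slm_eta g
  refine mem_Gam_conj (h := slm (star a) (star b) (star c) (star d) ?_) fun v => ?_
  · rw [← star_mul', ← star_mul', ← star_sub, h, star_one]
  · simp only [act_slm, cA_apply]
    ext <;> simp [coords, herm, Matrix.mul_apply, Fin.sum_univ_two] <;> ring

lemma dA_conj (g : SLR) : dA * actHom g * dA⁻¹ ∈ Gam := by
  obtain ⟨a, b, c, d, h, rfl⟩ := slm_eta g
  refine mem_Gam_conj (h := slm a (-b) (-c) d ?_) fun v => ?_
  · rw [← h]; ring
  · simp only [act_slm, dA_apply]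
    ext <;> simp [coords, herm, Matrix.mul_apply, Fin.sum_univ_two] <;> ring

lemma tA_conj (g : SLR) : tA * actHom g * tA⁻¹ ∈ Gam := by
  obtain ⟨a, b, c, d, h, rfl⟩ := slm_eta g
  refine mem_Gam_conj (h := slm
    (-6 * star d + ⟨1, 1⟩ * star b - 3 * ⟨1, -1⟩ * star c + 7 * star a)
    (3 * ⟨1, 1⟩ * star d - ⟨-6, 1⟩ * star b + 18 * star c - 3 * ⟨1, 1⟩ * star a)
    (-⟨1, -1⟩ * star d + 2 * star b - ⟨-6, -1⟩ * star c + ⟨1, -1⟩ * star a)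
    (7 * star d - ⟨1, 1⟩ * star b + 3 * ⟨1, -1⟩ * star c - 6 * star a) ?_) fun v => ?_
  · have h1 := congrArg Zsqrtd.re h
    have h2 := congrArg Zsqrtd.im h
    simp at h1 h2
    ext
    · simp; linear_combination h1
    · simp; linear_combination -h2
  · simp only [act_slm, tA_apply, rt]
    ext <;> simp [coords, herm, Matrix.mul_apply, Fin.sum_univ_two] <;> ring

lemma conj_mem_Gam {a : Aut} (ha : a ∈ AA) : ∀ γ ∈ Gam, a * γ * a⁻¹ ∈ Gam := by
  suffices h : (∀ γ ∈ Gam, a * γ * a⁻¹ ∈ Gam) ∧ ∀ γ ∈ Gam, a⁻¹ * γ * a ∈ Gam from h.1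
  refine AA_induction (p := fun a => (∀ γ ∈ Gam, a * γ * a⁻¹ ∈ Gam) ∧ ∀ γ ∈ Gam, a⁻¹ * γ * a ∈ Gam)
    ?_ ?_ ?_ ?_ ?_ ?_ ?_ ha
  · simp
  · rintro a b ⟨h1, h2⟩ ⟨h3, h4⟩
    constructor
    · intro γ hγ
      have := h1 _ (h3 γ hγ)
      simpa only [_root_.mul_inv_rev, mul_assoc] using this
    · intro γ hγ
      have := h4 _ (h2 γ hγ)
      simpa only [_root_.mul_inv_rev, mul_assoc] using this
  · rintro a ⟨h1, h2⟩
    exact ⟨by simpa using h2, by simpa using h1⟩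
  · intro g
    exact ⟨fun γ hγ => Gam.mul_mem (Gam.mul_mem (act_mem g) hγ) (Gam.inv_mem (act_mem g)),
      fun γ hγ => Gam.mul_mem (Gam.mul_mem (Gam.inv_mem (act_mem g)) hγ) (act_mem g)⟩
  · constructor <;> rintro _ ⟨g, rfl⟩ <;> exact cA_conj g
  · constructor <;> rintro _ ⟨g, rfl⟩ <;> exact dA_conj g
  · constructor <;> rintro _ ⟨g, rfl⟩ <;> exact tA_conj g

end O13

namespace O13
open Matrix

/-- The vertices of the triangular face opposite to the hexagon. -/
def Top (c : Lat × Lat) (u : Lat) : Prop := Vs c u ∧ bil c.2 u = 4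

instance (c : Lat × Lat) (u : Lat) : Decidable (Top c u) := by unfold Top; infer_instance

lemma Top.pr_iff {a : Aut} (ha : a ∈ AA) {c : Lat × Lat} {u : Lat} :
    Top (pr a c) (a u) ↔ Top c u := by
  simp only [Top, Vs_pr ha]
  simp only [pr, bil_AA ha]

def topVerts : List Lat := [(0, 0, 0, 1), (1, 0, 0, 0), (1, 1, 0, 1)]

lemma top_base_iff {u : Lat} : Top (base 0) u ↔ u ∈ topVerts := by
  rw [Top, Vs_iff]
  have h : ∀ u ∈ verts 0, bil (base 0).2 u = 4 ↔ u ∈ topVerts := by decide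
  have h' : ∀ u ∈ topVerts, u ∈ verts 0 := by decide
  exact ⟨fun H => (h u H.1).1 H.2, fun H => ⟨h' u H, (h u (h' u H)).2 H⟩⟩

lemma Top.exists {a : Aut} (ha : a ∈ AA) {u : Lat} (h : Top (pr a (base 0)) u) :
    ∃ x ∈ topVerts, u = a x :=
  ⟨a⁻¹ u, by rwa [← top_base_iff, ← Top.pr_iff ha, apply_inv_self], (apply_inv_self a u).symm⟩

lemma Top.sig {c : Lat × Lat} (hc : IsCupola c) {u : Lat} (h : Top c u) : Top (sig c) u := by
  obtain ⟨a, ha, rfl⟩ := hc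
  obtain ⟨x, hx, rfl⟩ := h.exists ha
  rw [sig_pr_cupola a isCupola_base, Top.pr_iff ha]
  have : ∀ x ∈ topVerts, Top (O13.sig (base 0)) x := by decide
  exact this x hx

lemma Top.tau {c : Lat × Lat} (hc : IsCupola c) {u : Lat} (h : Top c u) :
    Top (tau c) (u + (4 : ℤ) • c.2) := by
  obtain ⟨a, ha, rfl⟩ := hc
  obtain ⟨x, hx, rfl⟩ := h.exists ha
  have : ∀ x ∈ topVerts, Top (O13.tau (base 0)) (x + (4 : ℤ) • (base 0).2) := by decide
  have key : a x + (4 : ℤ) • (pr a (base 0)).2 = a (x + (4 : ℤ) • (base 0).2) := by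
    rw [map_add, map_zsmul]; rfl
  rw [tau_pr, key, Top.pr_iff ha]
  exact this x hx

/-- Oriented orderings of the triangular face of a cupola. -/
def IsFrame (v : (Lat × Lat) × Lat × Lat × Lat) : Prop :=
  IsCupola v.1 ∧ Top v.1 v.2.1 ∧ Top v.1 v.2.2.1 ∧ Top v.1 v.2.2.2 ∧
    0 < vol v.1.1 v.2.1 v.2.2.1 v.2.2.2

abbrev Frame : Type := {v // IsFrame v}

/-- The diagonal action on ordered faces. -/
def fr (a : Aut) (v : (Lat × Lat) × Lat × Lat × Lat) : (Lat × Lat) × Lat × Lat × Lat :=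
  (pr a v.1, a v.2.1, a v.2.2.1, a v.2.2.2)

lemma IsFrame.smul {a : Aut} (ha : a ∈ Gam) {v} (h : IsFrame v) : IsFrame (fr a v) := by
  obtain ⟨h0, h1, h2, h3, h4⟩ := h
  have hA := Gam_le_AA ha
  exact ⟨h0.pr hA, (Top.pr_iff hA).2 h1, (Top.pr_iff hA).2 h2, (Top.pr_iff hA).2 h3,
    h4.trans_eq (vol_Gam ha _ _ _ _).symm⟩

instance : MulAction Gam Frame where
  smul g v := ⟨fr g v.1, v.2.smul g.2⟩
  one_smul _ := rfl
  mul_smul _ _ _ := rfl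

/-- Coordinates of a frame on the standard cupola. -/
lemma IsFrame.exists {v : (Lat × Lat) × Lat × Lat × Lat} (h : IsFrame v) :
    ∃ a ∈ AA, ∃ e : ℤ, (e = 1 ∨ e = -1) ∧ (∀ u v w p, vol (a u) (a v) (a w) (a p) = e * vol u v w p) ∧
      ∃ x ∈ topVerts, ∃ y ∈ topVerts, ∃ z ∈ topVerts, 0 < e * vol (base 0).1 x y z ∧
        v = fr a (base 0, x, y, z) := by
  obtain ⟨c, u₁, u₂, u₃⟩ := v
  obtain ⟨⟨a, ha, rfl⟩, h1, h2, h3, h4⟩ := h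
  obtain ⟨e, he, hv⟩ := vol_AA ha
  obtain ⟨x, hx, rfl⟩ := h1.exists ha
  obtain ⟨y, hy, rfl⟩ := h2.exists ha
  obtain ⟨z, hz, rfl⟩ := h3.exists ha
  exact ⟨a, ha, e, he, hv, x, hx, y, hy, z, hz, h4.trans_eq (hv _ _ _ _), rfl⟩

lemma vol_cycle (q x y z : Lat) : vol q y z x = vol q x y z := by simp only [vol]; ring

lemma frame_distinct : ∀ x ∈ topVerts, ∀ y ∈ topVerts, ∀ z ∈ topVerts,
    vol (base 0).1 x y z ≠ 0 → x ≠ y := by decide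

set_option synthInstance.maxSize 100000 in
set_option synthInstance.maxHeartbeats 400000 in
lemma frame_unique : ∀ e ∈ [1, -1], ∀ x ∈ topVerts, ∀ y ∈ topVerts, ∀ z ∈ topVerts,
    0 < e * vol (base 0).1 x y z → ∀ x' ∈ topVerts, ∀ y' ∈ topVerts, ∀ z' ∈ topVerts,
    0 < e * vol (base 0).1 x' y' z' →
    (x', y', z') = (x, y, z) ∨ (x', y', z') = (y, z, x) ∨ (x', y', z') = (z, x, y) := by
  decide +kernel

set_option synthInstance.maxSize 100000 in
set_option synthInstance.maxHeartbeats 400000 in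
lemma frame_rotate : ∀ x ∈ topVerts, ∀ y ∈ topVerts, ∀ z ∈ topVerts,
    vol (base 0).1 x y z ≠ 0 → ∃ r ∈ Gam, fr r (base 0, x, y, z) = (base 0, y, z, x) := by
  have h : ∀ x ∈ topVerts, ∀ y ∈ topVerts, ∀ z ∈ topVerts, vol (base 0).1 x y z ≠ 0 →
      fr (actHom (slm 1 (-1) 1 0 (by decide))) (base 0, x, y, z) = (base 0, y, z, x) ∨
      fr (actHom (slm 0 (-1) 1 (-1) (by decide))) (base 0, x, y, z) = (base 0, y, z, x) := by
    decide +kernel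
  intro x hx y hy z hz hv
  rcases h x hx y hy z hz hv with h | h
  · exact ⟨_, act_mem _, h⟩
  · exact ⟨_, act_mem _, h⟩

namespace Frame

def proj (v : Frame) : Cupola := ⟨v.1.1, v.2.1⟩

def rot (v : Frame) : Frame := ⟨(v.1.1, v.1.2.2.1, v.1.2.2.2, v.1.2.1),
  v.2.1, v.2.2.2.1, v.2.2.2.2.1, v.2.2.1, by
    have := v.2.2.2.2.2
    rwa [← vol_cycle] at this⟩

lemma sig_isFrame {v} (h : IsFrame v) : IsFrame (sig v.1, v.2.1, v.2.2.2, v.2.2.1) := by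
  refine ⟨h.1.sig, h.2.1.sig h.1, h.2.2.2.1.sig h.1, h.2.2.1.sig h.1, ?_⟩
  obtain ⟨a, ha, e, he, hv, x, hx, y, hy, z, hz, hxyz, rfl⟩ := h.exists
  have hsig : (sig (pr a (base 0))).1 = a (sig (base 0)).1 := by
    rw [sig_pr_cupola a isCupola_base]; rfl
  simp only [fr, hsig, hv]
  have key : ∀ x ∈ topVerts, ∀ y ∈ topVerts, ∀ z ∈ topVerts,
      vol (sig (base 0)).1 x z y = vol (base 0).1 x y z := by decide
  rwa [key x hx y hy z hz]

lemma tau_isFrame {v} (h : IsFrame v) : IsFrame (tau v.1, v.2.1 + (4 : ℤ) • v.1.2,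
    v.2.2.2 + (4 : ℤ) • v.1.2, v.2.2.1 + (4 : ℤ) • v.1.2) := by
  refine ⟨h.1.tau, h.2.1.tau h.1, h.2.2.2.1.tau h.1, h.2.2.1.tau h.1, ?_⟩
  obtain ⟨a, ha, e, he, hv, x, hx, y, hy, z, hz, hxyz, rfl⟩ := h.exists
  have hs : ∀ x, a x + (4 : ℤ) • (pr a (base 0)).2 = a (x + (4 : ℤ) • (base 0).2) := fun x => by
    rw [map_add, map_zsmul]; rfl
  have ht : (tau (pr a (base 0))).1 = a (tau (base 0)).1 := rfl
  simp only [fr, hs, ht, hv]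
  have key : ∀ x ∈ topVerts, ∀ y ∈ topVerts, ∀ z ∈ topVerts,
      vol (tau (base 0)).1 (x + (4 : ℤ) • (base 0).2) (z + (4 : ℤ) • (base 0).2)
        (y + (4 : ℤ) • (base 0).2) = vol (base 0).1 x y z := by decide
  rwa [key x hx y hy z hz]

def liftσ (v : Frame) : Frame := ⟨_, sig_isFrame v.2⟩
def liftτ (v : Frame) : Frame := ⟨_, tau_isFrame v.2⟩

lemma smul_liftσ (g : Gam) (v : Frame) : liftσ (g • v) = g • liftσ v := by
  refine Subtype.ext (Prod.ext ?_ rfl)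
  exact sig_pr_cupola g v.2.1

lemma smul_liftτ (g : Gam) (v : Frame) : liftτ (g • v) = g • liftτ v := by
  have hs : ∀ x m : Lat, (g : Aut) x + (4 : ℤ) • (g : Aut) m = (g : Aut) (x + (4 : ℤ) • m) :=
    fun x m => by rw [map_add, map_zsmul]
  refine Subtype.ext (Prod.ext (tau_pr g v.1.1) ?_)
  exact Prod.ext (hs _ _) (Prod.ext (hs _ _) (hs _ _))

lemma bil_top : ∀ x ∈ topVerts, ∀ y ∈ topVerts, x ≠ y → 0 < bil x y := by decide

lemma exists_frame : ∀ e ∈ [1, -1], ∃ x ∈ topVerts, ∃ y ∈ topVerts, ∃ z ∈ topVerts,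
    0 < e * vol (base 0).1 x y z := by decide

lemma triple : Triple Gam proj rot where
  smul_p _ _ := rfl
  smul_ρ _ _ := rfl
  surj c := by
    obtain ⟨c, a, ha, rfl⟩ := c
    obtain ⟨e, he, hv⟩ := vol_AA ha
    obtain ⟨x, hx, y, hy, z, hz, h⟩ := exists_frame e (by simpa using he)
    refine ⟨⟨fr a (base 0, x, y, z), ⟨a, ha, rfl⟩, (Top.pr_iff ha).2 (top_base_iff.2 hx),
      (Top.pr_iff ha).2 (top_base_iff.2 hy), (Top.pr_iff ha).2 (top_base_iff.2 hz), ?_⟩, rfl⟩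
    exact h.trans_eq (hv _ _ _ _).symm
  p_ρ _ := rfl
  cube _ := rfl
  ne v h := by
    obtain ⟨a, ha, e, he, hv, x, hx, y, hy, z, hz, hxyz, hva⟩ := v.2.exists
    have h := congrArg (fun v : Frame => v.1.2.1) h
    change v.1.2.2.1 = v.1.2.1 at h
    rw [hva] at h
    refine frame_distinct x hx y hy z hz ?_ (a.injective h).symm
    rintro h0
    rw [h0, mul_zero] at hxyz
    exact hxyz.false
  fibre v w h := by
    obtain ⟨a, ha, e, he, hv, x, hx, y, hy, z, hz, hxyz, hva⟩ := v.2.exists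
    have hw := w.2
    have hc : w.1.1 = pr a (base 0) :=
      (congrArg (fun c : Cupola => c.1) h).symm.trans (congrArg Prod.fst hva)
    obtain ⟨w, hw'⟩ := w
    obtain ⟨c, u₁, u₂, u₃⟩ := w
    subst hc
    obtain ⟨-, h1, h2, h3, h4⟩ := hw
    obtain ⟨x', hx', rfl⟩ := h1.exists ha
    obtain ⟨y', hy', rfl⟩ := h2.exists ha
    obtain ⟨z', hz', rfl⟩ := h3.exists ha
    have := frame_unique e (by simpa using he) x hx y hy z hz hxyz x' hx' y' hy' z' hz'
      (h4.trans_eq (hv _ _ _ _))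
    obtain ⟨v, hv'⟩ := v
    obtain rfl : v = _ := hva
    simp only [Prod.mk.injEq] at this
    rcases this with ⟨rfl, rfl, rfl⟩ | ⟨rfl, rfl, rfl⟩ | ⟨rfl, rfl, rfl⟩
    · exact Or.inl rfl
    · exact Or.inr (Or.inl rfl)
    · exact Or.inr (Or.inr rfl)
  free g v h := by
    obtain ⟨a, ha, e, he, hv, x, hx, y, hy, z, hz, hxyz, hva⟩ := v.2.exists
    have h1 := congrArg (fun v : Frame => v.1.2.1) h
    have h2 := congrArg (fun v : Frame => v.1.2.2.1) h
    change (g : Aut) v.1.2.1 = v.1.2.1 at h1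
    change (g : Aut) v.1.2.2.1 = v.1.2.2.1 at h2
    refine Subtype.ext (eq_one_of_fix g.2 v.2.2.1.1.1 v.2.2.2.1.1.1 ?_ h1 h2)
    rw [hva]
    refine (bil_top x hx y hy (frame_distinct x hx y hy z hz ?_)).trans_eq (bil_AA ha _ _).symm
    rintro h0
    rw [h0, mul_zero] at hxyz
    exact hxyz.false
  orbit v := by
    obtain ⟨a, ha, e, he, hv, x, hx, y, hy, z, hz, hxyz, hva⟩ := v.2.exists
    obtain ⟨r, hr, h⟩ := frame_rotate x hx y hy z hz (by
      rintro h0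
      rw [h0, mul_zero] at hxyz
      exact hxyz.false)
    refine ⟨⟨a * r * a⁻¹, conj_mem_Gam ha r hr⟩, Subtype.ext ?_⟩
    change fr (a * r * a⁻¹) v.1 = (v.1.1, v.1.2.2.1, v.1.2.2.2, v.1.2.1)
    have hinv : fr a⁻¹ v.1 = (base 0, x, y, z) := by
      rw [hva]
      exact Prod.ext (pr_inv_self a _) (Prod.ext (inv_apply_self a _)
        (Prod.ext (inv_apply_self a _) (inv_apply_self a _)))
    change fr a (fr r (fr a⁻¹ v.1)) = _
    rw [hinv, h, hva]
    rfl

end Frame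
end O13

namespace O13
open Matrix

/-- Representatives of the orbits of cupolas. -/
def rep : Bool ⊕ Bool → Aut
  | .inl true => 1
  | .inr true => cA
  | .inl false => tA
  | .inr false => cA * tA

lemma rep_mem : ∀ s, rep s ∈ AA
  | .inl true => AA.one_mem
  | .inr true => cA_mem
  | .inl false => tA_mem
  | .inr false => AA.mul_mem cA_mem tA_mem

lemma exists_rep_of (s : Bool ⊕ Bool) (a b c d : R13) (h : a * d - b * c = 1) {x : Lat × Lat}
    (hx : x = pr (actHom (slm a b c d h)) (pr (rep s) (base 0))) :
    ∃ s, ∃ γ ∈ Gam, x = pr γ (pr (rep s) (base 0)) :=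
  ⟨s, _, act_mem _, hx⟩

lemma exists_rep_step {x : Aut} (hx : x = cA ∨ x = dA ∨ x = tA) (s : Bool ⊕ Bool) :
    ∃ s', ∃ γ ∈ Gam, pr x (pr (rep s) (base 0)) = pr γ (pr (rep s') (base 0)) := by
  rcases hx with rfl | rfl | rfl <;> rcases s with (_ | _) | (_ | _)
  · exact exists_rep_of (.inr false) 1 0 0 1 (by decide) (by decide +kernel)
  · exact exists_rep_of (.inr true) 1 0 0 1 (by decide) (by decide +kernel)
  · exact exists_rep_of (.inl false) 1 0 0 1 (by decide) (by decide +kernel)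
  · exact exists_rep_of (.inl true) 1 0 0 1 (by decide) (by decide +kernel)
  · exact exists_rep_of (.inr false) 1 (-1) 0 1 (by decide) (by decide +kernel)
  · exact exists_rep_of (.inr true) 0 (-1) 1 0 (by decide) (by decide +kernel)
  · exact exists_rep_of (.inl false) 1 (-1) 0 1 (by decide) (by decide +kernel)
  · exact exists_rep_of (.inl true) 0 (-1) 1 0 (by decide) (by decide +kernel)
  · exact exists_rep_of (.inl true) 1 0 0 1 (by decide) (by decide +kernel)
  · exact exists_rep_of (.inl false) 1 0 0 1 (by decide) (by decide +kernel)
  · exact exists_rep_of (.inr true) ⟨-12, 1⟩ ⟨0, -6⟩ ⟨0, 2⟩ ⟨-12, -1⟩ (by decide) (by decide +kernel)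
  · exact exists_rep_of (.inr false) ⟨-12, 1⟩ ⟨0, -6⟩ ⟨0, 2⟩ ⟨-12, -1⟩ (by decide) (by decide +kernel)

/-- Moving elements of `Γ` past an element of `AA`. -/
lemma pr_comm {a γ : Aut} (ha : a ∈ AA) (hγ : γ ∈ Gam) (c : Lat × Lat) :
    ∃ γ' ∈ Gam, pr a (pr γ c) = pr γ' (pr a c) :=
  ⟨_, conj_mem_Gam ha γ hγ, by
    change _ = pr (a * γ) (pr a⁻¹ (pr a c))
    rw [pr_inv_self]; rfl⟩

lemma exists_rep {a : Aut} (ha : a ∈ AA) :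
    ∃ s, ∃ γ ∈ Gam, pr a (base 0) = pr γ (pr (rep s) (base 0)) := by
  have gen : ∀ x ∈ (Gam : Set Aut) ∪ {cA, dA, tA}, ∀ b ∈ AA,
      (∃ s, ∃ γ ∈ Gam, pr b (base 0) = pr γ (pr (rep s) (base 0))) →
      ∃ s, ∃ γ ∈ Gam, pr (x * b) (base 0) = pr γ (pr (rep s) (base 0)) := by
    rintro x hx b - ⟨s, γ, hγ, h⟩
    rw [pr_mul, h]
    rcases hx with hx | hx
    · exact ⟨s, x * γ, Gam.mul_mem hx hγ, rfl⟩
    · have hx' : x = cA ∨ x = dA ∨ x = tA := by simpa using hx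
      obtain ⟨γ', hγ', e⟩ := pr_comm (Subgroup.subset_closure (Or.inr hx)) hγ (pr (rep s) (base 0))
      obtain ⟨s', γ'', hγ'', e'⟩ := exists_rep_step hx' s
      exact ⟨s', γ' * γ'', Gam.mul_mem hγ' hγ'', by rw [e, e']; rfl⟩
  refine Subgroup.closure_induction_left
    (p := fun a _ => ∃ s, ∃ γ ∈ Gam, pr a (base 0) = pr γ (pr (rep s) (base 0))) ?_ ?_ ?_ ha
  · exact ⟨.inl true, 1, Gam.one_mem, rfl⟩
  · exact gen
  · intro x hx b hb h
    refine gen x⁻¹ ?_ b hb h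
    rcases hx with hx | hx
    · exact Or.inl (Gam.inv_mem hx)
    · right
      rcases hx with rfl | rfl | rfl
      · exact Or.inl rfl
      · exact Or.inr (Or.inl rfl)
      · exact Or.inr (Or.inr rfl)

/-- The form induced by a cupola vanishes modulo `13`. -/
lemma thirteen_dvd {c : Lat × Lat} (hc : IsCupola c) (v : Lat) : 13 ∣ bil c.1 v := by
  obtain ⟨a, ha, rfl⟩ := hc
  change 13 ∣ bil (a (base 0).1) v
  rw [bil_AA_inv ha]
  generalize a⁻¹ v = v
  exact ⟨6 * v.1 + 6 * v.2.2.2 - 6 * v.2.1 - 36 * v.2.2.1, by simp [bil, base]; ring⟩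

lemma act_mod {c : Lat × Lat} (hc : IsCupola c) {a : Aut} (ha : a ∈ Gam) :
    13 ∣ (a c.1).2.2.1 - c.1.2.2.1 := by
  obtain ⟨g, rfl⟩ := ha
  obtain ⟨a, b, c', d, h, rfl⟩ := slm_eta g
  have h1 := thirteen_dvd hc (1, 0, 0, 0)
  have h2 := thirteen_dvd hc (0, 1, 0, 0)
  have h3 := thirteen_dvd hc (0, 0, 0, 1)
  generalize c.1 = v at *
  obtain ⟨x, y, w, z⟩ := v
  simp [bil] at h1 h2 h3
  obtain ⟨x, rfl⟩ := h3
  obtain ⟨z, rfl⟩ := h1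
  obtain ⟨y, rfl⟩ : (13 : ℤ) ∣ y := by omega
  have hre := congrArg (fun r : R13 => (r.re : ZMod 13)) h
  have h13 : (13 : ZMod 13) = 0 := rfl
  refine (ZMod.intCast_zmod_eq_zero_iff_dvd _ 13).1 ?_
  rw [actHom_apply, act_slm]
  simp [h13] at hre
  simp [coords, herm, Matrix.mul_apply, Fin.sum_univ_two, h13]
  linear_combination (w : ZMod 13) * hre

/-- The cupolas in the first two orbits. -/
def Principal (c : Lat × Lat) : Prop := ∃ u, Top c u ∧ ∃ γ ∈ Gam, u = γ (1, 0, 0, 0)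

lemma Principal.pr {γ : Aut} (hγ : γ ∈ Gam) {c : Lat × Lat} (h : Principal c) :
    Principal (pr γ c) := by
  obtain ⟨u, hu, δ, hδ, rfl⟩ := h
  exact ⟨_, (Top.pr_iff (Gam_le_AA hγ)).2 hu, γ * δ, Gam.mul_mem hγ hδ, rfl⟩

noncomputable instance : DecidablePred Principal := fun _ => Classical.propDecidable _

/-- The orbit of a cupola. -/
noncomputable def orbitLabel (c : Lat × Lat) : Bool ⊕ Bool :=
  if 13 ∣ c.1.2.2.1 - 5 then .inl (decide (Principal c)) else .inr (decide (Principal c))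

lemma orbitLabel_pr {γ : Aut} (hγ : γ ∈ Gam) {c : Lat × Lat} (hc : IsCupola c) :
    orbitLabel (pr γ c) = orbitLabel c := by
  have h1 : Principal (pr γ c) ↔ Principal c := by
    refine ⟨fun h => ?_, Principal.pr hγ⟩
    have := h.pr (Gam.inv_mem hγ)
    rwa [pr_inv_self] at this
  have h2 : 13 ∣ (pr γ c).1.2.2.1 - 5 ↔ 13 ∣ c.1.2.2.1 - 5 := by
    have : 13 ∣ (pr γ c).1.2.2.1 - c.1.2.2.1 := act_mod hc hγ
    omega
  simp only [orbitLabel, h1, h2]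

lemma not_principal_of {c : Lat × Lat} (h : ∀ u, Top c u → u.1 % 4 = 3 ∨ u.2.2.2 % 4 = 3) :
    ¬ Principal c := by
  rintro ⟨u, hu, _, ⟨g, rfl⟩, rfl⟩
  obtain ⟨a, b, c', d, hdet, rfl⟩ := slm_eta g
  have key : ∀ r s : ℤ, (r * r + 13 * (s * s)) % 4 ≠ 3 := by
    intro r s
    have : ∀ r s : ZMod 4, r * r + 13 * (s * s) ≠ 3 := by decide
    intro h
    apply this r s
    have := (ZMod.intCast_eq_intCast_iff' _ 3 4).2 h
    exact_mod_cast this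
  have := h _ hu
  rw [actHom_apply, act_slm] at this
  simp [coords, herm, Matrix.mul_apply, Fin.sum_univ_two] at this
  rcases this with h | h
  · exact key a.re a.im (by convert h using 2; ring)
  · exact key c'.re c'.im (by convert h using 2; ring)

lemma orbitLabel_rep (s : Bool ⊕ Bool) : orbitLabel (pr (rep s) (base 0)) = s := by
  have hp : ∀ s', Sum.elim id id s' = true → Principal (pr (rep s') (base 0)) := by
    rintro ((_ | _) | (_ | _)) h
    · cases h
    · exact ⟨(1, 0, 0, 0), by decide, 1, Gam.one_mem, rfl⟩
    · cases h
    · exact ⟨(1, 0, 0, 0), by decide, 1, Gam.one_mem, rfl⟩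
  have hn : ∀ s', Sum.elim id id s' = false → ¬ Principal (pr (rep s') (base 0)) := by
    rintro ((_ | _) | (_ | _)) h
    · refine not_principal_of fun u hu => ?_
      obtain ⟨x, hx, rfl⟩ := hu.exists (rep_mem _)
      exact (by decide : ∀ x ∈ topVerts, (tA x).1 % 4 = 3 ∨ (tA x).2.2.2 % 4 = 3) x hx
    · cases h
    · refine not_principal_of fun u hu => ?_
      obtain ⟨x, hx, rfl⟩ := hu.exists (rep_mem _)
      exact (by decide : ∀ x ∈ topVerts, (tA x).1 % 4 = 3 ∨ (tA x).2.2.2 % 4 = 3) x hx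
    · cases h
  rw [orbitLabel]
  rcases s with (_ | _) | (_ | _)
  · rw [if_pos (by decide), decide_eq_false (hn (.inl false) rfl)]
  · rw [if_pos (by decide), decide_eq_true (hp (.inl true) rfl)]
  · rw [if_neg (by decide), decide_eq_false (hn (.inr false) rfl)]
  · rw [if_neg (by decide), decide_eq_true (hp (.inr true) rfl)]

lemma sig_rep (s : Bool ⊕ Bool) : ∃ γ ∈ Gam,
    sig (pr (rep s) (base 0)) = pr γ (pr (rep s.swap) (base 0)) := by
  rcases s with (_ | _) | (_ | _)
  · exact ⟨_, act_mem (slm ⟨-12, 1⟩ ⟨0, -6⟩ ⟨0, 2⟩ ⟨-12, -1⟩ (by decide)), by decide +kernel⟩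
  · exact ⟨1, Gam.one_mem, by decide +kernel⟩
  · exact ⟨_, act_mem (slm ⟨-12, -1⟩ ⟨0, 6⟩ ⟨0, -2⟩ ⟨-12, 1⟩ (by decide)), by decide +kernel⟩
  · exact ⟨1, Gam.one_mem, by decide +kernel⟩

lemma tau_rep (s : Bool ⊕ Bool) : ∃ γ ∈ Gam,
    tau (pr (rep s) (base 0)) = pr γ (pr (rep s) (base 0)) := by
  rw [tau_pr]
  have h : tau (base 0) =
      pr (actHom (slm ⟨-2, -1⟩ ⟨-2, 1⟩ ⟨-4, 0⟩ ⟨2, 1⟩ (by decide))) (base 0) := by decide +kernel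
  rw [h]
  exact pr_comm (rep_mem s) (act_mem _) _

namespace Cupola

noncomputable def orbit (c : Cupola) : Bool ⊕ Bool := orbitLabel c.1

def ofRep (s : Bool ⊕ Bool) : Cupola := ⟨pr (rep s) (base 0), rep s, rep_mem s, rfl⟩

lemma orbit_smul (g : Gam) (c : Cupola) : (g • c).orbit = c.orbit := orbitLabel_pr g.2 c.2

lemma orbit_ofRep (s : Bool ⊕ Bool) : (ofRep s).orbit = s := orbitLabel_rep s

lemma exists_smul_ofRep (c : Cupola) : ∃ g : Gam, c = g • ofRep c.orbit := by
  obtain ⟨c, a, ha, rfl⟩ := c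
  obtain ⟨s, γ, hγ, h⟩ := exists_rep ha
  have e : (⟨pr a (base 0), a, ha, rfl⟩ : Cupola) = (⟨γ, hγ⟩ : Gam) • ofRep s := Subtype.ext h
  exact ⟨⟨γ, hγ⟩, by rw [e, orbit_smul, orbit_ofRep]⟩

lemma orbit_eq_iff (x y : Cupola) : x.orbit = y.orbit ↔ ∃ g : Gam, g • x = y := by
  constructor
  · intro h
    obtain ⟨g, hg⟩ := exists_smul_ofRep x
    obtain ⟨g', hg'⟩ := exists_smul_ofRep y
    refine ⟨g' * g⁻¹, ?_⟩
    rw [mul_smul, inv_smul_eq_iff.2 hg, h, ← hg']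
  · rintro ⟨g, rfl⟩
    exact (orbit_smul g x).symm

lemma orbit_σ (x : Cupola) : x.σ.orbit = x.orbit.swap := by
  obtain ⟨g, hg⟩ := exists_smul_ofRep x
  generalize x.orbit = s at hg
  obtain ⟨γ, hγ, h⟩ := sig_rep s
  have e : (ofRep s).σ = (⟨γ, hγ⟩ : Gam) • ofRep s.swap := Subtype.ext h
  rw [hg, (special ℚ).smul_σ, orbit_smul, e, orbit_smul, orbit_ofRep]

lemma orbit_τ (x : Cupola) : x.τ.orbit = x.orbit := by
  obtain ⟨g, hg⟩ := exists_smul_ofRep x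
  generalize x.orbit = s at hg
  obtain ⟨γ, hγ, h⟩ := tau_rep s
  have e : (ofRep s).τ = (⟨γ, hγ⟩ : Gam) • ofRep s := Subtype.ext h
  rw [hg, (special ℚ).smul_τ, orbit_smul, e, orbit_smul, orbit_ofRep]

end Cupola

theorem finrank_groupHomology_Gam (q : ℕ) (hq : 2 < q) :
    Module.finrank (ZMod 3) (groupHomology (Rep.trivial (ZMod 3) Gam (ZMod 3)) q) =
      (if periodSign q = 1 then 2 else 0) + (if periodSign (q - 1) = 1 then 0 else 2) :=
  Special.finrank_homology (equivariant (ZMod 3)) (Cupola.special (ZMod 3)) cuspPair_free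
    (fun c => label c c [11]) (fun p => label p.1 p.2 [4, 8, 9])
    (fun g c p _ => smul_mem_label g c c _ p) (fun g c p _ => smul_mem_label g c.1 c.2 _ p)
    Cupola.card_label_ne_zero Cupola.card_label_ne_zero_of_ordinary (by decide) Frame.triple
    Frame.smul_liftσ Frame.smul_liftτ (fun _ => rfl) (fun _ => rfl) (fun _ => rfl) (fun _ => rfl)
    Cupola.orbit (fun s => ⟨_, Cupola.orbit_ofRep s⟩) Cupola.orbit_eq_iff Cupola.orbit_σ
    Cupola.orbit_τ q hq

end O13

namespace O13
open CategoryTheory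

section Bar
variable {k : Type} [CommRing k] {G G' : Type} [Group G] [Group G']

lemma inducedMap_comp_symm (e : G ≃* G') (n : ℕ) (x : GroupHomology k G k n) :
    inducedMap k k e.symm.toMonoidHom n (inducedMap k k e.toMonoidHom n x) = x := by
  obtain ⟨x, rfl⟩ := Submodule.Quotient.mk_surjective _ x
  refine congrArg _ (Subtype.ext ?_)
  change chainsMap k k e.symm.toMonoidHom n (chainsMap k k e.toMonoidHom n x.1) = x.1
  simp only [chainsMap, Finsupp.lmapDomain_apply, ← Finsupp.mapDomain_comp]
  have h : ((fun f : Fin n → G' => ⇑e.symm.toMonoidHom ∘ f) ∘ fun f => ⇑e.toMonoidHom ∘ f) = id := by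
    funext f
    funext i
    simp
  rw [h, Finsupp.mapDomain_id]

/-- Isomorphic groups have isomorphic homology. -/
noncomputable def barEquiv (e : G ≃* G') (n : ℕ) :
    GroupHomology k G k n ≃ₗ[k] GroupHomology k G' k n :=
  LinearEquiv.ofLinearMap (inducedMap k k e.toMonoidHom n) (inducedMap k k e.symm.toMonoidHom n)
    (LinearMap.ext fun x => inducedMap_comp_symm e.symm n x)
    (LinearMap.ext fun x => inducedMap_comp_symm e n x)

lemma d_trivial (n : ℕ) :
    (groupHomology.inhomogeneousChains.d (Rep.trivial k G k) n).hom = BarHomology.d k G k n := by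
  refine Finsupp.lhom_ext fun g a => ?_
  refine (groupHomology.inhomogeneousChains.d_single (A := Rep.trivial k G k) n g a).trans ?_
  simp [BarHomology.d]

/-- The comparison of the two descriptions of the bar complex. -/
lemma nonempty_groupHomology_equiv (n : ℕ) :
    Nonempty (groupHomology (Rep.trivial k G k) (n + 1) ≃ₗ[k] GroupHomology k G k (n + 1)) := by
  let C := groupHomology.inhomogeneousChains (Rep.trivial k G k)
  let S := C.sc' (n + 2) (n + 1) n
  have hg : S.g.hom = BarHomology.d k G k n := by
    rw [← d_trivial, ← groupHomology.inhomogeneousChains.d_def]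
    rfl
  have hf : S.f.hom = BarHomology.d k G k (n + 1) := by
    rw [← d_trivial, ← groupHomology.inhomogeneousChains.d_def]
    rfl
  have hker : LinearMap.ker S.g.hom = BarHomology.cycles k G k (n + 1) :=
    congrArg LinearMap.ker hg
  let E := ((C.homologyIsoSc' (n + 2) (n + 1) n (by simp) (by simp)).trans
    S.moduleCatHomologyIso).toLinearEquiv
  refine ⟨E.trans (Submodule.Quotient.equiv _ _ (LinearEquiv.ofEq _ _ hker) ?_)⟩
  ext x
  simp only [Submodule.mem_map, boundariesIn, Submodule.mem_comap, LinearMap.mem_range]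
  constructor
  · rintro ⟨_, ⟨y, rfl⟩, rfl⟩
    exact ⟨y, (LinearMap.congr_fun hf y).symm⟩
  · rintro ⟨y, hy⟩
    exact ⟨_, ⟨y, rfl⟩, Subtype.ext ((LinearMap.congr_fun hf y).trans hy)⟩

end Bar
end O13

namespace O13
open Polynomial

section Ring
variable {K : Type} [Field K] [NumberField K] {α : K}

lemma ratCast_ne_root (hα : α ^ 2 = -13) (r : ℚ) : (r : K) ≠ α := by
  rintro rfl
  have : r ^ 2 = -13 := by exact_mod_cast hα
  nlinarith [sq_nonneg r]

lemma exists_rat_coords (hdeg : Module.finrank ℚ K = 2) (hα : α ^ 2 = -13) (x : K) :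
    ∃ r s : ℚ, x = r + s * α := by
  have hli : LinearIndependent ℚ ![1, α] := by
    rw [LinearIndependent.pair_iff]
    intro r s h
    simp only [Rat.smul_def, mul_one] at h
    have hs : s = 0 := by
      by_contra hs
      refine ratCast_ne_root hα (-r / s) ?_
      have : (s : K) ≠ 0 := by exact_mod_cast hs
      push_cast
      field_simp
      linear_combination -h
    subst hs
    simpa using h
  have hx : x ∈ Submodule.span ℚ (Set.range ![1, α]) := by
    rw [hli.span_eq_top_of_card_eq_finrank (by simp [hdeg])]
    trivial
  simp only [Matrix.range_cons, Matrix.range_empty, Set.union_empty, Set.singleton_union,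
    Submodule.mem_span_pair, Rat.smul_def, mul_one] at hx
  obtain ⟨r, s, h⟩ := hx
  exact ⟨r, s, h.symm⟩

lemma exists_int_of_sq {s : ℚ} {k : ℤ} (h : s ^ 2 = k) : ∃ l : ℤ, (l : ℚ) = s := by
  obtain ⟨l, hl⟩ := IsIntegrallyClosed.exists_algebraMap_eq_of_isIntegral_pow (R := ℤ) (x := s)
    two_pos (h ▸ isIntegral_algebraMap (x := k))
  exact ⟨l, by simpa using hl⟩

lemma int_of_trace_norm {r s : ℚ} {m n : ℤ} (hm : 2 * r = m) (hn : r ^ 2 + 13 * s ^ 2 = n) :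
    ∃ a b : ℤ, (a : ℚ) = r ∧ (b : ℚ) = s := by
  obtain ⟨k, hk⟩ := exists_int_of_sq (s := 26 * s) (k := 13 * (4 * n - m ^ 2)) (by
    push_cast
    rw [← hm, ← hn]
    ring)
  have hk2 : k ^ 2 = 13 * (4 * n - m ^ 2) := by
    have : ((k : ℚ)) ^ 2 = 13 * (4 * n - m ^ 2) := by
      rw [hk, ← hm, ← hn]
      ring
    exact_mod_cast this
  obtain ⟨l, rfl⟩ : (13 : ℤ) ∣ k :=
    Int.Prime.dvd_pow' (p := 13) (by norm_num) ⟨_, hk2⟩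
  have h4 : m ^ 2 + 13 * l ^ 2 = 4 * n := by linarith
  have hpar : m % 2 = 0 ∧ l % 2 = 0 := by
    have h' : (m % 4) ^ 2 % 4 = m ^ 2 % 4 := by simp [pow_two, Int.mul_emod]
    have h'' : (l % 4) ^ 2 % 4 = l ^ 2 % 4 := by simp [pow_two, Int.mul_emod]
    have hm4 : m % 4 = 0 ∨ m % 4 = 1 ∨ m % 4 = 2 ∨ m % 4 = 3 := by omega
    have hl4 : l % 4 = 0 ∨ l % 4 = 1 ∨ l % 4 = 2 ∨ l % 4 = 3 := by omega
    rcases hm4 with h | h | h | h <;> rcases hl4 with hl | hl | hl | hl <;>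
      rw [h] at h' <;> rw [hl] at h'' <;> norm_num at h' h'' <;> omega
  refine ⟨m / 2, l / 2, ?_, ?_⟩
  · have : (m : ℚ) = 2 * ((m / 2 : ℤ) : ℚ) := by exact_mod_cast (by omega : m = 2 * (m / 2))
    linarith
  · have : (l : ℚ) = 2 * ((l / 2 : ℤ) : ℚ) := by exact_mod_cast (by omega : l = 2 * (l / 2))
    push_cast at hk
    linarith

lemma exists_int_coords (hdeg : Module.finrank ℚ K = 2) (hα : α ^ 2 = -13) {x : K}
    (hx : IsIntegral ℤ x) : ∃ a b : ℤ, x = a + b * α := by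
  obtain ⟨r, s, rfl⟩ := exists_rat_coords hdeg hα x
  by_cases hs : s = 0
  · subst hs
    have hr : IsIntegral ℤ r := by
      have : IsIntegral ℤ (algebraMap ℚ K r) := by simpa using hx
      exact (isIntegral_algebraMap_iff (algebraMap ℚ K).injective).1 this
    obtain ⟨a, ha⟩ := IsIntegrallyClosed.isIntegral_iff.1 hr
    exact ⟨a, 0, by simp [← ha]⟩
  set x : K := r + s * α with hxd
  let P : ℚ[X] := X ^ 2 + C (-(2 * r)) * X + C (r ^ 2 + 13 * s ^ 2)
  have hPm : P.Monic := by
    simp only [P]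
    monicity!
  have hPd : P.natDegree = 2 := by
    simp only [P]
    compute_degree!
  have hP : aeval x P = 0 := by
    simp only [P, map_add, map_mul, map_pow, aeval_X, aeval_C, eq_ratCast, hxd]
    push_cast
    linear_combination (s : K) ^ 2 * hα
  have hxQ : IsIntegral ℚ x := hx.tower_top
  have h2 : 2 ≤ (minpoly ℚ x).natDegree := by
    rw [minpoly.two_le_natDegree_iff hxQ]
    rintro ⟨t, ht⟩
    refine ratCast_ne_root hα ((t - r) / s) ?_
    have hs' : (s : K) ≠ 0 := by exact_mod_cast hs
    simp only [eq_ratCast] at ht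
    push_cast
    field_simp
    rw [ht, hxd]
    ring
  have hmin : P = minpoly ℚ x :=
    eq_of_monic_of_dvd_of_natDegree_le (minpoly.monic hxQ) hPm (minpoly.dvd ℚ x hP)
      (by rw [hPd]; exact h2)
  have hco : P = (minpoly ℤ x).map (algebraMap ℤ ℚ) :=
    hmin.trans (minpoly.isIntegrallyClosed_eq_field_fractions' ℚ hx)
  have h1 := congrArg (fun p => coeff p 1) hco
  have h0 := congrArg (fun p => coeff p 0) hco
  simp only [P, coeff_map, coeff_add, coeff_X_pow, coeff_C_mul, coeff_X, coeff_C] at h0 h1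
  norm_num at h0 h1
  obtain ⟨a, b, rfl, rfl⟩ := int_of_trace_norm (r := r) (s := s)
    (m := -(minpoly ℤ x).coeff 1) (n := (minpoly ℤ x).coeff 0)
    (by push_cast; linarith) (by linarith)
  exact ⟨a, b, by simp [hxd]⟩

/-- The ring of integers of `ℚ(√-13)` is `ℤ[√-13]`. -/
lemma nonempty_ringEquiv (hdeg : Module.finrank ℚ K = 2) (hα : α ^ 2 = -13) :
    Nonempty (R13 ≃+* NumberField.RingOfIntegers K) := by
  have hα_int : IsIntegral ℤ α := by
    refine ⟨X ^ 2 + C 13, by monicity!, ?_⟩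
    simp [hα]
  let β : NumberField.RingOfIntegers K := ⟨α, hα_int⟩
  have hβ : β * β = ((-13 : ℤ) : NumberField.RingOfIntegers K) := by
    apply NumberField.RingOfIntegers.ext
    have : α * α = -13 := by rw [← hα, sq]
    have h : ((-13 : ℤ) : K) = -13 := by push_cast; rfl
    exact this.trans (h.symm.trans (map_intCast (algebraMap (NumberField.RingOfIntegers K) K) (-13)).symm)
  refine ⟨RingEquiv.ofBijective (Zsqrtd.lift ⟨β, hβ⟩) ⟨?_, ?_⟩⟩
  · refine Zsqrtd.lift_injective _ fun n h => ?_
    nlinarith [mul_self_nonneg n]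
  · intro y
    obtain ⟨a, b, h⟩ := exists_int_coords hdeg hα y.2
    refine ⟨⟨a, b⟩, NumberField.RingOfIntegers.ext ?_⟩
    rw [Zsqrtd.lift_apply_apply]
    simp only [map_add, map_mul, map_intCast]
    exact h.symm

end Ring

section PSL

lemma scalar_mem_ker {g : SLR} {ε : R13} (hε : ε ^ 2 = 1)
    (hg : Matrix.scalar (Fin 2) ε = (g : Mat)) : actHom g = 1 := by
  have : ε = 1 ∨ ε = -1 := by
    have h : (ε - 1) * (ε + 1) = 0 := by linear_combination hε
    rcases mul_eq_zero.1 h with h | h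
    · exact Or.inl (sub_eq_zero.1 h)
    · exact Or.inr (eq_neg_of_add_eq_zero_left h)
  refine LinearEquiv.ext fun w => ?_
  rw [actHom_apply, act, ← hg, Matrix.scalar_apply, ← Matrix.smul_one_eq_diagonal]
  rcases this with rfl | rfl <;> simp [coords_herm]

lemma ker_actHom : actHom.ker = Subgroup.center SLR := by
  ext g
  rw [MonoidHom.mem_ker, Matrix.SpecialLinearGroup.mem_center_iff]
  constructor
  · intro h
    have key (v : Lat) : act (g : Mat) v = v := by
      rw [← actHom_apply, h]
      rfl
    obtain ⟨ε, hε, ht, he⟩ := fix_null g (v := (1, 0, 0, 0)) (by decide) (key _)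
    obtain ⟨ε', -, ht', he'⟩ := fix_null g (v := (0, 0, 0, 1)) (by decide) (key _)
    have hee : ε' = ε := by
      rw [ht] at ht'
      have : (2 : ℤ) * ε = 2 * ε' := by exact_mod_cast ht'
      omega
    subst hee
    refine ⟨ε', by rcases hε with rfl | rfl <;> simp, ?_⟩
    have hs : herm (1, 0, 0, 0) + herm (0, 0, 0, 1) = 1 := by
      ext i j <;> fin_cases i <;> fin_cases j <;> simp [herm]
    have := congrArg₂ (· + ·) he he'
    simp only [← Matrix.mul_add, ← smul_add, hs, Matrix.mul_one] at this
    rw [this, Matrix.scalar_apply, Matrix.smul_one_eq_diagonal]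
  · rintro ⟨r, hr, hg⟩
    exact scalar_mem_ker (by simpa using hr) hg

lemma mapSL_surjective {R S : Type} [CommRing R] [CommRing S] (e : R ≃+* S) :
    Function.Surjective (Matrix.SpecialLinearGroup.map (n := Fin 2) e.toRingHom) := by
  intro g
  refine ⟨Matrix.SpecialLinearGroup.map e.symm.toRingHom g, ?_⟩
  ext i j
  simp

lemma map_mem_center_iff {R S : Type} [CommRing R] [CommRing S] (e : R ≃+* S)
    (g : Matrix.SpecialLinearGroup (Fin 2) R) :
    Matrix.SpecialLinearGroup.map e.toRingHom g ∈ Subgroup.center _ ↔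
      g ∈ Subgroup.center _ := by
  have hinj : Function.Injective (Matrix.SpecialLinearGroup.map (n := Fin 2) e.toRingHom) := by
    intro a b h
    ext i j
    exact e.injective (congrArg (fun x => x i j) h)
  constructor <;> rw [Subgroup.mem_center_iff, Subgroup.mem_center_iff]
  · intro h x
    apply hinj
    rw [map_mul, map_mul, h]
  · intro h x
    obtain ⟨y, rfl⟩ := mapSL_surjective e x
    rw [← map_mul, ← map_mul, h]

/-- `PSL₂` of a ring isomorphic to `ℤ[√-13]` acts faithfully on Hermitian forms. -/
lemma nonempty_PSL2_equiv {S : Type} [CommRing S] (e : S ≃+* R13) :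
    Nonempty (PSL2 S ≃* Gam) := by
  let φ : Matrix.SpecialLinearGroup (Fin 2) S →* Gam :=
    actHom.rangeRestrict.comp (Matrix.SpecialLinearGroup.map e.toRingHom)
  have hφ : Function.Surjective φ :=
    actHom.rangeRestrict_surjective.comp (mapSL_surjective e)
  have hker : Subgroup.center (Matrix.SpecialLinearGroup (Fin 2) S) = φ.ker := by
    ext g
    rw [← map_mem_center_iff e, ← ker_actHom, MonoidHom.mem_ker, MonoidHom.mem_ker]
    exact (Subtype.ext_iff (a1 := φ g) (a2 := 1)).symm
  exact ⟨(QuotientGroup.quotientMulEquivOfEq hker).trans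
    (QuotientGroup.quotientKerEquivOfSurjective φ hφ)⟩

end PSL

lemma finrank_PSL2 {K : Type} [Field K] [NumberField K]
    (hdeg : Module.finrank ℚ K = 2) (hK : ∃ α : K, α ^ 2 = -13) (q : ℕ) (hq : 2 < q) :
    Module.finrank (ZMod 3)
      (GroupHomology (ZMod 3) (PSL2 (NumberField.RingOfIntegers K)) (ZMod 3) q) =
    (if periodSign q = 1 then 2 else 0) + (if periodSign (q - 1) = 1 then 0 else 2) := by
  obtain ⟨α, hα⟩ := hK
  obtain ⟨e⟩ := nonempty_ringEquiv hdeg hα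
  obtain ⟨f⟩ := nonempty_PSL2_equiv e.symm
  obtain ⟨n, rfl⟩ : ∃ n, q = n + 1 := ⟨q - 1, by omega⟩
  obtain ⟨g⟩ := nonempty_groupHomology_equiv (k := ZMod 3) (G := Gam) n
  rw [(barEquiv f (n + 1)).finrank_eq, ← g.finrank_eq, finrank_groupHomology_Gam _ hq]

end O13

/-- The `𝔽₃`-dimensions of the homology of `PSL₂(𝒪₋₁₃)` with trivial `ℤ/3`-coefficients in
degrees `> 2`. -/
theorem f3_homology_PSL2_O13 (K : Type) [Field K] [NumberField K]
    (hdeg : Module.finrank ℚ K = 2) (hK : ∃ α : K, α ^ 2 = -13)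
    (q : ℕ) (hq : 2 < q) :
    ((q % 4 = 0 ∨ q % 4 = 2) → Module.finrank (ZMod 3) (GroupHomology (ZMod 3) (PSL2 (NumberField.RingOfIntegers K)) (ZMod 3) (q)) = 2) ∧
    (q % 4 = 3 → Module.finrank (ZMod 3) (GroupHomology (ZMod 3) (PSL2 (NumberField.RingOfIntegers K)) (ZMod 3) (q)) = 4) ∧
    (q % 4 = 1 → Module.finrank (ZMod 3) (GroupHomology (ZMod 3) (PSL2 (NumberField.RingOfIntegers K)) (ZMod 3) (q)) = 0) := by
  rw [O13.finrank_PSL2 hdeg hK q hq]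
  have h (n : ℕ) : O13.periodSign n = 1 ↔ n % 4 = 0 ∨ n % 4 = 3 := by
    unfold O13.periodSign
    split_ifs with h <;> simp [h]
  simp only [h]
  refine ⟨fun hm => ?_, fun hm => ?_, fun hm => ?_⟩ <;> split_ifs <;> omega
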